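/- For every ε > 0 there exist constants c > 0 and C > 0 such that for all sufficiently large x, |Σ_{n ≤ x} ω(n) − (x·log log x + B₁·x − li_f(x))| ≤ C·x·e^{-c(log x)^{3/5-ε}}. -/

import Mathlib

open Filter Real MeasureTheory
open scoped Classical

/-- `lif x = ∫₂^x {x/t}/log t dt`. -/
noncomputable def lif (x : ℝ) : ℝ := ∫ t in (2:ℝ)..x, Int.fract (x / t) / Real.log t
/-- The Mertens constant `B₁ = γ - Σ_p Σ_{k ≥ 2} 1/(k p^k)`. -/
noncomputable def mertensB1 : ℝ :=
  Real.eulerMascheroniConstant -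
    ∑' p : Nat.Primes, ∑' k : ℕ, 1 / (((k + 2) : ℝ) * ((p : ℕ) : ℝ) ^ (k + 2))

namespace VK

lemma newton_prod {R : Type*} [CommRing R] {k : ℕ} (hu : ∀ j ∈ Finset.Icc 1 k, IsUnit (j : R))
    (x y : Fin k → R) (h : ∀ j ∈ Finset.Icc 1 k, ∑ i, x i ^ j = ∑ i, y i ^ j) (z : R) :
    ∏ i, (z - x i) = ∏ i, (z - y i) := by
  have key : ∀ j ≤ k, MvPolynomial.aeval x (MvPolynomial.esymm (Fin k) ℤ j)
      = MvPolynomial.aeval y (MvPolynomial.esymm (Fin k) ℤ j) := by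
    intro j
    induction j using Nat.strong_induction_on with
    | _ j ih =>
      intro hj
      rcases Nat.eq_zero_or_pos j with rfl | hj0
      · simp
      have hx := congrArg (MvPolynomial.aeval x) (MvPolynomial.mul_esymm_eq_sum (Fin k) ℤ j)
      have hy := congrArg (MvPolynomial.aeval y) (MvPolynomial.mul_esymm_eq_sum (Fin k) ℤ j)
      simp only [map_mul, map_sum, map_pow, map_neg, map_one, map_natCast] at hx hy
      apply (hu j (Finset.mem_Icc.2 ⟨hj0, hj⟩)).mul_left_cancel
      rw [hx, hy]
      congr 1
      refine Finset.sum_congr rfl fun a ha => ?_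
      simp only [Finset.mem_filter, Finset.HasAntidiagonal.mem_antidiagonal] at ha
      rw [ih a.1 ha.2 (by omega)]
      congr 1
      simp only [MvPolynomial.psum, map_sum, map_pow, MvPolynomial.aeval_X]
      exact h a.2 (Finset.mem_Icc.2 ⟨by omega, by omega⟩)
  have e : ∀ w : Fin k → R, ∏ i, (z - w i) =
      ∑ j ∈ Finset.range (k + 1), (-1) ^ j * (MvPolynomial.aeval w (MvPolynomial.esymm (Fin k) ℤ j) * z ^ (k - j)) := by
    intro w
    have := congrArg (Polynomial.eval z) (Multiset.prod_X_sub_X_eq_sum_esymm (Finset.univ.val.map w))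
    simp only [Multiset.map_map, Multiset.card_map, Finset.card_val, Finset.card_univ,
      Fintype.card_fin, Polynomial.eval_finsetSum, Polynomial.eval_mul, Polynomial.eval_pow, Polynomial.eval_neg,
      Polynomial.eval_one, Polynomial.eval_C, Polynomial.eval_X] at this
    simp only [MvPolynomial.aeval_esymm_eq_multiset_esymm]
    rw [← this, Polynomial.eval_multiset_prod]
    simp [Finset.prod, Function.comp_def]
  rw [e, e]
  refine Finset.sum_congr rfl fun j hj => ?_
  rw [key j (by simpa [Nat.lt_succ_iff] using hj)]

lemma linnik_perm {k p : ℕ} (hp : p.Prime) (hk : k < p) (x y : Fin k → ℤ)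
    (hx : ∀ i j, (p : ℤ) ∣ x i - x j → i = j)
    (h : ∀ j ∈ Finset.Icc 1 k, ((p : ℤ) ^ k) ∣ ∑ i, x i ^ j - ∑ i, y i ^ j) (i : Fin k) :
    ∃ l, ((p : ℤ) ^ k) ∣ y i - x l := by
  have hp' : Prime (p : ℤ) := Nat.prime_iff_prime_int.1 hp
  have hz : ((∏ l, (y i - x l) : ℤ) : ZMod (p ^ k)) = 0 := by
    have := newton_prod (R := ZMod (p ^ k)) (k := k) (fun j hj => by
      rw [ZMod.isUnit_iff_coprime]
      simp only [Finset.mem_Icc] at hj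
      exact Nat.Coprime.pow_right _ (Nat.coprime_of_lt_prime (by omega) (by omega) hp).symm)
      (fun l => (x l : ZMod (p ^ k))) (fun l => (y l : ZMod (p ^ k))) (fun j hj => by
        have := h j hj
        rw [← sub_eq_zero]
        have h2 := (ZMod.intCast_zmod_eq_zero_iff_dvd (∑ i, x i ^ j - ∑ i, y i ^ j) (p ^ k)).2 (by exact_mod_cast this)
        push_cast at h2
        exact h2) (y i : ZMod (p ^ k))
    push_cast
    rw [this]
    exact Finset.prod_eq_zero (Finset.mem_univ i) (by simp)
  have hd : ((p : ℤ) ^ k) ∣ ∏ l, (y i - x l) := by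
    have := (ZMod.intCast_zmod_eq_zero_iff_dvd _ (p ^ k)).1 hz
    exact_mod_cast this
  have hkpos : 0 < k := i.pos
  obtain ⟨l, -, hl⟩ := (hp'.dvd_finset_prod_iff _).1 ((dvd_pow_self _ hkpos.ne').trans hd)
  refine ⟨l, ?_⟩
  rw [← Finset.mul_prod_erase _ _ (Finset.mem_univ l)] at hd
  refine IsCoprime.dvd_of_dvd_mul_right ?_ hd
  refine IsCoprime.pow_left (IsCoprime.prod_right fun m hm => ?_)
  rw [hp'.coprime_iff_not_dvd]
  intro hdm
  have : (p : ℤ) ∣ x m - x l := by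
    have := dvd_sub hl hdm
    simpa using this
  exact (Finset.ne_of_mem_erase hm) (hx _ _ this)

lemma card_modEq_le {p k j : ℕ} (hp : 0 < p) (hj : j ≤ k) (m : ℤ) :
    ((Finset.Ico (0:ℤ) (p ^ k)).filter (fun v => (p : ℤ) ^ j ∣ v - m)).card ≤ p ^ (k - j) := by
  have hpj : (0:ℤ) < (p:ℤ) ^ j := by positivity
  have : (Finset.Ico (0:ℤ) ((p:ℤ) ^ (k - j))).card = p ^ (k - j) := by
    rw [Int.card_Ico]; simp
    exact_mod_cast rfl
  rw [← this]
  refine Finset.card_le_card_of_injOn (fun v => v / (p:ℤ) ^ j) ?_ ?_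
  · intro v hv
    simp only [Finset.coe_filter, Finset.mem_Ico, Set.mem_setOf_eq] at hv
    simp only [Finset.coe_Ico, Set.mem_Ico]
    refine ⟨Int.ediv_nonneg hv.1.1 hpj.le, ?_⟩
    apply Int.ediv_lt_of_lt_mul hpj
    rw [← pow_add, Nat.sub_add_cancel hj]; exact hv.1.2
  · intro v hv w hw hvw
    simp only [Finset.coe_filter, Finset.mem_Ico, Set.mem_setOf_eq] at hv hw
    have h1 : v % (p:ℤ)^j = w % (p:ℤ)^j := by

      have := dvd_sub hv.2 hw.2
      rw [show v - m - (w - m) = v - w by ring] at this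
      exact (Int.emod_emod_of_dvd v (dvd_refl _)).symm.trans ((Int.emod_emod_of_dvd v (dvd_refl _)).trans (Int.emod_eq_emod_iff_emod_sub_eq_zero.2 (Int.emod_eq_zero_of_dvd this)))
    rw [← Int.mul_ediv_add_emod v ((p:ℤ)^j), ← Int.mul_ediv_add_emod w ((p:ℤ)^j), h1]
    simp only at hvw
    rw [hvw]

lemma linnik_count {k p : ℕ} (hp : p.Prime) (hk : k < p) (D : Finset ℤ)
    (hD : ∀ a ∈ D, ∀ b ∈ D, ((p : ℤ) ^ k) ∣ a - b → a = b) (m : Fin k → ℤ) :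
    ((Fintype.piFinset (fun _ : Fin k => D)).filter (fun x =>
      (∀ i j, (p : ℤ) ∣ x i - x j → i = j) ∧
      ∀ j : Fin k, (p : ℤ) ^ (j.1 + 1) ∣ ∑ i, x i ^ (j.1 + 1) - m j)).card
      ≤ k ^ k * p ^ (k * (k - 1) / 2) := by
  have hpk : (0:ℤ) < (p:ℤ) ^ k := by have := hp.pos; positivity
  set T : Finset (Fin k → ℤ) := Fintype.piFinset (fun j : Fin k =>
    (Finset.Ico (0:ℤ) (p ^ k)).filter (fun v => (p : ℤ) ^ (j.1 + 1) ∣ v - m j)) with hT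
  have hTc : T.card ≤ p ^ (k * (k - 1) / 2) := by
    rw [hT, Fintype.card_piFinset]
    calc _ ≤ ∏ j : Fin k, p ^ (k - (j.1 + 1)) :=
          Finset.prod_le_prod' fun j _ => card_modEq_le hp.pos j.2 _
      _ = p ^ (k * (k - 1) / 2) := by
          rw [Finset.prod_pow_eq_pow_sum, Fin.sum_univ_eq_sum_range (fun j => k - (j + 1)),
            ← Finset.sum_range_id_mul_two, Nat.mul_div_cancel _ two_pos, ← Finset.sum_range_reflect]
          congr 1
          exact Finset.sum_congr rfl fun j hj => by have := Finset.mem_range.1 hj; omega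
  refine (Finset.card_le_mul_card_image_of_maps_to (t := T)
    (f := fun x j => (∑ i, x i ^ (j.1 + 1)) % (p:ℤ) ^ k) ?_ (k ^ k) ?_).trans
    (Nat.mul_le_mul_left _ hTc)
  · intro x hx
    simp only [Finset.mem_filter] at hx
    simp only [hT, Fintype.mem_piFinset, Finset.mem_filter, Finset.mem_Ico]
    refine fun j => ⟨⟨Int.emod_nonneg _ hpk.ne', Int.emod_lt_of_pos _ hpk⟩, ?_⟩
    have h1 : (p:ℤ) ^ (j.1 + 1) ∣ (∑ i, x i ^ (j.1 + 1)) % (p:ℤ) ^ k - ∑ i, x i ^ (j.1 + 1) := by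
      refine (pow_dvd_pow _ j.2).trans ?_
      rw [← dvd_neg, neg_sub]; exact Int.dvd_self_sub_emod
    have := dvd_add h1 (hx.2.2 j)
    simpa using this
  · intro b _

    by_contra hcon
    obtain ⟨x, hx'⟩ := Finset.card_pos.1 (lt_of_le_of_lt (Nat.zero_le _) (not_le.1 hcon))
    simp only [Finset.mem_filter, Fintype.mem_piFinset] at hx'
    refine hcon ((Finset.card_le_card (t := Finset.univ.image (fun σ : Fin k → Fin k => x ∘ σ)) ?_).trans
      (Finset.card_image_le.trans (by simp)))
    · intro y hy
      simp only [Finset.mem_filter, Fintype.mem_piFinset] at hy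
      have hh : ∀ i, ∃ l, y i = x l := by
        intro i
        obtain ⟨l, hl⟩ := linnik_perm hp hk x y hx'.1.2.1 (fun j hj => by
          simp only [Finset.mem_Icc] at hj
          have h1 := congrFun (hx'.2.trans hy.2.symm) ⟨j - 1, by omega⟩
          simp only [show j - 1 + 1 = j by omega] at h1
          exact Int.ModEq.dvd (Int.ModEq.symm h1)) i
        exact ⟨l, hD _ (hy.1.1 i) _ (hx'.1.1 l) hl⟩
      choose σ hσ using hh
      exact Finset.mem_image.2 ⟨σ, Finset.mem_univ _, funext fun i => (hσ i).symm⟩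

/-- a finite family of characters detecting zero on the ball of radius `M` -/
structure Chars (k : ℕ) (M : ℝ) where
  ι : Type
  ft : Fintype ι
  ne : Nonempty ι
  χ : ι → AddChar (Fin k → ℤ) ℂ
  nrm : ∀ i v, ‖χ i v‖ = 1
  orth : ∀ v, ‖v‖ ≤ M → ∑ i, χ i v = if v = 0 then (Fintype.card ι : ℂ) else 0

attribute [instance] Chars.ft Chars.ne

lemma exists_chars (k : ℕ) (M : ℝ) : Nonempty (Chars k M) := by
  obtain ⟨Q, hQ⟩ := exists_nat_gt (max M 0)
  have hQ0 : 0 < Q := by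
    have := (le_max_right M 0).trans_lt hQ
    exact_mod_cast this
  have : NeZero Q := ⟨hQ0.ne'⟩
  let G := Fin k → ZMod Q
  let pj : (Fin k → ℤ) →+ G :=
    { toFun := fun v j => (v j : ZMod Q)
      map_zero' := by ext j; exact Int.cast_zero
      map_add' := by intro a b; ext j; exact Int.cast_add _ _ }
  refine ⟨⟨AddChar G ℂ, Fintype.ofFinite _, ⟨1⟩, fun ψ => ψ.compAddMonoidHom pj, fun ψ v => ?_, fun v hv => ?_⟩⟩
  · exact AddChar.norm_apply ψ (pj v)
  · have h := AddChar.sum_apply_eq_ite (pj v) (α := G)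
    have hz : pj v = 0 ↔ v = 0 := by
      refine ⟨fun h0 => ?_, fun h0 => by simp [h0]⟩
      funext j
      have h1 := congrFun h0 j
      have h2 : (Q : ℤ) ∣ v j := (ZMod.intCast_zmod_eq_zero_iff_dvd _ _).1 h1
      refine Int.eq_zero_of_abs_lt_dvd h2 ?_
      have h3 : (|v j| : ℝ) ≤ M := by
        have := (norm_le_pi_norm v j).trans hv
        simpa [Int.norm_eq_abs] using this
      have : (|v j| : ℝ) < Q := h3.trans_lt ((le_max_left _ _).trans_lt hQ)
      exact_mod_cast this
    have hcard : (Fintype.card (AddChar G ℂ) : ℂ) = Fintype.card G := by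
      rw [← Nat.card_eq_fintype_card, ← Nat.card_eq_fintype_card, Nat.card_eq_fintype_card (α := G), Nat.card_eq_fintype_card]
      rw [AddChar.card_eq]
    simp only [hz] at h
    rw [Fintype.card_congr (Equiv.refl _)] at hcard
    rw [← hcard] at h
    convert h using 1
    exact Finset.sum_congr (by ext; simp) fun _ _ => rfl

/-- number of coincidences -/
noncomputable def cnt {k : ℕ} {α β : Type*} (X : Finset α) (Y : Finset β) (a : α → Fin k → ℤ) (b : β → Fin k → ℤ) : ℕ :=
  ((X ×ˢ Y).filter (fun z => a z.1 = b z.2)).card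

section
variable {k : ℕ} {M : ℝ} (c : Chars k M) {α β : Type*}

/-- exponential sum -/
noncomputable def Chars.F (X : Finset α) (a : α → Fin k → ℤ) (i : c.ι) : ℂ := ∑ x ∈ X, c.χ i (a x)

lemma cnt_eq {X : Finset α} {Y : Finset β} {a : α → Fin k → ℤ} {b : β → Fin k → ℤ}
    (ha : ∀ x ∈ X, ‖a x‖ ≤ M / 2) (hb : ∀ y ∈ Y, ‖b y‖ ≤ M / 2) :
    (cnt X Y a b : ℂ) * Fintype.card c.ι = ∑ i, c.F X a i * (starRingEnd ℂ) (c.F Y b i) := by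
  have h1 : ∀ i, c.F X a i * (starRingEnd ℂ) (c.F Y b i) = ∑ z ∈ X ×ˢ Y, c.χ i (a z.1 - b z.2) := by
    intro i
    rw [Chars.F, Chars.F, map_sum, Finset.sum_mul_sum, Finset.sum_product]
    refine Finset.sum_congr rfl fun x _ => Finset.sum_congr rfl fun y _ => ?_
    rw [AddChar.map_sub_eq_div, div_eq_mul_inv, ← Complex.inv_eq_conj (c.nrm _ _)]
  rw [Finset.sum_congr rfl fun i _ => h1 i, Finset.sum_comm]
  rw [Finset.sum_congr rfl fun z hz => c.orth (a z.1 - b z.2) (by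
    have := Finset.mem_product.1 hz
    linarith [norm_sub_le (a z.1) (b z.2), ha _ this.1, hb _ this.2])]
  simp only [sub_eq_zero]
  rw [← Finset.sum_filter, Finset.sum_const, nsmul_eq_mul]
  rfl

lemma cnt_le {X : Finset α} {Y : Finset β} {a : α → Fin k → ℤ} {b : β → Fin k → ℤ}
    (ha : ∀ x ∈ X, ‖a x‖ ≤ M / 2) (hb : ∀ y ∈ Y, ‖b y‖ ≤ M / 2) :
    (cnt X Y a b : ℝ) * Fintype.card c.ι ≤ ∑ i, ‖c.F X a i‖ * ‖c.F Y b i‖ := by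
  have := congrArg norm (cnt_eq c ha hb)
  simp only [norm_mul, Complex.norm_natCast] at this
  rw [this]
  refine (norm_sum_le _ _).trans (le_of_eq (Finset.sum_congr rfl fun i _ => ?_))
  simp

lemma cnt_self {X : Finset α} {a : α → Fin k → ℤ} (ha : ∀ x ∈ X, ‖a x‖ ≤ M / 2) :
    (cnt X X a a : ℝ) * Fintype.card c.ι = ∑ i, ‖c.F X a i‖ ^ 2 := by
  have := cnt_eq c ha ha
  simp only [Complex.mul_conj, Complex.normSq_eq_norm_sq] at this
  exact_mod_cast this
end

/-- power vector -/
def pv (k : ℕ) (z : ℤ) : Fin k → ℤ := fun j => z ^ (j.1 + 1)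
/-- power sum vector -/
def ps (k : ℕ) {σ : Type*} [Fintype σ] (x : σ → ℤ) : Fin k → ℤ := ∑ i, pv k (x i)
/-- tuples -/
noncomputable abbrev tup (σ : Type*) [Fintype σ] [DecidableEq σ] (A : Finset ℤ) : Finset (σ → ℤ) := Fintype.piFinset (fun _ => A)
/-- Vinogradov count for a finite set -/
noncomputable def JA (k s : ℕ) (A : Finset ℤ) : ℕ := cnt (tup (Fin s) A) (tup (Fin s) A) (ps k) (ps k)
/-- Vinogradov count -/
noncomputable def J (k s P : ℕ) : ℕ := JA k s (Finset.Ico (0:ℤ) P)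

lemma ps_apply {k : ℕ} {σ : Type*} [Fintype σ] (x : σ → ℤ) (j : Fin k) : ps k x j = ∑ i, x i ^ (j.1 + 1) := by
  simp [ps, pv]

section
variable {k : ℕ} {M : ℝ} (c : Chars k M)
/-- basic sum over a set -/
noncomputable def Chars.f (A : Finset ℤ) (i : c.ι) : ℂ := ∑ z ∈ A, c.χ i (pv k z)

lemma F_pi {σ : Type*} [Fintype σ] [DecidableEq σ] (A : σ → Finset ℤ) (i : c.ι) :
    c.F (Fintype.piFinset A) (ps k) i = ∏ l, c.f (A l) i := by
  simp only [Chars.F, Chars.f, Finset.prod_univ_sum]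
  refine Finset.sum_congr rfl fun x _ => ?_
  exact map_prod (c.χ i).toMonoidHom (fun l => Multiplicative.ofAdd (pv k (x l))) Finset.univ

lemma F_tup {σ : Type*} [Fintype σ] [DecidableEq σ] (A : Finset ℤ) (i : c.ι) :
    c.F (tup σ A) (ps k) i = c.f A i ^ Fintype.card σ := by
  rw [tup, F_pi]; simp

lemma norm_ps_le {σ : Type*} [Fintype σ] [DecidableEq σ] {A : Finset ℤ} {H : ℝ} (hA : ∀ z ∈ A, ‖pv k z‖ ≤ H) {x : σ → ℤ}
    (hx : x ∈ tup σ A) : ‖ps k x‖ ≤ Fintype.card σ * H := by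
  rw [ps]
  refine (norm_sum_le _ _).trans ?_
  refine (Finset.sum_le_card_nsmul _ _ H fun l _ => hA _ (Fintype.mem_piFinset.1 hx l)).trans ?_
  simp

lemma JA_eq {s : ℕ} {A : Finset ℤ} {H : ℝ} (hA : ∀ z ∈ A, ‖pv k z‖ ≤ H) (hM : s * H ≤ M / 2) :
    (JA k s A : ℝ) * Fintype.card c.ι = ∑ i, ‖c.f A i‖ ^ (2 * s) := by
  rw [JA, cnt_self c fun x hx => (norm_ps_le hA hx).trans (by simpa using hM)]
  refine Finset.sum_congr rfl fun i _ => ?_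
  rw [F_tup, norm_pow, ← pow_mul]; simp [mul_comm]

lemma f_le (A : Finset ℤ) (i : c.ι) : ‖c.f A i‖ ≤ A.card := by
  refine (norm_sum_le _ _).trans ?_
  simp [c.nrm]
end

lemma cnt_mono {k : ℕ} {α β : Type*} {X X' : Finset α} {Y Y' : Finset β} {a : α → Fin k → ℤ} {b : β → Fin k → ℤ}
    (h : X ⊆ X') (h' : Y ⊆ Y') : cnt X Y a b ≤ cnt X' Y' a b :=
  Finset.card_le_card (Finset.filter_subset_filter _ (Finset.product_subset_product h h'))

lemma cnt_comm {k : ℕ} {α β : Type*} {X : Finset α} {Y : Finset β} {a : α → Fin k → ℤ} {b : β → Fin k → ℤ} :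
    cnt X Y a b = cnt Y X b a := by
  refine Finset.card_bij' (fun z _ => z.swap) (fun z _ => z.swap) ?_ ?_ ?_ ?_ <;>
    simp +contextual [eq_comm]

/-- bound on power vectors -/
lemma exists_H (k : ℕ) (A : Finset ℤ) : ∃ H : ℝ, 0 ≤ H ∧ ∀ z ∈ A, ‖pv k z‖ ≤ H :=
  ⟨∑ z ∈ A, ‖pv k z‖, Finset.sum_nonneg fun _ _ => norm_nonneg _,
    fun _ hz => Finset.single_le_sum (f := fun z => ‖pv k z‖) (fun _ _ => norm_nonneg _) hz⟩

lemma JA_succ (k s t : ℕ) (A : Finset ℤ) : JA k (s + t) A ≤ A.card ^ (2 * t) * JA k s A := by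
  obtain ⟨H, hH0, hH⟩ := exists_H k A
  obtain ⟨c⟩ := exists_chars k (2 * ((s + t) * H))
  have h1 := JA_eq c (s := s + t) hH (by push_cast; linarith)
  have h2 := JA_eq c (s := s) hH (by
    have : 0 ≤ (t:ℝ) * H := by positivity
    linarith)
  have hc : (0:ℝ) < Fintype.card c.ι := by exact_mod_cast Fintype.card_pos
  have : (JA k (s + t) A : ℝ) ≤ A.card ^ (2 * t) * JA k s A := by
    refine le_of_mul_le_mul_right ?_ hc
    rw [h1, mul_assoc, h2, Finset.mul_sum]
    refine Finset.sum_le_sum fun i _ => ?_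
    rw [mul_add, pow_add, mul_comm]
    gcongr
    exact f_le c A i
  exact_mod_cast this

/-- number of representations is maximal at zero shift -/
lemma cnt_shift_le {k s : ℕ} (A : Finset ℤ) (v : Fin k → ℤ) :
    cnt (tup (Fin s) A) (tup (Fin s) A) (ps k) (fun y => ps k y + v) ≤ JA k s A := by
  obtain ⟨H, hH0, hH⟩ := exists_H k A
  obtain ⟨c⟩ := exists_chars k (2 * (s * H + ‖v‖))
  have h1 := JA_eq c (s := s) hH (by linarith [norm_nonneg v])
  have h2 := cnt_le c (X := tup (Fin s) A) (Y := tup (Fin s) A) (a := ps k) (b := fun y => ps k y + v)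
    (fun x hx => (norm_ps_le hH hx).trans (by simp)) (fun x hx => (norm_add_le _ _).trans (by
      have := norm_ps_le hH hx
      simp at this ⊢
      linarith))
  have hc : (0:ℝ) < Fintype.card c.ι := by exact_mod_cast Fintype.card_pos
  have : (cnt (tup (Fin s) A) (tup (Fin s) A) (ps k) (fun y => ps k y + v) : ℝ) ≤ JA k s A := by
    refine le_of_mul_le_mul_right (h2.trans ?_) hc
    rw [h1]
    refine Finset.sum_le_sum fun i _ => ?_
    have e : c.F (tup (Fin s) A) (fun y => ps k y + v) i = c.F (tup (Fin s) A) (ps k) i * c.χ i v := by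
      simp [Chars.F, Finset.sum_mul, AddChar.map_add_eq_mul]
    rw [e, F_tup, norm_mul, c.nrm, norm_pow, mul_one, ← pow_add]
    simp [two_mul]
  exact_mod_cast this

lemma ps_shift {k : ℕ} {σ : Type*} [Fintype σ] (x y : σ → ℤ) (h : ps k x = ps k y) (c : ℤ) :
    ps k (fun i => x i - c) = ps k (fun i => y i - c) := by
  funext j
  simp only [ps_apply, sub_eq_add_neg, add_pow]
  rw [Finset.sum_comm, Finset.sum_comm (s := Finset.univ)]
  refine Finset.sum_congr rfl fun m hm => ?_
  rw [← Finset.sum_mul, ← Finset.sum_mul, ← Finset.sum_mul, ← Finset.sum_mul]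
  congr 2
  rcases m with _ | m
  · simp
  · have := congrFun h ⟨m, by have := Finset.mem_range.1 hm; have := j.2; omega⟩
    simpa only [ps_apply] using this

lemma ps_shift2 {k s : ℕ} (x y : Fin k → ℤ) (u v : Fin s → ℤ) (h : ps k x + ps k u = ps k y + ps k v) (c : ℤ) :
    ps k (fun i => x i - c) + ps k (fun i => u i - c) = ps k (fun i => y i - c) + ps k (fun i => v i - c) := by
  have := ps_shift (k := k) (Sum.elim x u) (Sum.elim y v) (by
    simpa [ps, Fintype.sum_sum_type] using h) c
  simpa [ps, Fintype.sum_sum_type] using this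

/-- residue class in an initial segment -/
noncomputable def rc (P p : ℕ) (c : ℤ) : Finset ℤ := (Finset.Ico (0:ℤ) P).filter (fun z => z % p = c)

lemma ps_rc {k s P p : ℕ} {c : ℤ} {u : Fin s → ℤ} (hu : u ∈ tup (Fin s) (rc P p c)) (j : Fin k) :
    ps k (fun i => u i - c) j = (p:ℤ) ^ (j.1 + 1) * ps k (fun i => u i / p) j := by
  simp only [ps_apply, Finset.mul_sum, ← mul_pow]
  refine Finset.sum_congr rfl fun i _ => ?_
  have h1 := (Finset.mem_filter.1 (Fintype.mem_piFinset.1 hu i)).2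
  congr 1
  have := Int.mul_ediv_add_emod (u i) p
  rw [h1] at this; linarith

lemma rc_div_mem {s P p R : ℕ} {c : ℤ} (hp : 0 < p) (hR : P ≤ p * R) {u : Fin s → ℤ} (hu : u ∈ tup (Fin s) (rc P p c)) :
    (fun i => u i / (p:ℤ)) ∈ tup (Fin s) (Finset.Ico (0:ℤ) R) := by
  refine Fintype.mem_piFinset.2 fun i => ?_
  have h1 := Finset.mem_Ico.1 (Finset.mem_filter.1 (Fintype.mem_piFinset.1 hu i)).1
  have hp' : (0:ℤ) < p := by exact_mod_cast hp
  refine Finset.mem_Ico.2 ⟨Int.ediv_nonneg h1.1 hp'.le, Int.ediv_lt_of_lt_mul hp' ?_⟩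
  calc u i < P := h1.2
    _ ≤ R * p := by rw [mul_comm]; exact_mod_cast hR

lemma rc_div_inj {s P p : ℕ} {c : ℤ} {u u' : Fin s → ℤ} (hu : u ∈ tup (Fin s) (rc P p c))
    (hu' : u' ∈ tup (Fin s) (rc P p c)) (h : (fun i => u i / (p:ℤ)) = (fun i => u' i / (p:ℤ))) : u = u' := by
  funext i
  have h1 := (Finset.mem_filter.1 (Fintype.mem_piFinset.1 hu i)).2
  have h2 := (Finset.mem_filter.1 (Fintype.mem_piFinset.1 hu' i)).2
  have h3 := congrFun h i
  rw [← Int.mul_ediv_add_emod (u i) p, ← Int.mul_ediv_add_emod (u' i) p, h1, h2, h3]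

/-- fibre count -/
lemma fib_le {k s P p R : ℕ} {c : ℤ} (hp : 0 < p) (hR : P ≤ p * R) (x y : Fin k → ℤ) :
    ((tup (Fin s) (rc P p c) ×ˢ tup (Fin s) (rc P p c)).filter
      (fun z => ps k x + ps k z.1 = ps k y + ps k z.2)).card ≤ J k s R := by
  refine le_trans ?_ (cnt_shift_le (k := k) (s := s) (Finset.Ico (0:ℤ) R)
    (fun j => (ps k (fun i => y i - c) j - ps k (fun i => x i - c) j) / (p:ℤ) ^ (j.1 + 1)))
  refine Finset.card_le_card_of_injOn (fun z => (fun i => z.1 i / (p:ℤ), fun i => z.2 i / (p:ℤ))) ?_ ?_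
  · rintro ⟨u, v⟩ h
    simp only [Finset.coe_filter, Finset.mem_product, Set.mem_setOf_eq] at h ⊢
    refine ⟨⟨rc_div_mem hp hR h.1.1, rc_div_mem hp hR h.1.2⟩, ?_⟩
    funext j
    have h2 := congrFun (ps_shift2 x y u v h.2 c) j
    simp only [Pi.add_apply] at h2 ⊢
    rw [ps_rc h.1.1, ps_rc h.1.2] at h2
    have hpj : (p:ℤ) ^ (j.1 + 1) ≠ 0 := by positivity
    rw [← sub_eq_iff_eq_add']
    refine (Int.ediv_eq_of_eq_mul_right hpj ?_).symm
    linarith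
  · rintro ⟨u, v⟩ h ⟨u', v'⟩ h' he
    simp only [Finset.coe_filter, Finset.mem_product, Set.mem_setOf_eq] at h h'
    simp only [Prod.mk.injEq] at he ⊢
    exact ⟨rc_div_inj h.1.1 h'.1.1 he.1, rc_div_inj h.1.2 h'.1.2 he.2⟩

lemma JA_rc {k s P p R : ℕ} {c : ℤ} (hp : 0 < p) (hR : P ≤ p * R) : JA k s (rc P p c) ≤ J k s R := by
  have := fib_le (k := k) (s := s) (c := c) hp hR (fun _ => 0) (fun _ => 0)
  simp only [add_right_inj] at this
  exact this

/-- good tuples -/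
noncomputable def gd (k p P : ℕ) : Finset (Fin k → ℤ) :=
  (tup (Fin k) (Finset.Ico (0:ℤ) P)).filter (fun x => ∀ i j, (p : ℤ) ∣ x i - x j → i = j)

/-- tuples split in two groups -/
def ps2 (k s : ℕ) (z : (Fin k → ℤ) × (Fin s → ℤ)) : Fin k → ℤ := ps k z.1 + ps k z.2

lemma tup_card (n P : ℕ) : (tup (Fin n) (Finset.Ico (0:ℤ) P)).card = P ^ n := by simp [tup]

lemma good_le {k s P p R : ℕ} {c : ℤ} (hp : p.Prime) (hk : k < p) (hR : P ≤ p * R) (hP : P ≤ p ^ k) :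
    cnt (gd k p P ×ˢ tup (Fin s) (rc P p c)) (gd k p P ×ˢ tup (Fin s) (rc P p c)) (ps2 k s) (ps2 k s) ≤
      J k s R * ((k ^ k * p ^ (k * (k - 1) / 2)) * P ^ k) := by
  set T := (gd k p P ×ˢ gd k p P).filter (fun z => ∀ j : Fin k,
    (p:ℤ) ^ (j.1 + 1) ∣ ps k (fun i => z.1 i - c) j - ps k (fun i => z.2 i - c) j) with hT
  have hTc : T.card ≤ (k ^ k * p ^ (k * (k - 1) / 2)) * P ^ k := by
    rw [← tup_card k P]
    refine Finset.card_le_mul_card_image_of_maps_to (f := fun z => z.2) ?_ _ ?_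
    · intro z hz
      exact (Finset.mem_filter.1 (Finset.mem_product.1 (Finset.mem_filter.1 hz).1).2).1
    · intro y hy
      refine le_trans ?_ (linnik_count hp hk (Finset.Ico (-c) (P - c)) ?_ (fun j => ps k (fun i => y i - c) j))
      · refine Finset.card_le_card_of_injOn (fun z i => z.1 i - c) ?_ ?_
        · rintro ⟨x, y'⟩ h
          simp only [hT, gd, Finset.coe_filter, Finset.mem_product, Finset.mem_filter, Set.mem_setOf_eq,
            Fintype.mem_piFinset, Finset.mem_Ico] at h ⊢
          obtain ⟨⟨⟨hx, -⟩, hd⟩, rfl⟩ := h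
          refine ⟨fun i => ⟨by linarith [(hx.1 i).1], by linarith [(hx.1 i).2]⟩, fun i j hij => hx.2 i j (by simpa using hij), ?_⟩
          intro j
          simpa only [ps_apply] using hd j
        · rintro ⟨x, y'⟩ h ⟨x', y''⟩ h' he
          simp only [Finset.coe_filter, Set.mem_setOf_eq] at h h'
          refine Prod.ext (funext fun i => ?_) (h.2.trans h'.2.symm)
          have := congrFun he i
          simpa using this
      · intro a ha b hb hab
        rw [Finset.mem_Ico] at ha hb
        have : a - b = 0 := Int.eq_zero_of_abs_lt_dvd hab (by
          have : (P:ℤ) ≤ (p:ℤ) ^ k := by exact_mod_cast hP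
          rw [abs_lt]; constructor <;> linarith)
        linarith
  refine le_trans ?_ (Nat.mul_le_mul_left _ hTc)
  refine Finset.card_le_mul_card_image_of_maps_to (f := fun z => (z.1.1, z.2.1)) ?_ _ ?_
  · rintro ⟨⟨x, u⟩, ⟨y, v⟩⟩ h
    simp only [Finset.mem_filter, Finset.mem_product] at h
    refine Finset.mem_filter.2 ⟨Finset.mem_product.2 ⟨h.1.1.1, h.1.2.1⟩, fun j => ?_⟩
    have h2 := congrFun (ps_shift2 x y u v h.2 c) j
    simp only [Pi.add_apply] at h2
    rw [ps_rc h.1.1.2, ps_rc h.1.2.2] at h2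
    refine ⟨ps k (fun i => v i / p) j - ps k (fun i => u i / p) j, ?_⟩
    simp only
    linarith
  · rintro ⟨x, y⟩ -
    refine le_trans ?_ (fib_le (k := k) (s := s) (c := c) hp.pos hR x y)
    refine Finset.card_le_card_of_injOn (fun z => (z.1.2, z.2.2)) ?_ ?_
    · rintro ⟨⟨x', u⟩, ⟨y', v⟩⟩ h
      simp only [Finset.coe_filter, Finset.mem_product, Finset.mem_filter, Set.mem_setOf_eq, Prod.mk.injEq] at h ⊢
      obtain ⟨⟨h1, h2⟩, rfl, rfl⟩ := h
      exact ⟨⟨h1.1.2, h1.2.2⟩, h2⟩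
    · rintro ⟨⟨x', u⟩, ⟨y', v⟩⟩ h ⟨⟨x'', u'⟩, ⟨y'', v'⟩⟩ h' he
      simp only [Finset.coe_filter, Set.mem_setOf_eq, Prod.mk.injEq] at h h' he ⊢
      exact ⟨⟨h.2.1.trans h'.2.1.symm, he.1⟩, h.2.2.trans h'.2.2.symm, he.2⟩

lemma F_prod {k : ℕ} {M : ℝ} (c : Chars k M) {s : ℕ} (X : Finset (Fin k → ℤ)) (Y : Finset (Fin s → ℤ)) (i : c.ι) :
    c.F (X ×ˢ Y) (ps2 k s) i = c.F X (ps k) i * c.F Y (ps k) i := by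
  simp only [Chars.F, Finset.sum_mul_sum, Finset.sum_product, ps2, AddChar.map_add_eq_mul]

lemma f_split {k : ℕ} {M : ℝ} (c : Chars k M) {P p : ℕ} (hp : 0 < p) (i : c.ι) :
    c.f (Finset.Ico (0:ℤ) P) i = ∑ r ∈ Finset.Ico (0:ℤ) p, c.f (rc P p r) i := by
  simp only [Chars.f, rc]
  refine (Finset.sum_fiberwise_of_maps_to (fun z _ => ?_) _).symm
  have : (0:ℤ) < p := by exact_mod_cast hp
  exact Finset.mem_Ico.2 ⟨Int.emod_nonneg _ this.ne', Int.emod_lt_of_pos _ this⟩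

lemma young {a b τ : ℝ} (ha : 0 ≤ a) (hb : 0 ≤ b) (hτ : 0 < τ) (n : ℕ) :
    a * b ^ n ≤ τ⁻¹ * b ^ (n + 1) + τ ^ n * a ^ (n + 1) := by
  rcases le_total (τ * a) b with h | h
  · have h1 : a ≤ τ⁻¹ * b := by rw [le_inv_mul_iff₀ hτ]; exact h
    have : a * b ^ n ≤ τ⁻¹ * b ^ (n + 1) := by
      calc a * b ^ n ≤ (τ⁻¹ * b) * b ^ n := by gcongr
        _ = _ := by ring
    have : 0 ≤ τ ^ n * a ^ (n + 1) := by positivity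
    linarith
  · have : a * b ^ n ≤ τ ^ n * a ^ (n + 1) := by
      calc a * b ^ n ≤ a * (τ * a) ^ n := by gcongr
        _ = _ := by rw [mul_pow]; ring
    have : 0 ≤ τ⁻¹ * b ^ (n + 1) := by positivity
    linarith

/-- bad tuples -/
noncomputable def bd (k s p P : ℕ) (i j : Fin k) (r : ℤ) : Finset ((Fin k → ℤ) × (Fin s → ℤ)) :=
  Fintype.piFinset (fun l => if l = i ∨ l = j then rc P p r else Finset.Ico (0:ℤ) P) ×ˢ tup (Fin s) (Finset.Ico (0:ℤ) P)

/-- all tuples -/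
noncomputable def al (k s P : ℕ) : Finset ((Fin k → ℤ) × (Fin s → ℤ)) :=
  tup (Fin k) (Finset.Ico (0:ℤ) P) ×ˢ tup (Fin s) (Finset.Ico (0:ℤ) P)

lemma bd_sub {k s p P : ℕ} {i j : Fin k} {r : ℤ} : bd k s p P i j r ⊆ al k s P := by
  refine Finset.product_subset_product (Fintype.piFinset_subset _ _ fun l => ?_) subset_rfl
  split_ifs
  · exact Finset.filter_subset _ _
  · exact subset_rfl

lemma mem_bd {k s p P : ℕ} (hp : 0 < p) {z} (hz : z ∈ al k s P) (hg : z.1 ∉ gd k p P) :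
    ∃ q ∈ (Finset.univ : Finset (Fin k)).offDiag ×ˢ Finset.Ico (0:ℤ) p, z ∈ bd k s p P q.1.1 q.1.2 q.2 := by
  obtain ⟨h1, h2⟩ := Finset.mem_product.1 hz
  simp only [gd, Finset.mem_filter, h1, true_and] at hg
  push Not at hg
  obtain ⟨i, j, hd, hij⟩ := hg
  have hp' : (0:ℤ) < p := by exact_mod_cast hp
  refine ⟨((i, j), z.1 i % p), ?_, ?_⟩
  · simp [hij, Int.emod_nonneg _ hp'.ne', Int.emod_lt_of_pos _ hp']
  · refine Finset.mem_product.2 ⟨Fintype.mem_piFinset.2 fun l => ?_, h2⟩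
    have h3 := Fintype.mem_piFinset.1 h1 l
    simp only
    split_ifs with h
    · refine Finset.mem_filter.2 ⟨h3, ?_⟩
      rcases h with rfl | rfl
      · rfl
      · exact Int.modEq_iff_dvd.2 hd
    · exact h3

lemma cnt_split {k s p P : ℕ} (hp : 0 < p) :
    cnt (al k s P) (al k s P) (ps2 k s) (ps2 k s) ≤
      cnt (gd k p P ×ˢ tup (Fin s) (Finset.Ico (0:ℤ) P)) (gd k p P ×ˢ tup (Fin s) (Finset.Ico (0:ℤ) P)) (ps2 k s) (ps2 k s)
      + ∑ q ∈ (Finset.univ : Finset (Fin k)).offDiag ×ˢ Finset.Ico (0:ℤ) p,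
        2 * cnt (bd k s p P q.1.1 q.1.2 q.2) (al k s P) (ps2 k s) (ps2 k s) := by
  set I := (Finset.univ : Finset (Fin k)).offDiag ×ˢ Finset.Ico (0:ℤ) p
  have e : ∀ q : (Fin k × Fin k) × ℤ, 2 * cnt (bd k s p P q.1.1 q.1.2 q.2) (al k s P) (ps2 k s) (ps2 k s) =
     cnt (bd k s p P q.1.1 q.1.2 q.2) (al k s P) (ps2 k s) (ps2 k s) +
     cnt (al k s P) (bd k s p P q.1.1 q.1.2 q.2) (ps2 k s) (ps2 k s) := fun q => by
    rw [two_mul, cnt_comm (X := al k s P)]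
  simp only [e]
  unfold cnt
  refine le_trans (Finset.card_le_card (t := Finset.filter _ _ ∪ I.biUnion (fun q => Finset.filter _ _ ∪ Finset.filter _ _)) ?_)
    ((Finset.card_union_le _ _).trans (Nat.add_le_add_left (Finset.card_biUnion_le.trans
      (Finset.sum_le_sum fun q _ => Finset.card_union_le _ _)) _))
  rintro ⟨x, y⟩ h
  simp only [Finset.mem_filter, Finset.mem_product] at h
  obtain ⟨⟨hx, hy⟩, he⟩ := h
  simp only [Finset.mem_union, Finset.mem_biUnion, Finset.mem_filter, Finset.mem_product, he, and_true]
  by_cases h1 : x.1 ∈ gd k p P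
  · by_cases h2 : y.1 ∈ gd k p P
    · left
      exact ⟨⟨h1, (Finset.mem_product.1 hx).2⟩, ⟨h2, (Finset.mem_product.1 hy).2⟩⟩
    · right
      obtain ⟨q, hq, hb⟩ := mem_bd hp hy h2
      exact ⟨q, hq, Or.inr ⟨hx, hb⟩⟩
  · right
    obtain ⟨q, hq, hb⟩ := mem_bd hp hx h1
    exact ⟨q, hq, Or.inl ⟨hb, hy⟩⟩

set_option maxHeartbeats 1000000 in
theorem linnik_step {k s P p R : ℕ} (hs : 1 ≤ s) (hk2 : 2 ≤ k) (hp : p.Prime) (hk : k < p) (hR : P ≤ p * R) (hP : P ≤ p ^ k) :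
    (J k (s + k) P : ℝ) ≤ 2 * k ^ k * P ^ k * p ^ (2 * s + k * (k - 1) / 2) * J k s R
      + (4 * k ^ 2) ^ (s + k) * p ^ (s + k) * R ^ (2 * k) * J k s R := by
  set A := Finset.Ico (0:ℤ) P with hA
  obtain ⟨H, hH0, hH⟩ := exists_H k A
  obtain ⟨c⟩ := exists_chars k (2 * ((k + s) * H))
  have hN : (0:ℝ) < Fintype.card c.ι := by exact_mod_cast Fintype.card_pos
  set N : ℝ := (Fintype.card c.ι : ℝ) with hNdef
  have hrH : ∀ r, ∀ z ∈ rc P p r, ‖pv k z‖ ≤ H := fun r z hz => hH z (Finset.mem_filter.1 hz).1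
  have hb : ∀ z ∈ al k s P, ‖ps2 k s z‖ ≤ (2 * ((k + s) * H)) / 2 := by
    intro z hz
    have h1 := norm_ps_le hH (Finset.mem_product.1 hz).1
    have h2 := norm_ps_le hH (Finset.mem_product.1 hz).2
    simp only [Fintype.card_fin] at h1 h2
    have := norm_add_le (ps k z.1) (ps k z.2)
    simp only [ps2]; linarith
  set n := s + k with hn
  have hJn : (J k n P : ℝ) * N = ∑ i, ‖c.f A i‖ ^ (2 * n) :=
    JA_eq c hH (by rw [hn]; push_cast; linarith)
  have hJal : (cnt (al k s P) (al k s P) (ps2 k s) (ps2 k s) : ℝ) * N = ∑ i, ‖c.f A i‖ ^ (2 * n) := by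
    rw [cnt_self c hb]
    refine Finset.sum_congr rfl fun i _ => ?_
    rw [al, F_prod, F_tup, F_tup, ← pow_add, norm_pow, ← pow_mul]
    simp [hn, mul_comm, add_comm, A]
  -- bad part
  have hbad : ∀ q ∈ (Finset.univ : Finset (Fin k)).offDiag ×ˢ Finset.Ico (0:ℤ) p,
      (cnt (bd k s p P q.1.1 q.1.2 q.2) (al k s P) (ps2 k s) (ps2 k s) : ℝ) * N ≤
        ∑ i, ‖c.f (rc P p q.2) i‖ ^ 2 * (‖c.f A i‖ ^ 2) ^ (n - 1) := by
    intro q hq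
    refine (cnt_le c (fun z hz => hb z (bd_sub hz)) hb).trans (le_of_eq (Finset.sum_congr rfl fun i _ => ?_))
    rw [al, bd, F_prod, F_prod, F_pi, F_tup, F_tup]
    have hne : q.1.1 ≠ q.1.2 := (Finset.mem_offDiag.1 (Finset.mem_product.1 hq).1).2.2
    have h1 : ∏ l, c.f (if l = q.1.1 ∨ l = q.1.2 then rc P p q.2 else A) i =
        c.f (rc P p q.2) i ^ 2 * c.f A i ^ (k - 2) := by
      simp only [apply_ite (fun B => c.f B i)]
      rw [Finset.prod_ite, Finset.prod_const, Finset.prod_const]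
      have h2 : (Finset.univ.filter (fun l => l = q.1.1 ∨ l = q.1.2)).card = 2 := by
        rw [← Finset.card_pair hne]; congr 1; ext; simp
      have h3 := Finset.card_filter_add_card_filter_not (s := (Finset.univ : Finset (Fin k))) (fun l => l = q.1.1 ∨ l = q.1.2)
      rw [h2, Finset.card_univ, Fintype.card_fin] at h3
      rw [h2]; congr 2; omega
    rw [h1]
    simp only [norm_mul, norm_pow, Fintype.card_fin, ← pow_mul]
    rw [mul_assoc, mul_assoc, ← hA, ← pow_add, ← pow_add, ← pow_add]
    congr 2; omega
  -- good part
  have hgood : (cnt (gd k p P ×ˢ tup (Fin s) A) (gd k p P ×ˢ tup (Fin s) A) (ps2 k s) (ps2 k s) : ℝ) ≤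
      k ^ k * P ^ k * p ^ (2 * s + k * (k - 1) / 2) * J k s R := by
    refine le_of_mul_le_mul_right ?_ hN
    have hsub : gd k p P ×ˢ tup (Fin s) A ⊆ al k s P :=
      Finset.product_subset_product (Finset.filter_subset _ _) subset_rfl
    rw [cnt_self c (fun z hz => hb z (hsub hz))]
    have hrb : ∀ r, ∀ z ∈ gd k p P ×ˢ tup (Fin s) (rc P p r), ‖ps2 k s z‖ ≤ (2 * ((k + s) * H)) / 2 := fun r z hz => by
      refine hb z (Finset.product_subset_product (Finset.filter_subset _ _) ?_ hz)
      exact Fintype.piFinset_subset _ _ fun _ => Finset.filter_subset _ _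
    have ep : (p:ℝ) ^ (2 * s) = (p:ℝ) ^ (2 * s - 1) * p := by rw [← pow_succ, show 2 * s - 1 + 1 = 2 * s by omega]
    calc ∑ i, ‖c.F (gd k p P ×ˢ tup (Fin s) A) (ps2 k s) i‖ ^ 2
        ≤ ∑ i, (p:ℝ) ^ (2 * s - 1) * ∑ r ∈ Finset.Ico (0:ℤ) p, ‖c.F (gd k p P ×ˢ tup (Fin s) (rc P p r)) (ps2 k s) i‖ ^ 2 := by
          refine Finset.sum_le_sum fun i _ => ?_
          simp only [F_prod, F_tup, norm_mul, norm_pow, Fintype.card_fin, mul_pow, ← Finset.mul_sum, ← pow_mul]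
          rw [mul_left_comm ((p:ℝ) ^ _)]
          gcongr
          rw [hA, f_split c hp.pos]
          refine (pow_le_pow_left₀ (norm_nonneg _) (norm_sum_le _ _) _).trans ?_
          have := pow_sum_le_card_mul_sum_pow (s := Finset.Ico (0:ℤ) p) (f := fun r => ‖c.f (rc P p r) i‖) (fun r _ => norm_nonneg _) (2 * s - 1)
          rw [show 2 * s - 1 + 1 = s * 2 by omega] at this
          simpa using this
      _ = (p:ℝ) ^ (2 * s - 1) * ∑ r ∈ Finset.Ico (0:ℤ) p, (cnt (gd k p P ×ˢ tup (Fin s) (rc P p r)) (gd k p P ×ˢ tup (Fin s) (rc P p r)) (ps2 k s) (ps2 k s) : ℝ) * N := by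
          rw [← Finset.mul_sum, Finset.sum_comm]
          congr 1
          exact Finset.sum_congr rfl fun r _ => (cnt_self c (hrb r)).symm
      _ ≤ (p:ℝ) ^ (2 * s - 1) * ∑ r ∈ Finset.Ico (0:ℤ) p, (J k s R * ((k ^ k * p ^ (k * (k - 1) / 2)) * P ^ k) : ℝ) * N := by
          refine mul_le_mul_of_nonneg_left (Finset.sum_le_sum fun r _ => mul_le_mul_of_nonneg_right ?_ hN.le) (by positivity)
          have := (Nat.cast_le (α := ℝ)).2 (good_le (s := s) (c := r) hp hk hR hP)
          simp only [Nat.cast_mul, Nat.cast_pow] at this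
          exact this
      _ = _ := by
          rw [Finset.sum_const, Int.card_Ico, pow_add, ep, sub_zero, Int.toNat_natCast, nsmul_eq_mul]
          ring
  -- assembly
  have hsp := (Nat.cast_le (α := ℝ)).2 (cnt_split (k := k) (s := s) (P := P) hp.pos)
  rw [Nat.cast_add, Nat.cast_sum] at hsp
  simp only [Nat.cast_mul, Nat.cast_ofNat] at hsp
  set a : c.ι → ℝ := fun i => ∑ r ∈ Finset.Ico (0:ℤ) p, ‖c.f (rc P p r) i‖ ^ 2
  have hk0 : (0:ℝ) < k := by have : 0 < k := by omega
                             exact_mod_cast this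
  have hbadsum : (∑ q ∈ (Finset.univ : Finset (Fin k)).offDiag ×ˢ Finset.Ico (0:ℤ) p,
        2 * (cnt (bd k s p P q.1.1 q.1.2 q.2) (al k s P) (ps2 k s) (ps2 k s) : ℝ)) * N ≤
      2 * k ^ 2 * ∑ i, a i * (‖c.f A i‖ ^ 2) ^ (n - 1) := by
    calc _ = ∑ q ∈ (Finset.univ : Finset (Fin k)).offDiag ×ˢ Finset.Ico (0:ℤ) p,
        2 * ((cnt (bd k s p P q.1.1 q.1.2 q.2) (al k s P) (ps2 k s) (ps2 k s) : ℝ) * N) := by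
          rw [Finset.sum_mul]; exact Finset.sum_congr rfl fun _ _ => by ring
      _ ≤ ∑ q ∈ (Finset.univ : Finset (Fin k)).offDiag ×ˢ Finset.Ico (0:ℤ) p,
        2 * ∑ i, ‖c.f (rc P p q.2) i‖ ^ 2 * (‖c.f A i‖ ^ 2) ^ (n - 1) := by
          refine Finset.sum_le_sum fun q hq => ?_
          linarith [hbad q hq]
      _ = ((Finset.univ : Finset (Fin k)).offDiag.card : ℝ) * (2 * ∑ i, a i * (‖c.f A i‖ ^ 2) ^ (n - 1)) := by
          rw [Finset.sum_product]
          simp only [Finset.sum_const, nsmul_eq_mul, ← Finset.mul_sum]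
          rw [Finset.sum_comm]
          simp only [a, Finset.sum_mul]
      _ ≤ k ^ 2 * (2 * ∑ i, a i * (‖c.f A i‖ ^ 2) ^ (n - 1)) := by
          gcongr
          have : ((Finset.univ : Finset (Fin k)).offDiag.card) ≤ k ^ 2 := by
            rw [Finset.offDiag_card]; simp [sq]
          exact_mod_cast this
      _ = _ := by ring
  have hy : ∀ i, a i * (‖c.f A i‖ ^ 2) ^ (n - 1) ≤ (4 * k ^ 2 : ℝ)⁻¹ * ‖c.f A i‖ ^ (2 * n) +
      (4 * k ^ 2 : ℝ) ^ (n - 1) * ((p:ℝ) ^ (n - 1) * ∑ r ∈ Finset.Ico (0:ℤ) p, ‖c.f (rc P p r) i‖ ^ (2 * n)) := by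
    intro i
    have h1 := young (a := a i) (b := ‖c.f A i‖ ^ 2) (τ := 4 * k ^ 2) (Finset.sum_nonneg fun _ _ => by positivity) (by positivity) (by positivity) (n - 1)
    rw [show n - 1 + 1 = n by omega, ← pow_mul _ 2 n] at h1
    refine h1.trans ?_
    gcongr
    have := pow_sum_le_card_mul_sum_pow (s := Finset.Ico (0:ℤ) p) (f := fun r => ‖c.f (rc P p r) i‖ ^ 2) (fun r _ => by positivity) (n - 1)
    rw [show n - 1 + 1 = n by omega] at this
    simpa [← pow_mul] using this
  have hJr : ∀ r, ∑ i, ‖c.f (rc P p r) i‖ ^ (2 * n) ≤ R ^ (2 * k) * J k s R * N := by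
    intro r
    rw [← JA_eq c (hrH r) (by rw [hn]; push_cast; linarith)]
    gcongr
    have h1 : JA k n (rc P p r) ≤ J k n R := JA_rc hp.pos hR
    have h2 := JA_succ k s k (Finset.Ico (0:ℤ) R)
    simp only [Int.card_Ico, sub_zero, Int.toNat_natCast] at h2
    exact_mod_cast h1.trans h2
  have hfin : ∑ i, a i * (‖c.f A i‖ ^ 2) ^ (n - 1) ≤ (4 * k ^ 2 : ℝ)⁻¹ * (J k n P * N) +
      (4 * k ^ 2 : ℝ) ^ (n - 1) * ((p:ℝ) ^ (n - 1) * (p * (R ^ (2 * k) * J k s R * N))) := by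
    refine (Finset.sum_le_sum fun i _ => hy i).trans ?_
    rw [Finset.sum_add_distrib, ← Finset.mul_sum, ← Finset.mul_sum, ← Finset.mul_sum, hJn, Finset.sum_comm]
    gcongr
    refine (Finset.sum_le_sum fun r _ => hJr r).trans (le_of_eq ?_)
    simp
  have hJJ : (J k n P : ℝ) = cnt (al k s P) (al k s P) (ps2 k s) (ps2 k s) :=
    mul_right_cancel₀ hN.ne' (hJn.trans hJal.symm)
  rw [← hJJ] at hsp
  have e1 : (4 * k ^ 2 : ℝ) ^ n = 4 * k ^ 2 * (4 * k ^ 2 : ℝ) ^ (n - 1) := by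
    rw [← pow_succ', show n - 1 + 1 = n by omega]
  have e2 : (p : ℝ) ^ n = p * (p : ℝ) ^ (n - 1) := by
    rw [← pow_succ', show n - 1 + 1 = n by omega]
  refine le_of_mul_le_mul_right ?_ hN
  have h3 := mul_le_mul_of_nonneg_right hsp hN.le
  rw [add_mul] at h3
  have h4 := mul_le_mul_of_nonneg_left hfin (by positivity : (0:ℝ) ≤ 2 * k ^ 2)
  have h5 := mul_le_mul_of_nonneg_right hgood hN.le
  have h6 : (2 * k ^ 2 : ℝ) * ((4 * k ^ 2 : ℝ)⁻¹ * (J k n P * N)) = J k n P * N / 2 := by field_simp; ring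
  rw [e1, e2]
  have h7 := h3.trans (add_le_add h5 (hbadsum.trans h4))
  rw [mul_add, h6] at h7
  linarith

lemma J_triv (k s P : ℕ) : J k s P ≤ P ^ (2 * s) := by
  have := JA_succ k 0 s (Finset.Ico (0:ℤ) P)
  simp only [zero_add, Int.card_Ico, sub_zero, Int.toNat_natCast] at this
  refine this.trans ?_
  have h : JA k 0 (Finset.Ico (0:ℤ) P) ≤ 1 := by
    unfold JA cnt
    refine (Finset.card_filter_le _ _).trans ?_
    simp [tup]
  calc _ ≤ P ^ (2 * s) * 1 := Nat.mul_le_mul_left _ h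
    _ = _ := mul_one _

/-- exponent in the mean value theorem -/
noncomputable def EE (k r : ℕ) : ℝ := 2 * (k ^ 2 + r * k) - k * (k + 1) / 2 + k * (k + 1) / 2 * (1 - 1 / k) ^ r

lemma EE_rec {k : ℕ} (hk : 2 ≤ k) (r : ℕ) : k * EE k (r + 1) = (k - 1) * EE k r + (2 * (k ^ 2 + r * k) + k ^ 2 + k * (k - 1) / 2) := by
  have : (k:ℝ) ≠ 0 := by positivity
  unfold EE
  rw [pow_succ (1 - 1 / (k:ℝ)) r]
  generalize (1 - 1 / (k:ℝ)) ^ r = q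
  push_cast
  field_simp
  ring

lemma EE_bd {k : ℕ} (hk : 2 ≤ k) (r : ℕ) : 0 ≤ EE k r ∧ EE k r ≤ 2 * (k ^ 2 + r * k) ∧ 2 * (k ^ 2 + r * k) - (k:ℝ) ^ 2 ≤ EE k r := by
  have h2 : (2:ℝ) ≤ k := by exact_mod_cast hk
  have h0 : (0:ℝ) ≤ 1 - 1 / k := by
    rw [sub_nonneg, div_le_one (by linarith)]; linarith
  have h1 : (1 - 1 / k : ℝ) ^ r ≤ 1 := pow_le_one₀ h0 (by
    have : (0:ℝ) ≤ 1 / k := by positivity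
    linarith)
  have h3 : (0:ℝ) ≤ (1 - 1 / k : ℝ) ^ r := pow_nonneg h0 r
  have h4 : (0:ℝ) ≤ k * (k + 1) / 2 := by positivity
  have h5 : (k * (k + 1) / 2 : ℝ) ≤ k ^ 2 := by nlinarith
  have h6 : (0:ℝ) ≤ r * k := by positivity
  have h7 := mul_le_of_le_one_right h4 h1
  have h8 := mul_nonneg h4 h3
  unfold EE
  refine ⟨?_, ?_, ?_⟩ <;> nlinarith

theorem vmvt {k : ℕ} (hk : 2 ≤ k) (r P : ℕ) (hP : 1 ≤ P) :
    (J k (k ^ 2 + r * k) P : ℝ) ≤ (4 * k) ^ (k ^ 3 + 6 * r * (k ^ 2 + r * k)) * (P : ℝ) ^ EE k r := by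
  have hk0 : (0:ℝ) < k := by positivity
  have hk2 : (2:ℝ) ≤ k := by exact_mod_cast hk
  induction r generalizing P with
  | zero =>
    have e : EE k 0 = ((2 * k ^ 2 : ℕ) : ℝ) := by simp [EE]
    rw [e, rpow_natCast]
    have h1 : (J k (k ^ 2 + 0 * k) P : ℝ) ≤ (P:ℝ) ^ (2 * k ^ 2) := by
      have := J_triv k (k ^ 2 + 0 * k) P
      simp only [zero_mul, add_zero] at this ⊢
      exact_mod_cast this
    refine h1.trans (le_mul_of_one_le_left (by positivity) (one_le_pow₀ (by linarith)))
  | succ r ih =>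
    have hP1 : (1:ℝ) ≤ P := by exact_mod_cast hP
    have hb := EE_bd hk (r + 1)
    set n := k ^ 2 + (r + 1) * k with hn
    set s := k ^ 2 + r * k with hs
    have hns : n = s + k := by rw [hn, hs]; ring
    have hkk : k ≤ k ^ 2 := by nlinarith
    have hsk : k ^ 2 ≤ s := by rw [hs]; omega
    clear_value n s
    by_cases hsm : P ≤ k ^ k
    · have h1 : (J k n P : ℝ) ≤ (P:ℝ) ^ (2 * n) := by exact_mod_cast J_triv k n P
      have h2 : (P:ℝ) ^ (2 * n) ≤ (P:ℝ) ^ (k ^ 2) * (P : ℝ) ^ EE k (r + 1) := by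
        rw [← rpow_natCast, ← rpow_natCast, ← rpow_add (by linarith)]
        refine rpow_le_rpow_of_exponent_le hP1 ?_
        have := hb.2.2
        rw [hn]; push_cast at this ⊢; linarith
      have h3 : (P:ℝ) ^ (k ^ 2) ≤ (4 * k) ^ (k ^ 3 + 6 * (r + 1) * n) := by
        calc (P:ℝ) ^ (k ^ 2) ≤ ((k:ℝ) ^ k) ^ (k ^ 2) := by gcongr; exact_mod_cast hsm
          _ = (k:ℝ) ^ (k ^ 3) := by rw [← pow_mul]; congr 1; ring
          _ ≤ (4 * k) ^ (k ^ 3) := by gcongr; linarith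
          _ ≤ _ := pow_le_pow_right₀ (by linarith) (by omega)
      exact h1.trans (h2.trans (by gcongr))
    · push Not at hsm
      set Y : ℝ := (P:ℝ) ^ ((1:ℝ) / k) with hY
      have hYk : Y ^ k = P := by
        rw [hY, ← rpow_natCast, ← rpow_mul (by linarith)]; field_simp; simp
      have hY1 : 1 ≤ Y := one_le_rpow hP1 (by positivity)
      have hY0 : 0 < Y := by linarith
      have hkY : (k:ℝ) < Y := by
        refine lt_of_pow_lt_pow_left₀ k hY0.le ?_
        rw [hYk]; exact_mod_cast hsm
      set m := ⌈Y⌉₊ with hm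
      have hmY : Y ≤ m := Nat.le_ceil Y
      have hmY2 : (m:ℝ) ≤ 2 * Y := by have := (Nat.ceil_lt_add_one hY0.le).le; linarith
      have hm0 : m ≠ 0 := by
        have : (0:ℝ) < m := by linarith
        exact_mod_cast this.ne'
      obtain ⟨p, hp, hmp, hpm⟩ := Nat.exists_prime_lt_and_le_two_mul m hm0
      have hpY : Y ≤ p := by
        have : (m:ℝ) ≤ p := by exact_mod_cast hmp.le
        linarith
      have hp4 : (p:ℝ) ≤ 4 * Y := by
        have : (p:ℝ) ≤ 2 * m := by exact_mod_cast hpm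
        linarith
      have hkp : k < p := by
        have : (k:ℝ) < p := by linarith
        exact_mod_cast this
      have hPp : P ≤ p ^ k := by
        have : (P:ℝ) ≤ (p:ℝ) ^ k := by rw [← hYk]; gcongr
        exact_mod_cast this
      set R := P / p + 1 with hR
      have hPR : P ≤ p * R := by
        have := Nat.div_add_mod P p
        have := Nat.mod_lt P hp.pos
        rw [hR, mul_add]; omega
      have hp0 : (0:ℝ) < p := by linarith
      have hRY : (R:ℝ) ≤ 2 * Y ^ (k - 1) := by
        have h1 : ((P / p : ℕ) : ℝ) ≤ P / p := Nat.cast_div_le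
        have h2 : (P:ℝ) / p ≤ Y ^ (k - 1) := by
          rw [div_le_iff₀ hp0, ← hYk]
          calc Y ^ k = Y ^ (k - 1) * Y := by rw [← pow_succ, show k - 1 + 1 = k by omega]
            _ ≤ _ := by gcongr
        have h3 : 1 ≤ Y ^ (k - 1) := one_le_pow₀ hY1
        rw [hR]; push_cast; linarith
      have hstep := linnik_step (s := s) (by have := Nat.pow_pos (n := 2) (show 0 < k by omega); omega) hk hp hkp hPR hPp
      rw [← hns] at hstep
      have hJs : (J k s R : ℝ) ≤ (4 * k) ^ (k ^ 3 + 6 * r * s) * (4 ^ s * Y ^ ((k - 1) * EE k r)) := by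
        refine (ih R (Nat.le_add_left _ _)).trans ?_
        gcongr
        have hb0 := EE_bd hk r
        calc (R:ℝ) ^ EE k r ≤ (2 * Y ^ (k - 1)) ^ EE k r := rpow_le_rpow (by positivity) hRY hb0.1
          _ = 2 ^ EE k r * Y ^ ((k - 1) * EE k r) := by
              rw [mul_rpow (by norm_num) (by positivity), ← rpow_natCast, ← rpow_mul hY0.le, Nat.cast_sub (by omega), Nat.cast_one]
          _ ≤ _ := by
              gcongr
              calc (2:ℝ) ^ EE k r ≤ 2 ^ ((2 * s : ℕ) : ℝ) := by
                    refine rpow_le_rpow_of_exponent_le (by norm_num) ?_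
                    rw [hs]; push_cast; exact hb0.2.1
                _ = 4 ^ s := by rw [rpow_natCast, pow_mul]; norm_num
      set W : ℝ := Y ^ (2 * s + k ^ 2 + k * (k - 1) / 2) with hW
      have hdiv : k * (k - 1) / 2 ≤ k ^ 2 := by
        refine (Nat.div_le_self _ _).trans ?_
        rw [sq]; exact Nat.mul_le_mul_left _ (by omega)
      have hWe : Y ^ ((k - 1) * EE k r) * W = (P:ℝ) ^ EE k (r + 1) := by
        rw [hW, ← hYk, ← rpow_natCast Y k, ← rpow_mul hY0.le, EE_rec hk, rpow_add hY0]
        congr 1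
        rw [← rpow_natCast]
        congr 1
        have : ((k * (k - 1) / 2 : ℕ) : ℝ) = k * (k - 1) / 2 := by
          rw [Nat.cast_div (Nat.even_mul_pred_self k).two_dvd (by norm_num)]
          rw [Nat.cast_mul, Nat.cast_sub (by omega)]; simp
        push_cast at this ⊢
        rw [this, hs]; push_cast; ring
      have t1 : 2 * (k:ℝ) ^ k * P ^ k * p ^ (2 * s + k * (k - 1) / 2) ≤ (4 * k) ^ (4 * n) * W := by
        calc 2 * (k:ℝ) ^ k * P ^ k * p ^ (2 * s + k * (k - 1) / 2)
            ≤ 2 * (k:ℝ) ^ k * (Y ^ k) ^ k * (4 * Y) ^ (2 * s + k * (k - 1) / 2) := by rw [hYk]; gcongr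
          _ = (2 * 4 ^ (2 * s + k * (k - 1) / 2) * (k:ℝ) ^ k) * W := by
              rw [hW, mul_pow, ← pow_mul, pow_add Y, pow_add Y, pow_add Y, sq]; ring
          _ ≤ (4 ^ (4 * n) * k ^ (4 * n)) * W := by
              gcongr
              · calc (2:ℝ) * 4 ^ (2 * s + k * (k - 1) / 2) ≤ 4 * 4 ^ (2 * s + k * (k - 1) / 2) := by gcongr; norm_num
                  _ = 4 ^ (2 * s + k * (k - 1) / 2 + 1) := by ring
                  _ ≤ 4 ^ (4 * n) := pow_le_pow_right₀ (by norm_num) (by omega)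
              · linarith
              · omega
          _ = _ := by rw [mul_pow]
      have t2 : (4 * (k:ℝ) ^ 2) ^ n * p ^ n * R ^ (2 * k) ≤ (4 * k) ^ (4 * n) * W := by
        calc (4 * (k:ℝ) ^ 2) ^ n * p ^ n * R ^ (2 * k)
            ≤ (4 * (k:ℝ) ^ 2) ^ n * (4 * Y) ^ n * (2 * Y ^ (k - 1)) ^ (2 * k) := by gcongr
          _ = 4 ^ (2 * n + k) * k ^ (2 * n) * Y ^ (n + (k - 1) * (2 * k)) := by
              rw [mul_pow, mul_pow, mul_pow, ← pow_mul, ← pow_mul, pow_add, pow_add Y, pow_mul 2 2 k, two_mul n, pow_add 4 n n]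
              norm_num
              ring
          _ ≤ (4 ^ (4 * n) * k ^ (4 * n)) * W := by
              have h1 : (1:ℝ) ≤ k := by linarith
              rw [hW]
              have h2 : n + (k - 1) * (2 * k) ≤ 2 * s + k ^ 2 + k * (k - 1) / 2 := by
                clear * - hns hsk hk
                subst hns
                obtain ⟨j, rfl⟩ : ∃ j, k = j + 1 := ⟨k - 1, by omega⟩
                have : (j + 1) * (j + 1 - 1) / 2 * 2 = (j + 1) * (j + 1 - 1) := Nat.div_mul_cancel (Nat.even_mul_pred_self _).two_dvd
                simp only [Nat.add_sub_cancel] at this ⊢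
                nlinarith
              have h3 := pow_le_pow_right₀ hY1 h2
              have h4 : (4:ℝ) ^ (2 * n + k) ≤ 4 ^ (4 * n) := pow_le_pow_right₀ (by norm_num) (by omega)
              have h5 : (k:ℝ) ^ (2 * n) ≤ k ^ (4 * n) := pow_le_pow_right₀ h1 (by omega)
              gcongr
          _ = _ := by rw [mul_pow]
      calc (J k n P : ℝ) ≤ (2 * (k:ℝ) ^ k * P ^ k * p ^ (2 * s + k * (k - 1) / 2) + (4 * (k:ℝ) ^ 2) ^ n * p ^ n * R ^ (2 * k)) * J k s R := by
            linarith
        _ ≤ ((4 * k) ^ (4 * n) * W + (4 * k) ^ (4 * n) * W) * ((4 * k) ^ (k ^ 3 + 6 * r * s) * (4 ^ s * Y ^ ((k - 1) * EE k r))) := by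
            gcongr
        _ = (2 * 4 ^ s) * (4 * k) ^ (4 * n) * (4 * k) ^ (k ^ 3 + 6 * r * s) * (P:ℝ) ^ EE k (r + 1) := by
            rw [← hWe]; ring
        _ ≤ (4 * k) ^ (2 * n) * (4 * k) ^ (4 * n) * (4 * k) ^ (k ^ 3 + 6 * r * s) * (P:ℝ) ^ EE k (r + 1) := by
            gcongr
            calc (2:ℝ) * 4 ^ s ≤ 4 * 4 ^ s := by gcongr; norm_num
              _ = 4 ^ (s + 1) := by ring
              _ ≤ 4 ^ (2 * n) := pow_le_pow_right₀ (by norm_num) (by omega)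
              _ ≤ _ := by gcongr; linarith
        _ = (4 * k) ^ (2 * n + 4 * n + (k ^ 3 + 6 * r * s)) * (P:ℝ) ^ EE k (r + 1) := by
            rw [pow_add _ (2 * n + 4 * n), pow_add _ (2 * n)]
        _ ≤ _ := by
            refine mul_le_mul_of_nonneg_right (pow_le_pow_right₀ (by linarith) ?_) (by positivity)
            have : r * s ≤ r * n := Nat.mul_le_mul_left _ (by omega)
            nlinarith

/-- bilinear exponential -/
noncomputable def EB {k : ℕ} (γ : Fin k → ℝ) (l m : Fin k → ℤ) : ℂ :=
  Complex.exp (((∑ j, γ j * l j * m j : ℝ) : ℂ) * Complex.I)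

lemma EB_comm {k : ℕ} (γ : Fin k → ℝ) (l m) : EB γ l m = EB γ m l := by
  unfold EB; congr 3; exact Finset.sum_congr rfl fun _ _ => by ring

/-- the character attached to a vector -/
noncomputable def EBc {k : ℕ} (γ : Fin k → ℝ) (l : Fin k → ℤ) : AddChar (Fin k → ℤ) ℂ where
  toFun m := EB γ l m
  map_zero_eq_one' := by simp [EB]
  map_add_eq_mul' a b := by
    simp only [EB, ← Complex.exp_add, ← add_mul]
    congr 2
    rw [← Complex.ofReal_add, ← Finset.sum_add_distrib]
    congr 1
    exact Finset.sum_congr rfl fun j _ => by simp; ring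

lemma EBc_apply {k : ℕ} (γ : Fin k → ℝ) (l m : Fin k → ℤ) : EBc γ l m = EB γ l m := rfl

lemma EB_norm {k : ℕ} (γ : Fin k → ℝ) (l m : Fin k → ℤ) : ‖EB γ l m‖ = 1 := Complex.norm_exp_ofReal_mul_I _

/-- pairs of tuples -/
noncomputable def prs (s M : ℕ) : Finset ((Fin s → ℤ) × (Fin s → ℤ)) :=
  tup (Fin s) (Finset.Ico (0:ℤ) M) ×ˢ tup (Fin s) (Finset.Ico (0:ℤ) M)

lemma prs_card (s M : ℕ) : (prs s M).card = M ^ (2 * s) := by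
  rw [prs, Finset.card_product, tup_card, ← pow_add, two_mul]

lemma pow_expand {k : ℕ} (χ : AddChar (Fin k → ℤ) ℂ) (hχ : ∀ v, ‖χ v‖ = 1) (s M : ℕ) :
    ((‖∑ a ∈ Finset.Ico (0:ℤ) M, χ (pv k a)‖ ^ (2 * s) : ℝ) : ℂ) = ∑ z ∈ prs s M, χ (ps k z.1 - ps k z.2) := by
  have h1 : (∑ a ∈ Finset.Ico (0:ℤ) M, χ (pv k a)) ^ s = ∑ u ∈ tup (Fin s) (Finset.Ico (0:ℤ) M), χ (ps k u) := by
    have := Finset.prod_univ_sum (fun _ : Fin s => Finset.Ico (0:ℤ) M) (fun _ a => χ (pv k a))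
    rw [Finset.prod_const, Finset.card_univ, Fintype.card_fin] at this
    rw [this]
    refine Finset.sum_congr rfl fun u _ => ?_
    exact (map_prod χ.toMonoidHom (fun l => Multiplicative.ofAdd (pv k (u l))) Finset.univ).symm
  rw [mul_comm, pow_mul, ← norm_pow, h1, ← Complex.normSq_eq_norm_sq, ← Complex.mul_conj, map_sum, Finset.sum_mul_sum, prs, Finset.sum_product]
  refine Finset.sum_congr rfl fun x _ => Finset.sum_congr rfl fun y _ => ?_
  rw [AddChar.map_sub_eq_div, div_eq_mul_inv, ← Complex.inv_eq_conj (hχ _)]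

/-- box -/
noncomputable def bx (k s M : ℕ) : Finset (Fin k → ℤ) :=
  Fintype.piFinset (fun j : Fin k => Finset.Icc (-((s * M ^ (j.1 + 1) : ℕ) : ℤ)) ((s * M ^ (j.1 + 1) : ℕ) : ℤ))

lemma diff_mem {k s M : ℕ} {z} (hz : z ∈ prs s M) : ps k z.1 - ps k z.2 ∈ bx k s M := by
  obtain ⟨h1, h2⟩ := Finset.mem_product.1 hz
  refine Fintype.mem_piFinset.2 fun j => ?_
  have key : ∀ u ∈ tup (Fin s) (Finset.Ico (0:ℤ) M), 0 ≤ ps k u j ∧ ps k u j ≤ ((s * M ^ (j.1 + 1) : ℕ) : ℤ) := by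
    intro u hu
    rw [ps_apply]
    have h := fun i => Finset.mem_Ico.1 (Fintype.mem_piFinset.1 hu i)
    refine ⟨Finset.sum_nonneg fun i _ => pow_nonneg (h i).1 _, ?_⟩
    refine (Finset.sum_le_card_nsmul _ _ ((M:ℤ) ^ (j.1 + 1)) fun i _ => pow_le_pow_left₀ (h i).1 (h i).2.le _).trans ?_
    simp
  have a1 := key _ h1
  have a2 := key _ h2
  rw [Finset.mem_Icc, Pi.sub_apply]
  constructor <;> linarith

/-- number of representations -/
noncomputable def nr (k s M : ℕ) (l : Fin k → ℤ) : ℕ := ((prs s M).filter (fun z => ps k z.1 - ps k z.2 = l)).card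

lemma nr_le (k s M : ℕ) (l) : nr k s M l ≤ J k s M := by
  refine le_trans (le_of_eq ?_) (cnt_shift_le (k := k) (s := s) (Finset.Ico (0:ℤ) M) l)
  unfold nr cnt prs
  congr 1
  exact Finset.filter_congr fun z _ => by rw [sub_eq_iff_eq_add']

lemma sum_prs {k s M : ℕ} (h : (Fin k → ℤ) → ℝ) :
    ∑ z ∈ prs s M, h (ps k z.1 - ps k z.2) = ∑ l ∈ bx k s M, nr k s M l * h l := by
  rw [← Finset.sum_fiberwise_of_maps_to (fun z hz => diff_mem (k := k) hz)]
  refine Finset.sum_congr rfl fun l _ => ?_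
  rw [nr, ← nsmul_eq_mul, ← Finset.sum_const]
  exact Finset.sum_congr rfl fun z hz => by rw [(Finset.mem_filter.1 hz).2]

/-- the one-dimensional bilinear sums -/
noncomputable def UU (Y : ℕ) (g : ℝ) : ℝ :=
  ∑ m ∈ Finset.Icc (-(Y:ℤ)) Y, ‖∑ l ∈ Finset.Icc (-(Y:ℤ)) Y, Complex.exp (((g * l * m : ℝ) : ℂ) * Complex.I)‖

theorem double_holder {k s M : ℕ} (hs : 1 ≤ s) (γ : Fin k → ℝ) :
    ‖∑ a ∈ Finset.Ico (0:ℤ) M, ∑ b ∈ Finset.Ico (0:ℤ) M, EB γ (pv k a) (pv k b)‖ ^ (4 * s ^ 2) ≤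
      (M:ℝ) ^ (8 * s ^ 2 - 4 * s) * (J k s M : ℝ) ^ 2 * ∏ j : Fin k, UU (s * M ^ (j.1 + 1)) (γ j) := by
  set A := Finset.Ico (0:ℤ) M with hA
  have hAc : (A.card : ℝ) = M := by simp [hA]
  set G : (Fin k → ℤ) → ℝ := fun l => ‖∑ a ∈ A, EB γ l (pv k a)‖ with hG
  have hG0 : ∀ l, 0 ≤ G l := fun l => norm_nonneg _
  -- step 1
  have s1 : ‖∑ a ∈ A, ∑ b ∈ A, EB γ (pv k a) (pv k b)‖ ^ (2 * s) ≤ (M:ℝ) ^ (2 * s - 1) * ∑ z ∈ prs s M, G (ps k z.1 - ps k z.2) := by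
    calc _ ≤ (∑ a ∈ A, ‖∑ b ∈ A, EB γ (pv k a) (pv k b)‖) ^ (2 * s) := pow_le_pow_left₀ (norm_nonneg _) (norm_sum_le _ _) _
      _ ≤ (M:ℝ) ^ (2 * s - 1) * ∑ a ∈ A, ‖∑ b ∈ A, EB γ (pv k a) (pv k b)‖ ^ (2 * s) := by
          have := pow_sum_le_card_mul_sum_pow (s := A) (f := fun a => ‖∑ b ∈ A, EB γ (pv k a) (pv k b)‖) (fun r _ => norm_nonneg _) (2 * s - 1)
          rwa [show 2 * s - 1 + 1 = 2 * s by omega, hAc] at this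
      _ ≤ _ := by
          gcongr
          have h1 : ∀ a, ((‖∑ b ∈ A, EB γ (pv k a) (pv k b)‖ ^ (2 * s) : ℝ) : ℂ) = ∑ z ∈ prs s M, EB γ (pv k a) (ps k z.1 - ps k z.2) :=
            fun a => pow_expand (EBc γ (pv k a)) (EB_norm γ _) s M
          have h2 : ((∑ a ∈ A, ‖∑ b ∈ A, EB γ (pv k a) (pv k b)‖ ^ (2 * s) : ℝ) : ℂ) =
              ∑ z ∈ prs s M, ∑ a ∈ A, EB γ (ps k z.1 - ps k z.2) (pv k a) := by
            rw [Complex.ofReal_sum, Finset.sum_congr rfl fun a _ => h1 a, Finset.sum_comm]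
            exact Finset.sum_congr rfl fun z _ => Finset.sum_congr rfl fun a _ => EB_comm _ _ _
          have h3 := congrArg norm h2
          rw [Complex.norm_real, norm_of_nonneg (Finset.sum_nonneg fun _ _ => by positivity)] at h3
          rw [h3]
          exact norm_sum_le _ _
  -- step 2
  have s2 : (∑ z ∈ prs s M, G (ps k z.1 - ps k z.2)) ^ s ≤ ((M:ℝ) ^ (2 * s)) ^ (s - 1) * ∑ z ∈ prs s M, G (ps k z.1 - ps k z.2) ^ s := by
    have := pow_sum_le_card_mul_sum_pow (s := prs s M) (f := fun z => G (ps k z.1 - ps k z.2)) (fun r _ => hG0 _) (s - 1)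
    rwa [show s - 1 + 1 = s by omega, prs_card, Nat.cast_pow] at this
  -- step 3
  have s3 : (∑ z ∈ prs s M, G (ps k z.1 - ps k z.2) ^ s) ^ 2 ≤ (J k s M * (M:ℝ) ^ (2 * s)) * ∑ l ∈ bx k s M, G l ^ (2 * s) := by
    rw [sum_prs (fun l => G l ^ s)]
    refine (Finset.sum_mul_sq_le_sq_mul_sq _ _ _).trans ?_
    have h1 : ∑ l ∈ bx k s M, (nr k s M l : ℝ) ^ 2 ≤ J k s M * (M:ℝ) ^ (2 * s) := by
      have h2 := sum_prs (k := k) (s := s) (M := M) (fun _ => 1)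
      rw [Finset.sum_const, prs_card, nsmul_eq_mul, mul_one] at h2
      push_cast at h2
      rw [h2, Finset.mul_sum]
      refine Finset.sum_le_sum fun l _ => ?_
      rw [sq, mul_one]
      gcongr
      exact nr_le _ _ _ _
    have h3 : ∑ l ∈ bx k s M, (G l ^ s) ^ 2 = ∑ l ∈ bx k s M, G l ^ (2 * s) :=
      Finset.sum_congr rfl fun l _ => by rw [← pow_mul, mul_comm]
    rw [h3]
    exact mul_le_mul_of_nonneg_right h1 (Finset.sum_nonneg fun l _ => pow_nonneg (hG0 l) _)
  -- step 4
  have s4 : ∑ l ∈ bx k s M, G l ^ (2 * s) ≤ J k s M * ∏ j : Fin k, UU (s * M ^ (j.1 + 1)) (γ j) := by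
    have h1 : ∀ l, ((G l ^ (2 * s) : ℝ) : ℂ) = ∑ z ∈ prs s M, EB γ l (ps k z.1 - ps k z.2) :=
      fun l => pow_expand (EBc γ l) (EB_norm γ _) s M
    have h2 : ((∑ l ∈ bx k s M, G l ^ (2 * s) : ℝ) : ℂ) = ∑ z ∈ prs s M, ∑ l ∈ bx k s M, EB γ l (ps k z.1 - ps k z.2) := by
      rw [Complex.ofReal_sum, Finset.sum_congr rfl fun a _ => h1 a, Finset.sum_comm]
    have h3 := congrArg norm h2
    rw [Complex.norm_real, norm_of_nonneg (Finset.sum_nonneg fun l _ => pow_nonneg (hG0 l) _)] at h3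
    rw [h3]
    refine (norm_sum_le _ _).trans ?_
    rw [sum_prs (fun m => ‖∑ l ∈ bx k s M, EB γ l m‖)]
    have h4 : ∀ m, ‖∑ l ∈ bx k s M, EB γ l m‖ = ∏ j : Fin k,
        ‖∑ l ∈ Finset.Icc (-((s * M ^ (j.1 + 1) : ℕ) : ℤ)) ((s * M ^ (j.1 + 1) : ℕ) : ℤ), Complex.exp (((γ j * l * m j : ℝ) : ℂ) * Complex.I)‖ := by
      intro m
      rw [← norm_prod, Finset.prod_univ_sum]
      congr 1
      refine Finset.sum_congr rfl fun l _ => ?_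
      rw [EB, ← Complex.exp_sum, Complex.ofReal_sum, Finset.sum_mul]
    calc _ ≤ ∑ m ∈ bx k s M, (J k s M : ℝ) * ‖∑ l ∈ bx k s M, EB γ l m‖ := by
          gcongr with m hm
          exact nr_le _ _ _ _
      _ = _ := by
          rw [← Finset.mul_sum]
          congr 1
          simp only [UU]
          rw [Finset.prod_univ_sum]
          exact Finset.sum_congr rfl fun m _ => h4 m
  set S1 := ∑ z ∈ prs s M, G (ps k z.1 - ps k z.2)
  set S2 := ∑ z ∈ prs s M, G (ps k z.1 - ps k z.2) ^ s
  have hS1 : 0 ≤ S1 := Finset.sum_nonneg fun _ _ => hG0 _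
  have hS2 : 0 ≤ S2 := Finset.sum_nonneg fun _ _ => pow_nonneg (hG0 _) _
  have e1 : 4 * s ^ 2 = 2 * s * (s * 2) := by ring
  rw [e1, pow_mul]
  refine (pow_le_pow_left₀ (by positivity) s1 _).trans ?_
  rw [mul_pow, pow_mul S1]
  calc _ ≤ ((M:ℝ) ^ (2 * s - 1)) ^ (s * 2) * ((((M:ℝ) ^ (2 * s)) ^ (s - 1) * S2) ^ 2) := by gcongr
    _ = ((M:ℝ) ^ (2 * s - 1)) ^ (s * 2) * (((M:ℝ) ^ (2 * s)) ^ (s - 1)) ^ 2 * S2 ^ 2 := by ring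
    _ ≤ ((M:ℝ) ^ (2 * s - 1)) ^ (s * 2) * (((M:ℝ) ^ (2 * s)) ^ (s - 1)) ^ 2 * ((J k s M * (M:ℝ) ^ (2 * s)) * (J k s M * ∏ j : Fin k, UU (s * M ^ (j.1 + 1)) (γ j))) := by
        gcongr
        exact s3.trans (by gcongr)
    _ = (((M:ℝ) ^ (2 * s - 1)) ^ (s * 2) * (((M:ℝ) ^ (2 * s)) ^ (s - 1)) ^ 2 * (M:ℝ) ^ (2 * s)) * (J k s M : ℝ) ^ 2 * ∏ j : Fin k, UU (s * M ^ (j.1 + 1)) (γ j) := by ring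
    _ = _ := by
        congr 2
        rw [← pow_mul, ← pow_mul, ← pow_mul, ← pow_add, ← pow_add]
        congr 1
        obtain ⟨q, rfl⟩ : ∃ q, s = q + 1 := ⟨s - 1, by omega⟩
        rw [show 2 * (q + 1) - 1 = 2 * q + 1 by omega, show q + 1 - 1 = q by omega]
        symm
        apply Nat.sub_eq_of_eq_add
        ring

lemma UU_triv (Y : ℕ) (g : ℝ) : UU Y g ≤ (2 * Y + 1) ^ 2 := by
  have h : ((Finset.Icc (-(Y:ℤ)) Y).card : ℝ) = 2 * Y + 1 := by
    rw [Int.card_Icc]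
    have : ((Y:ℤ) + 1 - -(Y:ℤ)).toNat = 2 * Y + 1 := by omega
    rw [this]; push_cast; ring
  unfold UU
  rw [sq, ← h, ← nsmul_eq_mul, ← Finset.sum_const]
  refine Finset.sum_le_sum fun m _ => (norm_sum_le _ _).trans ?_
  simp only [Complex.norm_exp_ofReal_mul_I]
  simp

lemma geom_bound (Y : ℕ) (x : ℝ) (hx : x ≠ 0) (hx1 : |x| ≤ π) :
    ‖∑ l ∈ Finset.Icc (-(Y:ℤ)) Y, Complex.exp (((x * l : ℝ) : ℂ) * Complex.I)‖ ≤ π / |x| := by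
  have e1 : ∑ l ∈ Finset.Icc (-(Y:ℤ)) Y, Complex.exp (((x * l : ℝ) : ℂ) * Complex.I) =
      Complex.exp (((-(x * Y) : ℝ) : ℂ) * Complex.I) * ∑ i ∈ Finset.range (2 * Y + 1), (Complex.exp (Complex.I * x)) ^ i := by
    rw [Finset.mul_sum]
    refine Finset.sum_nbij' (fun l => (l + Y).toNat) (fun i => (i:ℤ) - Y) ?_ ?_ ?_ ?_ ?_
    · intro l hl; simp only [Finset.mem_Icc, Finset.mem_range] at *; omega
    · intro l hl; simp only [Finset.mem_Icc, Finset.mem_range] at *; omega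
    · intro l hl; simp only [Finset.mem_Icc] at *; omega
    · intro l hl; simp
    · intro l hl
      have h0 : (0:ℤ) ≤ l + Y := by simp only [Finset.mem_Icc] at hl; omega
      have h : (((l + Y).toNat : ℕ) : ℂ) = (l:ℂ) + Y := by
        exact_mod_cast congrArg (Int.cast (R := ℂ)) (Int.toNat_of_nonneg h0)
      rw [← Complex.exp_nat_mul, ← Complex.exp_add, h]
      congr 1; push_cast; ring
  have h2 : 2 / π * |x / 2| ≤ |sin (x / 2)| := by
    refine Real.mul_abs_le_abs_sin ?_
    rw [abs_div, abs_two]; linarith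
  have hx0 : 0 < |x| := abs_pos.2 hx
  have h3 : 2 * |x| / π ≤ ‖Complex.exp (Complex.I * x) - 1‖ := by
    rw [Complex.norm_exp_I_mul_ofReal_sub_one, norm_mul, Real.norm_eq_abs, Real.norm_eq_abs, abs_two]
    rw [abs_div, abs_two] at h2
    calc 2 * |x| / π = 2 * (2 / π * (|x| / 2)) := by ring
      _ ≤ _ := by linarith
  have h4 : 0 < ‖Complex.exp (Complex.I * x) - 1‖ := lt_of_lt_of_le (by positivity) h3
  rw [e1, norm_mul, Complex.norm_exp_ofReal_mul_I, one_mul, geom_sum_eq (by intro h; simp [h] at h4), norm_div]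
  have h5 : ‖Complex.exp (Complex.I * x) ^ (2 * Y + 1) - 1‖ ≤ 2 := by
    refine (norm_sub_le _ _).trans ?_
    rw [norm_pow, mul_comm Complex.I, Complex.norm_exp_ofReal_mul_I]; norm_num
  calc _ ≤ 2 / (2 * |x| / π) := by gcongr
    _ = π / |x| := by field_simp

lemma UU_nowrap (Y : ℕ) (g : ℝ) (hg : g ≠ 0) (h : |g| * Y ≤ π) :
    UU Y g ≤ (2 * Y + 1) + 2 * π * (1 + log Y) / |g| := by
  have hg0 : 0 < |g| := abs_pos.2 hg
  set f : ℤ → ℝ := fun m => if m = 0 then (2 * Y + 1 : ℝ) else π / (|g| * |(m:ℝ)|) with hf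
  have h1 : UU Y g ≤ ∑ m ∈ Finset.Icc (-(Y:ℤ)) Y, f m := by
    refine Finset.sum_le_sum fun m hm => ?_
    by_cases hm0 : m = 0
    · simp only [hf, hm0, if_true]
      refine (norm_sum_le _ _).trans ?_
      simp only [Complex.norm_exp_ofReal_mul_I, Finset.sum_const, nsmul_eq_mul, mul_one, Int.card_Icc]
      have : ((Y:ℤ) + 1 - -(Y:ℤ)).toNat = 2 * Y + 1 := by omega
      rw [this]; push_cast; exact le_rfl
    · simp only [hf, hm0, if_false]
      have hmr : (m:ℝ) ≠ 0 := by exact_mod_cast hm0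
      have := geom_bound Y (g * m) (mul_ne_zero hg hmr) (by
        rw [abs_mul]
        refine le_trans ?_ h
        gcongr
        rw [Finset.mem_Icc] at hm
        exact abs_le.2 ⟨by exact_mod_cast hm.1, by exact_mod_cast hm.2⟩)
      rw [abs_mul] at this
      refine le_trans (le_of_eq ?_) this
      congr 1
      refine Finset.sum_congr rfl fun l _ => ?_
      congr 3; ring
  refine h1.trans ?_
  rw [Finset.sum_Icc_of_even_eq_range (by intro n; simp [hf]), Finset.sum_range_succ']
  have h2 : ∑ k ∈ Finset.range Y, f ((k + 1 : ℕ) : ℤ) = π / |g| * ((harmonic Y : ℚ) : ℝ) := by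
    rw [harmonic]; push_cast; rw [Finset.mul_sum]
    refine Finset.sum_congr rfl fun i _ => ?_
    have : ((i:ℤ) + 1) ≠ 0 := by omega
    simp only [hf, this, if_false]; push_cast
    rw [abs_of_nonneg (a := (i:ℝ) + 1) (by positivity)]; field_simp
  have h3 := harmonic_le_one_add_log Y
  have h4 : f 0 = 2 * Y + 1 := by simp [hf]
  rw [h2, Nat.cast_zero, h4, nsmul_eq_mul]
  have : π / |g| * ((harmonic Y : ℚ) : ℝ) ≤ π / |g| * (1 + log Y) := by gcongr
  calc _ = (2 * (Y:ℝ) + 1) + 2 * (π / |g| * ((harmonic Y : ℚ) : ℝ)) := by push_cast; ring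
    _ ≤ (2 * (Y:ℝ) + 1) + 2 * (π / |g| * (1 + log Y)) := by linarith
    _ = _ := by ring

lemma U_save {L l K N n : ℝ} {j s M : ℕ} (hl : 0 < l) (hK : 1 / 2 ≤ K) (hL : L = K * l) (hN : N = exp l) (hn : N ≤ n) (hn2 : n ≤ 2 * N)
    (hM : exp (2 / 5 * l) / 2 ≤ M) (hM2 : M ≤ exp (2 / 5 * l)) (hs1 : 1 ≤ s) (hs : s ≤ exp (L / 100))
    (hj : 2 * K ≤ j) (hj2 : j ≤ 4 * K) (hj0 : 1 ≤ j) (h12 : 12 * K ≤ L / 100) (h3 : 1 + 3 * L ≤ exp (L / 100)) (g : ℝ)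
    (hg : |g| = exp L / (j * n ^ j)) : UU (s * M ^ j) g ≤ 9 * ((s * M ^ j : ℕ) : ℝ) ^ 2 * exp (-L / 10) := by
  have hN0 : 0 < N := hN ▸ exp_pos _
  have hn0 : 0 < n := by linarith
  have hL0 : 0 < L := by nlinarith
  have hj0' : (0:ℝ) < j := by exact_mod_cast hj0
  have hg0 : g ≠ 0 := by
    intro h; rw [h, abs_zero] at hg
    have : 0 < exp L / (j * n ^ j) := by positivity
    linarith
  have hgp : 0 < |g| := abs_pos.2 hg0
  have hM0 : (0:ℝ) < M := lt_of_lt_of_le (by positivity) hM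
  have hs1' : (1:ℝ) ≤ s := by exact_mod_cast hs1
  have hYe : ((s * M ^ j : ℕ) : ℝ) = s * (M:ℝ) ^ j := by push_cast; ring
  set Y : ℕ := s * M ^ j with hY
  clear_value Y
  have hpM : (M:ℝ) ^ j ≤ exp (2 / 5 * l * j) := by
    rw [mul_comm _ (j:ℝ), exp_nat_mul]; gcongr
  have h16 : (16:ℝ) ^ j ≤ exp (L / 100) := by
    have : (16:ℝ) ≤ exp 3 := by
      have : (2.7:ℝ) ^ 3 ≤ exp 1 ^ 3 := by gcongr; linarith [exp_one_gt_d9]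
      rw [← exp_nat_mul] at this; norm_num at this; linarith
    calc (16:ℝ) ^ j ≤ exp 3 ^ j := by gcongr
      _ = exp (j * 3) := by rw [← exp_nat_mul]
      _ ≤ _ := by gcongr; linarith
  have hpM2 : exp (2 / 5 * l * j) ≤ (M:ℝ) ^ j * 2 ^ j := by
    rw [mul_comm _ (j:ℝ), exp_nat_mul, ← mul_pow]; gcongr; linarith
  have hjl : 2 * L ≤ l * j := by rw [hL]; nlinarith
  have hjl2 : l * j ≤ 4 * L := by rw [hL]; nlinarith
  have hYM : (M:ℝ) ^ j ≤ Y := by rw [hYe]; nlinarith [pow_pos hM0 j]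
  have hY0 : (0:ℝ) < Y := lt_of_lt_of_le (pow_pos hM0 j) hYM
  have hYu : (Y:ℝ) ≤ exp (L / 100 + 2 / 5 * l * j) := by
    rw [hYe, exp_add]; gcongr
  have h2le : (2:ℝ) ^ j ≤ 16 ^ j := by gcongr; norm_num
  have hYl : exp (L / 10) ≤ Y := by
    have h1 : exp (2 / 5 * l * j) ≤ Y * exp (L / 100) := hpM2.trans (by gcongr; linarith)
    have h2 : exp (2 / 5 * l * j) = exp (2 / 5 * l * j - L / 100) * exp (L / 100) := by rw [← exp_add]; ring_nf
    rw [h2] at h1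
    have := le_of_mul_le_mul_right h1 (exp_pos _)
    refine le_trans ?_ this
    gcongr; linarith
  have hnow : |g| * Y ≤ π := by
    have h1 : |g| ≤ exp (L - l * j) := by
      rw [hg, exp_sub, mul_comm l, exp_nat_mul, ← hN]
      gcongr
      calc N ^ j ≤ n ^ j := by gcongr
        _ ≤ j * n ^ j := by nlinarith [pow_pos hn0 j, (by exact_mod_cast hj0 : (1:ℝ) ≤ j)]
    calc |g| * Y ≤ exp (L - l * j) * exp (L / 100 + 2 / 5 * l * j) := by gcongr
      _ = exp (L - l * j + (L / 100 + 2 / 5 * l * j)) := (exp_add _ _).symm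
      _ ≤ exp 0 := by gcongr; linarith
      _ ≤ π := by rw [exp_zero]; linarith [pi_gt_three]
  have hlog : 1 + log Y ≤ exp (L / 100) := by
    have : log Y ≤ L / 100 + 2 / 5 * l * j := by rw [log_le_iff_le_exp hY0]; exact hYu
    linarith
  have hinv : 1 / |g| ≤ Y ^ 2 * exp (-L / 5 + L / 100) := by
    rw [hg, one_div_div, div_le_iff₀ (exp_pos _)]
    have hn' : n ^ j ≤ 2 ^ j * exp (l * j) := by
      rw [mul_comm l, exp_nat_mul, ← mul_pow, ← hN]; gcongr
    have h8 : (j:ℝ) ≤ 2 ^ j := by exact_mod_cast Nat.lt_two_pow_self.le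
    have h5 : exp (4 / 5 * l * j) ≤ Y ^ 2 * 4 ^ j := by
      have : exp (4 / 5 * l * j) = exp (2 / 5 * l * j) ^ 2 := by rw [← exp_nat_mul]; congr 1; push_cast; ring
      rw [this]
      calc _ ≤ ((M:ℝ) ^ j * 2 ^ j) ^ 2 := by gcongr
        _ = ((M:ℝ) ^ j) ^ 2 * 4 ^ j := by rw [mul_pow, ← pow_mul, ← pow_mul, mul_comm j 2, pow_mul, pow_mul]; norm_num
        _ ≤ _ := by gcongr
    calc (j:ℝ) * n ^ j ≤ 2 ^ j * (2 ^ j * exp (l * j)) := by gcongr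
      _ = 4 ^ j * (exp (4 / 5 * l * j) * exp (1 / 5 * l * j)) := by
        rw [← exp_add, ← mul_assoc, ← mul_pow]; congr 1; · norm_num
        · congr 1; ring
      _ ≤ 4 ^ j * ((Y ^ 2 * 4 ^ j) * exp (4 / 5 * L)) := by
        have : 1 / 5 * l * j ≤ 4 / 5 * L := by linarith
        gcongr
      _ = Y ^ 2 * 16 ^ j * exp (4 / 5 * L) := by
        have : (16:ℝ) ^ j = 4 ^ j * 4 ^ j := by rw [← mul_pow]; norm_num
        rw [this]; ring
      _ ≤ Y ^ 2 * exp (L / 100) * exp (4 / 5 * L) := by gcongr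
      _ = Y ^ 2 * exp (-L / 5 + L / 100) * exp L := by rw [mul_assoc, mul_assoc, ← exp_add, ← exp_add]; ring_nf
  refine (UU_nowrap Y g hg0 hnow).trans ?_
  have hY2 : (Y:ℝ) ≤ Y ^ 2 * exp (-L / 10) := by
    have : exp (L / 10) * exp (-L / 10) = 1 := by rw [← exp_add]; ring_nf; exact exp_zero
    calc (Y:ℝ) = Y * (exp (L / 10) * exp (-L / 10)) := by rw [this, mul_one]
      _ ≤ Y * (Y * exp (-L / 10)) := by gcongr
      _ = _ := by ring
  have hY1 : (1:ℝ) ≤ Y := by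
    have : 0 < Y := by exact_mod_cast hY0
    exact_mod_cast this
  have hsm : 2 * π * exp (L / 100) * exp (-L / 5 + L / 100) ≤ 6 * exp (-L / 10) := by
    have e : exp (L / 100) * exp (-L / 5 + L / 100) = exp (-L / 10) * exp (-(8 * L / 100)) := by
      rw [← exp_add, ← exp_add]; ring_nf
    have h1 : exp (-(8 * L / 100)) ≤ 1 / 2 := by
      have : 2 ≤ exp (8 * L / 100) := by linarith [add_one_le_exp (8 * L / 100)]
      rw [exp_neg, inv_eq_one_div]; gcongr
    rw [mul_assoc, e]
    have := pi_lt_four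
    calc 2 * π * (exp (-L / 10) * exp (-(8 * L / 100))) ≤ 2 * 4 * (exp (-L / 10) * (1 / 2)) := by gcongr
      _ ≤ _ := by linarith [exp_pos (-L / 10)]
  have : 2 * π * (1 + log Y) / |g| ≤ 6 * (Y ^ 2 * exp (-L / 10)) := by
    calc 2 * π * (1 + log Y) / |g| = 2 * π * (1 + log Y) * (1 / |g|) := by ring
      _ ≤ 2 * π * exp (L / 100) * (Y ^ 2 * exp (-L / 5 + L / 100)) := by gcongr
      _ = Y ^ 2 * (2 * π * exp (L / 100) * exp (-L / 5 + L / 100)) := by ring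
      _ ≤ Y ^ 2 * (6 * exp (-L / 10)) := by gcongr
      _ = _ := by ring
  linarith

lemma card_mid {K : ℝ} {k : ℕ} (hK : 1 / 2 ≤ K) (hk : 5 * K + 5 ≤ k) :
    K ≤ ((Finset.univ.filter (fun j : Fin k => 2 * K ≤ ((j:ℕ):ℝ) + 1 ∧ ((j:ℕ):ℝ) + 1 ≤ 4 * K)).card : ℝ) := by
  have hc1 : 2 * K ≤ ⌈2 * K⌉₊ := Nat.le_ceil _
  have hc2 : (⌈2 * K⌉₊ : ℝ) < 2 * K + 1 := Nat.ceil_lt_add_one (by linarith)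
  have hc0 : 1 ≤ ⌈2 * K⌉₊ := Nat.one_le_ceil_iff.2 (by linarith)
  obtain ⟨q, hq⟩ : ∃ q, ⌈2 * K⌉₊ = q + 1 := ⟨_, (Nat.sub_add_cancel hc0).symm⟩
  rw [hq] at hc1 hc2; push_cast at hc1 hc2
  have hb : ∀ i < ⌈K⌉₊, (q:ℝ) + i + 1 ≤ 4 * K := by
    intro i hi
    by_cases h1 : 1 ≤ K
    · have : (i:ℝ) < K := Nat.lt_ceil.1 hi
      linarith
    · have : ⌈K⌉₊ ≤ 1 := Nat.ceil_le.2 (by push_cast; linarith)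
      have hi0 : i = 0 := by omega
      have hq1 : ⌈2 * K⌉₊ ≤ 2 := Nat.ceil_le.2 (by push_cast; linarith)
      have : (q:ℝ) ≤ 1 := by exact_mod_cast (by omega : q ≤ 1)
      subst hi0; push_cast; linarith
  have hb' : ∀ i < ⌈K⌉₊, q + i < k := by
    intro i hi
    have := hb i hi
    have : ((q + i : ℕ) : ℝ) < k := by push_cast; linarith
    exact_mod_cast this
  refine (Nat.le_ceil K).trans ?_
  have := Finset.card_le_card_of_injOn (s := Finset.univ (α := Fin ⌈K⌉₊)) (t := Finset.univ.filter (fun j : Fin k => 2 * K ≤ ((j:ℕ):ℝ) + 1 ∧ ((j:ℕ):ℝ) + 1 ≤ 4 * K))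
    (fun i => (⟨q + i.1, hb' i.1 i.2⟩ : Fin k)) (by
      intro i _
      simp only [Finset.coe_filter, Finset.mem_univ, true_and, Set.mem_setOf_eq]
      push_cast
      exact ⟨by linarith [(Nat.cast_nonneg i.1 : (0:ℝ) ≤ i.1)], hb i.1 i.2⟩) (by
      intro a _ b _ h
      simp only [Fin.mk.injEq] at h
      exact Fin.ext (by omega))
  rw [Finset.card_univ, Fintype.card_fin] at this
  exact_mod_cast this

lemma prod_UU {L l K N n : ℝ} {k s M : ℕ} (hl : 0 < l) (hK : 1 / 2 ≤ K) (hL : L = K * l) (hN : N = exp l) (hn : N ≤ n) (hn2 : n ≤ 2 * N)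
    (hM : exp (2 / 5 * l) / 2 ≤ M) (hM2 : M ≤ exp (2 / 5 * l)) (hM1 : 1 ≤ M) (hs1 : 1 ≤ s) (hs : s ≤ exp (L / 100))
    (hk : 5 * K + 5 ≤ k) (h12 : 12 * K ≤ L / 100) (h3 : 1 + 3 * L ≤ exp (L / 100)) (γ : Fin k → ℝ)
    (hg : ∀ j : Fin k, |γ j| = exp L / ((j + 1 : ℕ) * n ^ (j.1 + 1))) :
    ∏ j : Fin k, UU (s * M ^ (j.1 + 1)) (γ j) ≤ (9 * (s:ℝ) ^ 2) ^ k * (M:ℝ) ^ (k * (k + 1)) * exp (-(L * K / 10)) := by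
  have hL0 : 0 < L := by nlinarith
  set w : Fin k → ℝ := fun j => if 2 * K ≤ ((j:ℕ):ℝ) + 1 ∧ ((j:ℕ):ℝ) + 1 ≤ 4 * K then exp (-L / 10) else 1 with hw
  have h1 : ∏ j : Fin k, UU (s * M ^ (j.1 + 1)) (γ j) ≤ ∏ j : Fin k, (9 * (s:ℝ) ^ 2 * ((M:ℝ) ^ (2 * (j.1 + 1))) * w j) := by
    refine Finset.prod_le_prod (fun j _ => Finset.sum_nonneg fun _ _ => norm_nonneg _) fun j _ => ?_
    have e : 9 * (s:ℝ) ^ 2 * ((M:ℝ) ^ (2 * (j.1 + 1))) = 9 * ((s * M ^ (j.1 + 1) : ℕ) : ℝ) ^ 2 := by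
      push_cast; rw [pow_mul']; ring
    rw [e]
    by_cases hj : 2 * K ≤ ((j:ℕ):ℝ) + 1 ∧ ((j:ℕ):ℝ) + 1 ≤ 4 * K
    · simp only [hw, hj, and_self, if_true]
      exact U_save hl hK hL hN hn hn2 hM hM2 hs1 hs (by push_cast; exact hj.1) (by push_cast; exact hj.2) (by omega) h12 h3 (γ j) (hg j)
    · simp only [hw, hj, if_false, mul_one]
      refine (UU_triv _ _).trans ?_
      have : (1:ℝ) ≤ ((s * M ^ (j.1 + 1) : ℕ) : ℝ) := by
        exact_mod_cast Nat.one_le_iff_ne_zero.2 (by positivity)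
      nlinarith
  refine h1.trans ?_
  rw [Finset.prod_mul_distrib, Finset.prod_mul_distrib, Finset.prod_const, Finset.card_univ, Fintype.card_fin]
  have h2 : ∏ j : Fin k, (M:ℝ) ^ (2 * (j.1 + 1)) = (M:ℝ) ^ (k * (k + 1)) := by
    rw [Finset.prod_pow_eq_pow_sum]
    congr 1
    rw [← Finset.mul_sum, Fin.sum_univ_eq_sum_range (fun i => i + 1) k, mul_comm]
    have := Finset.sum_range_id_mul_two (k + 1)
    rw [Finset.sum_range_succ', add_zero] at this
    rw [this]; simp; ring
  rw [h2]
  have h4 : ∏ j, w j ≤ exp (-(L * K / 10)) := by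
    rw [hw, Finset.prod_ite, Finset.prod_const, Finset.prod_const_one, mul_one, ← exp_nat_mul]
    gcongr
    have := card_mid hK hk
    nlinarith
  gcongr

lemma T0_num {L l K δ lM k s : ℝ} (hL0 : 0 < L) (hl : 0 < l) (hK : 1 / 2 ≤ K) (hL : L = K * l) (hkr : 7 ≤ k) (hk17 : k ≤ 17 * K)
    (hsr : s = 11 * k ^ 2) (hδ0 : 0 ≤ δ) (hδ1 : δ ≤ 1 / 10000) (hlM : lM ≤ 2 / 5 * l) (hlM0 : 0 ≤ lM) :
    1322 * k ^ 3 * log (4 * k) + k * log (9 * s ^ 2) ≤ 484 * k ^ 4 * 12 ∧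
    k * (k + 1) * δ * lM + 484 * k ^ 4 * (L / (10 ^ 9 * K ^ 3)) ≤ L * K / 10 := by
  have hlk : log (4 * k) ≤ 4 * k := log_le_self (by linarith)
  have hls : log (9 * s ^ 2) ≤ 66 * k ^ 2 := by
    have : (9 * s ^ 2) = (33 * k ^ 2) ^ 2 := by rw [hsr]; ring
    rw [this, log_pow]
    have := log_le_self (x := 33 * k ^ 2) (by positivity)
    push_cast; linarith
  have a1 : 1322 * k ^ 3 * log (4 * k) ≤ 5288 * k ^ 4 := by
    calc _ ≤ 1322 * k ^ 3 * (4 * k) := by gcongr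
      _ = _ := by ring
  have a2 : k * log (9 * s ^ 2) ≤ 66 * k ^ 4 := by
    calc k * log (9 * s ^ 2) ≤ k * (66 * k ^ 2) := by gcongr
      _ = 66 * k ^ 3 * 1 := by ring
      _ ≤ 66 * k ^ 3 * k := by gcongr; linarith
      _ = _ := by ring
  have a3 : k * (k + 1) * δ * lM ≤ 3 / 100 * (L * K) := by
    have : k * (k + 1) ≤ 2 * (17 * K) ^ 2 := by nlinarith
    calc k * (k + 1) * δ * lM ≤ 2 * (17 * K) ^ 2 * (1 / 10000) * (2 / 5 * l) := by gcongr
      _ = 578 * 2 / 50000 * (L * K) := by rw [hL]; ring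
      _ ≤ _ := by have := mul_pos hL0 (by linarith : 0 < K); linarith
  have a4 : 484 * k ^ 4 * (L / (10 ^ 9 * K ^ 3)) ≤ 5 / 100 * (L * K) := by
    have hK0 : 0 < K := by linarith
    calc 484 * k ^ 4 * (L / (10 ^ 9 * K ^ 3)) ≤ 484 * (17 * K) ^ 4 * (L / (10 ^ 9 * K ^ 3)) := by gcongr
      _ = 484 * 17 ^ 4 / 10 ^ 9 * (L * K) := by field_simp
      _ ≤ _ := by have := mul_pos hL0 hK0; linarith
  have a5 := mul_pos hL0 (by linarith : 0 < K)
  have a6 : (0:ℝ) < k ^ 4 := by positivity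
  exact ⟨by linarith, by linarith⟩

lemma T0_bound {L l K N n : ℝ} {k M : ℕ} (hl : 0 < l) (hK : 1 / 2 ≤ K) (hL : L = K * l) (hN : N = exp l) (hn : N ≤ n) (hn2 : n ≤ 2 * N)
    (hM : exp (2 / 5 * l) / 2 ≤ M) (hM2 : M ≤ exp (2 / 5 * l)) (hM1 : 1 ≤ M)
    (hs : ((11 * k ^ 2 : ℕ) : ℝ) ≤ exp (L / 100))
    (hk : 5 * K + 5 ≤ k) (hk2 : k ≤ 5 * K + 6) (h12 : 12 * K ≤ L / 100) (h3 : 1 + 3 * L ≤ exp (L / 100)) (γ : Fin k → ℝ)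
    (hg : ∀ j : Fin k, |γ j| = exp L / ((j + 1 : ℕ) * n ^ (j.1 + 1))) :
    ‖∑ a ∈ Finset.Ico (0:ℤ) M, ∑ b ∈ Finset.Ico (0:ℤ) M, EB γ (pv k a) (pv k b)‖ ≤
      M ^ 2 * exp (12 - L / (10 ^ 9 * K ^ 3)) := by
  have hk7 : 7 ≤ k := by
    have : (7:ℝ) < (k:ℝ) + 1 := by linarith
    have : 7 < k + 1 := by exact_mod_cast this
    omega
  have hkr : (7:ℝ) ≤ k := by exact_mod_cast hk7
  have hL0 : 0 < L := by nlinarith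
  have hM0 : (0:ℝ) < M := by exact_mod_cast hM1
  set s := 11 * k ^ 2 with hsd
  have hse : k ^ 2 + 10 * k * k = s := by rw [hsd]; ring
  have hsr : (s:ℝ) = 11 * (k:ℝ) ^ 2 := by rw [hsd]; push_cast; ring
  have hs1 : 1 ≤ s := by rw [hsd]; nlinarith
  clear_value s
  set X := ‖∑ a ∈ Finset.Ico (0:ℤ) M, ∑ b ∈ Finset.Ico (0:ℤ) M, EB γ (pv k a) (pv k b)‖ with hX
  have hX0 : 0 ≤ X := norm_nonneg _
  have hdh := double_holder (M := M) hs1 γ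
  rw [← hX] at hdh
  clear_value X
  have hprod := prod_UU hl hK hL hN hn hn2 hM hM2 hM1 hs1 hs hk h12 h3 γ hg
  have hJ := vmvt (by omega : 2 ≤ k) (10 * k) M hM1
  rw [hse] at hJ
  set δ : ℝ := (1 - 1 / (k:ℝ)) ^ (10 * k) with hδ
  have hδ1 : δ ≤ 1 / 10000 := by
    have h1 : 1 - 1 / (k:ℝ) ≤ exp (-(1 / k)) := by linarith [add_one_le_exp (-(1 / (k:ℝ)))]
    have h0 : 0 ≤ 1 - 1 / (k:ℝ) := by
      rw [sub_nonneg, div_le_one (by linarith)]; linarith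
    calc δ ≤ exp (-(1 / k)) ^ (10 * k) := by rw [hδ]; gcongr
      _ = exp (-10) := by rw [← exp_nat_mul]; congr 1; push_cast; field_simp
      _ ≤ 1 / 10000 := by
        have : (2.7:ℝ) ^ 10 ≤ exp 1 ^ 10 := by gcongr; linarith [exp_one_gt_d9]
        rw [← exp_nat_mul] at this
        rw [exp_neg, inv_eq_one_div]
        refine one_div_le_one_div_of_le (by norm_num) ?_
        norm_num at this ⊢; linarith
  have hδ0 : 0 ≤ δ := by rw [hδ]; exact pow_nonneg (by rw [sub_nonneg, div_le_one (by linarith)]; linarith) _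
  have hEE : EE k (10 * k) = 2 * s - k * (k + 1) / 2 + k * (k + 1) / 2 * δ := by
    rw [EE, ← hδ, ← hse]; push_cast; ring
  clear_value δ
  have hlM : log M ≤ 2 / 5 * l := by rw [log_le_iff_le_exp hM0]; exact hM2
  have hlM0 : 0 ≤ log M := log_nonneg (by exact_mod_cast hM1)
  have hJ2 : (J k s M : ℝ) ≤ exp (661 * k ^ 3 * log (4 * k) + (2 * s - k * (k + 1) / 2 + k * (k + 1) / 2 * δ) * log M) := by
    refine hJ.trans (le_of_eq ?_)
    rw [hEE, rpow_def_of_pos hM0, exp_add, ← hse]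
    congr 1
    · rw [← rpow_natCast, rpow_def_of_pos (by linarith)]
      congr 1; push_cast; ring
    · rw [hse]; ring_nf
  set W := 661 * k ^ 3 * log (4 * k) + (2 * s - k * (k + 1) / 2 + k * (k + 1) / 2 * δ) * log M with hW
  clear_value W
  have h8 : (8 * s ^ 2 - 4 * s : ℕ) = (8 * (s:ℝ) ^ 2 - 4 * s) := by
    rw [Nat.cast_sub (by nlinarith)]; push_cast; ring
  have main : X ^ (4 * s ^ 2) ≤ (M ^ 2 * exp (12 - L / (10 ^ 9 * K ^ 3))) ^ (4 * s ^ 2) := by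
    calc X ^ (4 * s ^ 2) ≤ _ := hdh
      _ ≤ exp ((8 * (s:ℝ) ^ 2 - 4 * s) * log M) * exp W ^ 2 *
          (exp (k * log (9 * s ^ 2)) * exp (k * (k + 1) * log M) * exp (-(L * K / 10))) := by
        have e1 : (M:ℝ) ^ (8 * s ^ 2 - 4 * s) = exp ((8 * (s:ℝ) ^ 2 - 4 * s) * log M) := by
          rw [← rpow_natCast, h8, rpow_def_of_pos hM0, mul_comm]
        have e2 : (9 * (s:ℝ) ^ 2) ^ k = exp (k * log (9 * s ^ 2)) := by
          rw [exp_nat_mul, exp_log]; rw [hsr]; positivity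
        have e3 : (M:ℝ) ^ (k * (k + 1)) = exp (k * (k + 1) * log M) := by
          rw [← rpow_natCast, rpow_def_of_pos hM0, mul_comm]; push_cast; rfl
        rw [e1]
        rw [e2, e3] at hprod
        gcongr
        exact Finset.prod_nonneg fun j _ => Finset.sum_nonneg fun _ _ => norm_nonneg _
      _ = exp ((8 * (s:ℝ) ^ 2 - 4 * s) * log M + 2 * W + (k * log (9 * s ^ 2) + k * (k + 1) * log M + -(L * K / 10))) := by
        rw [exp_add, exp_add, exp_add, exp_add, ← exp_nat_mul W]; norm_num
      _ ≤ exp ((4 * s ^ 2 : ℕ) * (2 * log M + (12 - L / (10 ^ 9 * K ^ 3)))) := by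
        refine exp_le_exp.2 ?_
        obtain ⟨b1, b2⟩ := T0_num hL0 hl hK hL hkr (by linarith) hsr hδ0 hδ1 hlM hlM0
        have a7 : ((4 * s ^ 2 : ℕ):ℝ) = 484 * (k:ℝ) ^ 4 := by push_cast; rw [hsr]; ring
        have a8 : (8 * (s:ℝ) ^ 2) = 2 * (484 * (k:ℝ) ^ 4) := by rw [hsr]; ring
        rw [a7, hW, a8]
        linarith
      _ = _ := by
        rw [exp_nat_mul, exp_add, ← log_rpow hM0, exp_log (by positivity)]; norm_num
  exact le_of_pow_le_pow_left₀ (by positivity) (by positivity) main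

/-- `n^{-it}` -/
noncomputable def ee (t : ℝ) (n : ℕ) : ℂ := Complex.exp (((-(t * log n) : ℝ) : ℂ) * Complex.I)

lemma ee_norm (t : ℝ) (n : ℕ) : ‖ee t n‖ = 1 := Complex.norm_exp_ofReal_mul_I _

lemma ee_sum_le (t : ℝ) (s : Finset ℕ) : ‖∑ n ∈ s, ee t n‖ ≤ s.card := by
  refine (norm_sum_le _ _).trans ?_
  simp [ee_norm]

lemma ee_shift (t : ℝ) (N N' h : ℕ) (hN : N ≤ N') :
    ‖∑ n ∈ Finset.Ioc N N', ee t n - ∑ n ∈ Finset.Ioc N N', ee t (n + h)‖ ≤ 2 * h := by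
  have e1 : ∑ n ∈ Finset.Ioc N N', ee t (n + h) = ∑ n ∈ Finset.Ioc (N + h) (N' + h), ee t n := by
    rw [← Finset.map_add_right_Ioc, Finset.sum_map]; rfl
  have h1 := Finset.sum_Ioc_consecutive (fun n => ee t n) hN (by omega : N' ≤ N' + h)
  have h2 := Finset.sum_Ioc_consecutive (fun n => ee t n) (by omega : N ≤ N + h) (by omega : N + h ≤ N' + h)
  have h3 : ∑ n ∈ Finset.Ioc N N', ee t n - ∑ n ∈ Finset.Ioc N N', ee t (n + h) =
      ∑ n ∈ Finset.Ioc N (N + h), ee t n - ∑ n ∈ Finset.Ioc N' (N' + h), ee t n := by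
    rw [e1]; linear_combination h1 - h2
  rw [h3]
  refine (norm_sub_le _ _).trans ?_
  have a1 := ee_sum_le t (Finset.Ioc N (N + h))
  have a2 := ee_sum_le t (Finset.Ioc N' (N' + h))
  simp only [Nat.card_Ioc, Nat.add_sub_cancel_left] at a1 a2
  linarith

lemma ee_taylor {t : ℝ} (ht : 0 ≤ t) {n k : ℕ} {a b : ℤ} {θ : ℝ} (hn : 0 < n) (ha : 0 ≤ a) (hb : 0 ≤ b) (hθ : θ ≤ 1 / 2)
    (hx : (a:ℝ) * b / n ≤ θ) :
    ‖ee t (n + (a * b).toNat) - ee t n * EB (fun j : Fin k => t * (-1 / n) ^ (j.1 + 1) / ((j.1:ℝ) + 1)) (pv k a) (pv k b)‖ ≤ 2 * t * θ ^ (k + 1) := by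
  have hn' : (0:ℝ) < n := by exact_mod_cast hn
  have hab : (0:ℝ) ≤ (a:ℝ) * b := by exact_mod_cast mul_nonneg ha hb
  have hcast : (((a * b).toNat : ℕ) : ℝ) = (a:ℝ) * b := by
    have := congrArg (Int.cast (R := ℝ)) (Int.toNat_of_nonneg (mul_nonneg ha hb))
    push_cast at this; exact this
  set x : ℝ := -((a:ℝ) * b / n) with hxd
  have hx0 : (a:ℝ) * b / n = |x| := by rw [hxd, abs_neg, abs_of_nonneg (by positivity)]
  have hxx : |x| ≤ θ := hx0 ▸ hx
  have hT := Real.abs_log_sub_add_sum_range_le (x := x) (by linarith) k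
  have e1 : log ((n + (a * b).toNat : ℕ) : ℝ) = log n + log (1 - x) := by
    rw [← log_mul (by positivity) (by rw [hxd]; have : 0 ≤ (a:ℝ) * b / n := by positivity
                                      linarith)]
    congr 1; push_cast; rw [hcast, hxd]; field_simp; ring
  have e2 : ∑ j : Fin k, t * (-1 / (n:ℝ)) ^ (j.1 + 1) / ((j.1:ℝ) + 1) * (pv k a j : ℤ) * (pv k b j : ℤ) =
      t * ∑ i ∈ Finset.range k, x ^ (i + 1) / ((i:ℝ) + 1) := by
    rw [Finset.mul_sum, ← Fin.sum_univ_eq_sum_range (fun i => t * (x ^ (i + 1) / ((i:ℝ) + 1)))]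
    refine Finset.sum_congr rfl fun j _ => ?_
    have : x = (-1 / (n:ℝ)) * a * b := by rw [hxd]; ring
    rw [this, mul_pow, mul_pow]; simp only [pv]; push_cast; ring
  have key : ∀ u v w : ℝ, ‖Complex.exp ((u:ℂ) * Complex.I) - Complex.exp ((v:ℂ) * Complex.I) * Complex.exp ((w:ℂ) * Complex.I)‖ ≤ |u - v - w| := by
    intro u v w
    have h : Complex.exp ((u:ℂ) * Complex.I) - Complex.exp ((v:ℂ) * Complex.I) * Complex.exp ((w:ℂ) * Complex.I) =
      Complex.exp (((v + w : ℝ):ℂ) * Complex.I) * (Complex.exp (Complex.I * ((u - v - w : ℝ):ℂ)) - 1) := by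
      rw [mul_sub, ← Complex.exp_add, ← Complex.exp_add, mul_one]; congr 2 <;> (push_cast; ring)
    rw [h, norm_mul, Complex.norm_exp_ofReal_mul_I, one_mul]
    exact (Real.norm_exp_I_mul_ofReal_sub_one_le).trans (le_of_eq (Real.norm_eq_abs _))
  unfold ee EB
  refine (key _ _ _).trans ?_
  rw [e1, e2]
  have : -(t * (log n + log (1 - x))) - -(t * log n) - t * ∑ i ∈ Finset.range k, x ^ (i + 1) / ((i:ℝ) + 1) =
    -(t * (∑ i ∈ Finset.range k, x ^ (i + 1) / ((i:ℝ) + 1) + log (1 - x))) := by ring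
  rw [this, abs_neg, abs_mul, abs_of_nonneg ht]
  calc t * _ ≤ t * (|x| ^ (k + 1) / (1 - |x|)) := by gcongr
    _ ≤ t * (θ ^ (k + 1) / (1 / 2)) := by
      have : 1 / 2 ≤ 1 - |x| := by linarith
      have : 0 ≤ θ := (abs_nonneg x).trans hxx
      gcongr
    _ = _ := by ring

lemma ES_core {L l K t : ℝ} {N N' k M : ℕ} (hl : 10 ≤ l) (hK : 1 / 2 ≤ K) (hL : L = K * l) (hN : (N:ℝ) = exp l) (ht : t = exp L)
    (hM : exp (2 / 5 * l) / 2 ≤ M) (hM2 : M ≤ exp (2 / 5 * l)) (hM1 : 1 ≤ M)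
    (hs : ((11 * k ^ 2 : ℕ) : ℝ) ≤ exp (L / 100))
    (hk : 5 * K + 5 ≤ k) (hk2 : k ≤ 5 * K + 6) (h12 : 12 * K ≤ L / 100) (h3 : 1 + 3 * L ≤ exp (L / 100)) (hNN : N ≤ N') (hNN2 : N' ≤ 2 * N) :
    ‖∑ n ∈ Finset.Ioc N N', ee t n‖ ≤ N * (exp (12 - L / (10 ^ 9 * K ^ 3)) + 2 * exp (-l) + 2 * exp (-(l / 5))) := by
  have hM0 : (0:ℝ) < M := by exact_mod_cast hM1
  have hN0 : 0 < N := by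
    have : (0:ℝ) < N := hN ▸ exp_pos _
    exact_mod_cast this
  set T := Finset.Ico (0:ℤ) M with hT
  have hTc : (T.card : ℝ) = M := by rw [hT]; simp
  set S := ∑ n ∈ Finset.Ioc N N', ee t n with hS
  have hTab : ∀ a ∈ T, 0 ≤ a ∧ (a:ℝ) ≤ M := fun a ha => by
    rw [hT, Finset.mem_Ico] at ha; exact ⟨ha.1, by exact_mod_cast ha.2.le⟩
  have hMM : (M:ℝ) ^ 2 ≤ N * exp (-(l / 5)) := by
    calc (M:ℝ) ^ 2 ≤ exp (2 / 5 * l) ^ 2 := by gcongr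
      _ = exp (l + -(l / 5)) := by rw [← exp_nat_mul]; congr 1; push_cast; ring
      _ = _ := by rw [exp_add, hN]
  have h1 : ‖∑ a ∈ T, ∑ b ∈ T, (S - ∑ n ∈ Finset.Ioc N N', ee t (n + (a * b).toNat))‖ ≤ M ^ 2 * (2 * M ^ 2) := by
    refine (norm_sum_le _ _).trans ((Finset.sum_le_card_nsmul _ _ ((M:ℝ) * (2 * (M:ℝ) ^ 2)) fun a ha => ?_).trans (by rw [nsmul_eq_mul, hTc]; exact le_of_eq (by ring)))
    refine (norm_sum_le _ _).trans ((Finset.sum_le_card_nsmul _ _ (2 * (M:ℝ) ^ 2) fun b hb => ?_).trans (by rw [nsmul_eq_mul, hTc]))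
    refine (ee_shift t N N' _ hNN).trans ?_
    have hcast : (((a * b).toNat : ℕ) : ℝ) = (a:ℝ) * b := by
      have := congrArg (Int.cast (R := ℝ)) (Int.toNat_of_nonneg (mul_nonneg (hTab a ha).1 (hTab b hb).1))
      push_cast at this; exact this
    rw [hcast, sq]
    have := (hTab a ha).1; have := (hTab b hb).1
    gcongr
    · exact (hTab a ha).2
    · exact (hTab b hb).2
  have h2 : ∀ n ∈ Finset.Ioc N N', ‖∑ a ∈ T, ∑ b ∈ T, ee t (n + (a * b).toNat)‖ ≤ M ^ 2 * (exp (12 - L / (10 ^ 9 * K ^ 3)) + 2 * exp (-l)) := by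
    intro n hn
    rw [Finset.mem_Ioc] at hn
    have hnN : (N:ℝ) ≤ n := by exact_mod_cast hn.1.le
    have hn0 : (0:ℝ) < n := lt_of_lt_of_le (by exact_mod_cast hN0) hnN
    have hT0 := T0_bound (by linarith) hK hL hN hnN (by exact_mod_cast hn.2.trans hNN2) hM hM2 hM1 hs hk hk2 h12 h3
      (fun j : Fin k => t * (-1 / n) ^ (j.1 + 1) / ((j.1:ℝ) + 1)) (by
        intro j
        rw [abs_div, abs_mul, abs_pow, abs_div, abs_neg, abs_one, abs_of_pos hn0, ht, abs_of_pos (exp_pos _), abs_of_pos (by positivity)]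
        push_cast; rw [one_div, inv_pow]; field_simp)
    have h3 : ‖∑ a ∈ T, ∑ b ∈ T, (ee t (n + (a * b).toNat) - ee t n * EB (fun j : Fin k => t * (-1 / n) ^ (j.1 + 1) / ((j.1:ℝ) + 1)) (pv k a) (pv k b))‖ ≤ M ^ 2 * (2 * exp (-l)) := by
      refine (norm_sum_le _ _).trans ((Finset.sum_le_card_nsmul _ _ (M * (2 * exp (-l))) fun a ha => ?_).trans (by rw [nsmul_eq_mul, hTc]; exact le_of_eq (by ring)))
      refine (norm_sum_le _ _).trans ((Finset.sum_le_card_nsmul _ _ (2 * exp (-l)) fun b hb => ?_).trans (by rw [nsmul_eq_mul, hTc]))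
      refine (ee_taylor (θ := exp (-(l / 5))) (ht ▸ (exp_pos _).le) (by omega) (hTab a ha).1 (hTab b hb).1 ?_ ?_).trans ?_
      · have : 2 ≤ exp (l / 5) := by linarith [add_one_le_exp (l / 5)]
        rw [exp_neg, inv_eq_one_div]; gcongr
      · rw [div_le_iff₀ hn0]
        calc (a:ℝ) * b ≤ M * M := by
              have := (hTab b hb).1
              gcongr
              · exact (hTab a ha).2
              · exact (hTab b hb).2
          _ = (M:ℝ) ^ 2 := by ring
          _ ≤ _ := hMM
          _ ≤ _ := by rw [mul_comm]; gcongr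
      · rw [mul_assoc, ht, ← exp_nat_mul, ← exp_add]
        gcongr
        push_cast; rw [hL]; nlinarith
    have h4 : ∑ a ∈ T, ∑ b ∈ T, ee t (n + (a * b).toNat) = ∑ a ∈ T, ∑ b ∈ T, (ee t (n + (a * b).toNat) - ee t n * EB (fun j : Fin k => t * (-1 / n) ^ (j.1 + 1) / ((j.1:ℝ) + 1)) (pv k a) (pv k b))
       + ee t n * ∑ a ∈ T, ∑ b ∈ T, EB (fun j : Fin k => t * (-1 / n) ^ (j.1 + 1) / ((j.1:ℝ) + 1)) (pv k a) (pv k b) := by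
      simp only [Finset.sum_sub_distrib, Finset.mul_sum]; ring
    rw [h4]
    refine (norm_add_le _ _).trans ?_
    rw [norm_mul, ee_norm, one_mul]
    linarith
  have h5 : (M:ℂ) ^ 2 * S = ∑ a ∈ T, ∑ b ∈ T, (S - ∑ n ∈ Finset.Ioc N N', ee t (n + (a * b).toNat)) + ∑ n ∈ Finset.Ioc N N', ∑ a ∈ T, ∑ b ∈ T, ee t (n + (a * b).toNat) := by
    have hTc' : (T.card : ℂ) = M := by exact_mod_cast hTc
    have : ∑ n ∈ Finset.Ioc N N', ∑ a ∈ T, ∑ b ∈ T, ee t (n + (a * b).toNat) = ∑ a ∈ T, ∑ b ∈ T, ∑ n ∈ Finset.Ioc N N', ee t (n + (a * b).toNat) := by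
      rw [Finset.sum_comm]; exact Finset.sum_congr rfl fun _ _ => Finset.sum_comm
    rw [this]
    simp only [Finset.sum_sub_distrib, Finset.sum_const, nsmul_eq_mul, hTc']; ring
  have h6 : ‖∑ n ∈ Finset.Ioc N N', ∑ a ∈ T, ∑ b ∈ T, ee t (n + (a * b).toNat)‖ ≤ N * (M ^ 2 * (exp (12 - L / (10 ^ 9 * K ^ 3)) + 2 * exp (-l))) := by
    refine (norm_sum_le _ _).trans ((Finset.sum_le_card_nsmul _ _ _ h2).trans ?_)
    rw [nsmul_eq_mul, Nat.card_Ioc]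
    gcongr
    exact_mod_cast (by omega : N' - N ≤ N)
  have h7 : (M:ℝ) ^ 2 * ‖S‖ ≤ M ^ 2 * (N * (exp (12 - L / (10 ^ 9 * K ^ 3)) + 2 * exp (-l) + 2 * exp (-(l / 5)))) := by
    have : ‖(M:ℂ) ^ 2 * S‖ = M ^ 2 * ‖S‖ := by simp
    rw [← this, h5]
    refine (norm_add_le _ _).trans ((add_le_add h1 h6).trans ?_)
    have : (M:ℝ) ^ 2 * (2 * M ^ 2) ≤ M ^ 2 * (2 * (N * exp (-(l / 5)))) := by gcongr
    linarith
  exact le_of_mul_le_mul_left h7 (by positivity)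

lemma ES {t : ℝ} {N N' : ℕ} (ht0 : 0 < t) (hL : 42000 ≤ log t) (hN1 : 1 ≤ N) (hNN : N ≤ N') (hNN2 : N' ≤ 2 * N) (hNt : log N ≤ 2 * log t) :
    ‖∑ n ∈ Finset.Ioc N N', ee t n‖ ≤ N * exp (14 - log N ^ 3 / (10 ^ 9 * log t ^ 2)) := by
  have hN0 : (0:ℝ) < N := by exact_mod_cast hN1

  set L := log t with hLd
  set l := log N with hld
  by_cases hc : l ^ 3 < L ^ 2
  · refine (ee_sum_le _ _).trans ?_
    rw [Nat.card_Ioc]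
    have h1 : ((N' - N : ℕ) : ℝ) ≤ N := by exact_mod_cast (by omega : N' - N ≤ N)
    have h2 : l ^ 3 / (10 ^ 9 * L ^ 2) ≤ 1 := by
      rw [div_le_one (by positivity)]; nlinarith [sq_nonneg L]
    have h3 : 1 ≤ exp (14 - l ^ 3 / (10 ^ 9 * L ^ 2)) := one_le_exp (by linarith)
    nlinarith
  push Not at hc
  have hl : 1000 ≤ l := by
    by_contra h
    push Not at h
    have : l ^ 3 < 1000 ^ 3 := by
      have h0 : 0 ≤ l := log_nonneg (by exact_mod_cast hN1)
      gcongr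
    nlinarith
  have hl0 : 0 < l := by linarith
  set K := L / l with hK
  have hLK : L = K * l := by rw [hK]; field_simp
  have hK2 : 1 / 2 ≤ K := by rw [hK, le_div_iff₀ hl0]; linarith
  have hK3 : K ^ 3 ≤ L := by
    rw [hK, div_pow, div_le_iff₀ (by positivity)]
    nlinarith
  have hKe : L / (10 ^ 9 * K ^ 3) = l ^ 3 / (10 ^ 9 * L ^ 2) := by rw [hK]; field_simp
  clear_value K
  have h12 : 1200 * K ≤ L := by
    by_contra h
    push Not at h
    have : K < 35 := by
      by_contra h'
      push Not at h'
      nlinarith [mul_le_mul h' h' (by norm_num) (by linarith)]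
    linarith
  have hexp : (L / 100) ^ 3 / 6 ≤ exp (L / 100) := by
    have := pow_div_factorial_le_exp (L / 100) (by linarith) 3
    norm_num [Nat.factorial] at this ⊢; linarith
  obtain ⟨k, hk, hk2⟩ : ∃ k : ℕ, 5 * K + 5 ≤ k ∧ k ≤ 5 * K + 6 := by
    refine ⟨⌈5 * K⌉₊ + 5, ?_, ?_⟩
    · push_cast; linarith [Nat.le_ceil (5 * K)]
    · push_cast; linarith [Nat.ceil_lt_add_one (by linarith : 0 ≤ 5 * K)]
  have hE1 : 1 ≤ exp (2 / 5 * l) := one_le_exp (by positivity)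
  have hfl := Nat.floor_le (by linarith : 0 ≤ exp (2 / 5 * l))
  have hfl2 := Nat.lt_floor_add_one (exp (2 / 5 * l))
  have hfl3 : 1 ≤ ⌊exp (2 / 5 * l)⌋₊ := (Nat.one_le_floor_iff _).2 hE1
  have hfl4 : (1:ℝ) ≤ ⌊exp (2 / 5 * l)⌋₊ := by exact_mod_cast hfl3
  refine (ES_core (K := K) (k := k) (l := l) (L := L) (M := ⌊exp (2 / 5 * l)⌋₊) (by linarith) hK2 hLK (exp_log hN0).symm (exp_log ht0).symm
    (by linarith) hfl hfl3 ?_ hk hk2 (by linarith) ?_ hNN hNN2).trans ?_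
  · have : (k:ℝ) ≤ L / 60 := by linarith
    push_cast
    refine le_trans ?_ hexp
    calc 11 * (k:ℝ) ^ 2 ≤ 11 * (L / 60) ^ 2 := by gcongr
      _ ≤ _ := by nlinarith [mul_pos (by linarith : 0 < L) (by linarith : 0 < L)]
  · refine le_trans ?_ hexp
    nlinarith [mul_pos (by linarith : 0 < L) (by linarith : 0 < L)]
  · rw [hKe]
    gcongr
    have h5 : l ^ 3 / (10 ^ 9 * L ^ 2) ≤ l / 5 := by
      rw [div_le_div_iff₀ (by positivity) (by norm_num)]
      nlinarith [mul_le_mul hNt hNt hl0.le (by linarith), sq_nonneg L]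
    set q := l ^ 3 / (10 ^ 9 * L ^ 2) with hq
    have a1 : exp (-l) ≤ exp (-q) := by gcongr; linarith
    have a2 : exp (-(l / 5)) ≤ exp (-q) := by gcongr
    have a3 : exp (12 - q) = exp 12 * exp (-q) := by rw [← exp_add]; ring_nf
    have a4 : exp (14 - q) = exp 12 * exp 2 * exp (-q) := by rw [← exp_add, ← exp_add]; ring_nf
    rw [a3, a4]
    have a5 : 3 ≤ exp 2 := by linarith [add_one_le_exp (2:ℝ)]
    have a6 : 13 ≤ exp 12 := by linarith [add_one_le_exp (12:ℝ)]
    have : exp 12 + 4 ≤ exp 12 * exp 2 := by nlinarith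
    nlinarith [exp_pos (-q)]

/-- `(s-1)(n^{-s} - ∫_n^{n+1} u^{-s} du)` at `n+1` -/
noncomputable def Et (n : ℕ) (s : ℂ) : ℂ := (s - 1) * ((n + 1 : ℝ) : ℂ) ^ (-s) + (((n + 1 : ℝ) + 1 : ℝ) : ℂ) ^ (1 - s) - ((n + 1 : ℝ) : ℂ) ^ (1 - s)

lemma cpow_bd {a u : ℝ} (ha : 1 ≤ a) (hu : a ≤ u) {s : ℂ} (hs : 1 / 2 ≤ s.re) (hu2 : u ≤ a + 1) :
    ‖(u:ℂ) ^ (-s) - (a:ℂ) ^ (-s)‖ ≤ ‖s‖ * (1 / √a ^ 3) := by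
  have hd : ∀ x ∈ Set.Icc a u, HasDerivWithinAt (fun x : ℝ => (x:ℂ) ^ (-s)) (-s * (x:ℂ) ^ (-s - 1)) (Set.Icc a u) x := by
    intro x hx
    have hx0 : x ≠ 0 := by have := hx.1; linarith
    refine HasDerivAt.hasDerivWithinAt ?_
    by_cases h0 : s = 0
    · subst h0; simpa using hasDerivAt_const x (1:ℂ)
    · have := hasDerivAt_ofReal_cpow_const' hx0 (r := -s - 1) (by intro h; apply h0; linear_combination -h)
      have h2 := this.const_mul (-s)
      have h1 : -s - 1 + 1 = -s := by ring
      simp only [h1] at h2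
      refine h2.congr_of_eventuallyEq (Eventually.of_forall fun y => ?_)
      field_simp
  have := norm_image_sub_le_of_norm_deriv_le_segment' hd (C := ‖s‖ * (1 / √a ^ 3)) (by
    intro x hx
    have hx0 : 0 < x := by have := hx.1; linarith
    rw [norm_mul, norm_neg, Complex.norm_cpow_eq_rpow_re_of_pos hx0]
    gcongr
    calc x ^ (-s - 1).re ≤ a ^ (-s - 1).re := by
          refine rpow_le_rpow_of_nonpos (by linarith) hx.1 ?_
          simp; linarith
      _ ≤ a ^ (-(3 / 2) : ℝ) := by
          refine rpow_le_rpow_of_exponent_le ha ?_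
          simp; linarith
      _ = 1 / √a ^ 3 := by
          rw [rpow_neg (by linarith), one_div, sqrt_eq_rpow, ← rpow_natCast, ← rpow_mul (by linarith)]; norm_num) u ⟨hu, le_rfl⟩
  refine this.trans (mul_le_of_le_one_right (by positivity) (by linarith))

lemma Et_bd (n : ℕ) {s : ℂ} (hs : 1 / 2 ≤ s.re) : ‖Et n s‖ ≤ ‖s - 1‖ * (‖s‖ * (1 / √(n + 1) ^ 3)) := by
  set a : ℝ := n + 1 with ha
  have ha1 : 1 ≤ a := by rw [ha]; linarith [(Nat.cast_nonneg n : (0:ℝ) ≤ n)]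
  by_cases h1 : s = 1
  · simp [Et, h1]
  have hs1 : 1 - s ≠ 0 := by intro h; apply h1; linear_combination -h
  have hd : ∀ x ∈ Set.Icc a (a + 1), HasDerivWithinAt (fun x : ℝ => (x:ℂ) ^ (1 - s) - x * ((1 - s) * (a:ℂ) ^ (-s))) ((1 - s) * ((x:ℂ) ^ (-s) - (a:ℂ) ^ (-s))) (Set.Icc a (a + 1)) x := by
    intro x hx
    have hx0 : x ≠ 0 := by have := hx.1; linarith
    refine HasDerivAt.hasDerivWithinAt ?_
    have := (hasDerivAt_ofReal_cpow_const' hx0 (r := -s) (by intro h; apply h1; linear_combination -h)).const_mul (1 - s)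
    have h2 := this.sub ((Complex.ofRealCLM.hasDerivAt (x := x)).mul_const ((1 - s) * (a:ℂ) ^ (-s)))
    have e : -s + 1 = 1 - s := by ring
    simp only [e, Complex.ofRealCLM_apply] at h2
    convert h2 using 1
    · ext y; simp only [Pi.sub_apply]; field_simp
    · simp; ring
  have := norm_image_sub_le_of_norm_deriv_le_segment' hd (C := ‖s - 1‖ * (‖s‖ * (1 / √a ^ 3))) (by
    intro x hx
    rw [norm_mul, norm_sub_rev 1 s]
    gcongr
    exact cpow_bd ha1 hx.1 hs hx.2.le) (a + 1) ⟨by linarith, le_rfl⟩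
  refine le_trans (le_of_eq ?_) (this.trans (by rw [add_sub_cancel_left, mul_one]))
  congr 1
  rw [Et, ← ha]; push_cast; ring

lemma tail_step (n : ℕ) : 1 / √((n + 1 : ℕ) + 1 : ℝ) ^ 3 ≤ 2 / √(n + 1 : ℝ) - 2 / √((n + 1 : ℕ) + 1 : ℝ) := by
  have e : ((n + 1 : ℕ) + 1 : ℝ) = (n + 1 : ℝ) + 1 := by push_cast; ring
  rw [e]
  have hx : (0:ℝ) < n + 1 := by positivity
  set x : ℝ := n + 1
  have ha : 0 < √x := sqrt_pos.2 hx
  have hb : 0 < √(x + 1) := sqrt_pos.2 (by linarith)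
  have h1 := sq_sqrt hx.le
  have h2 := sq_sqrt (by linarith : 0 ≤ x + 1)
  have hab : √x ≤ √(x + 1) := sqrt_le_sqrt (by linarith)
  set a := √x
  set b := √(x + 1)
  clear_value a b
  have e1 : 2 / a - 2 / b = 2 / (a * b * (a + b)) := by
    field_simp; nlinarith
  rw [e1, div_le_div_iff₀ (by positivity) (by positivity)]
  have h3 : a * (a + b) ≤ 2 * b ^ 2 := by nlinarith
  calc 1 * (a * b * (a + b)) = b * (a * (a + b)) := by ring
    _ ≤ b * (2 * b ^ 2) := by gcongr
    _ = _ := by ring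

lemma tail_sum (N m : ℕ) : ∑ i ∈ Finset.range m, 1 / √(((i + (N + 1) : ℕ) : ℝ) + 1) ^ 3 ≤ 2 / √(N + 1 : ℝ) := by
  have : ∀ m, ∑ i ∈ Finset.range m, 1 / √(((i + (N + 1) : ℕ) : ℝ) + 1) ^ 3 ≤ 2 / √(N + 1 : ℝ) - 2 / √((N + m : ℕ) + 1 : ℝ) := by
    intro m
    induction m with
    | zero => simp
    | succ m ih =>
      rw [Finset.sum_range_succ]
      have := tail_step (N + m)
      have e : m + (N + 1) = N + m + 1 := by ring
      rw [e, show N + (m + 1) = N + m + 1 by ring]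
      linarith
  refine (this m).trans ?_
  have : 0 ≤ 2 / √((N + m : ℕ) + 1 : ℝ) := by positivity
  linarith

lemma summ32 : Summable (fun n : ℕ => 1 / √((n:ℝ) + 1) ^ 3) := by
  rw [← summable_nat_add_iff 1]
  exact summable_of_sum_range_le (fun _ => by positivity) (fun m => by simpa using tail_sum 0 m)

lemma Et_summ {s : ℂ} (hs : 1 / 2 ≤ s.re) : Summable (fun n => Et n s) :=
  Summable.of_norm_bounded ((summ32.mul_left ‖s‖).mul_left ‖s - 1‖) (fun n => Et_bd n hs)

lemma Et_sum (s : ℂ) (N : ℕ) : ∑ n ∈ Finset.range N, Et n s = (s - 1) * ∑ n ∈ Finset.range N, ((n + 1 : ℝ) : ℂ) ^ (-s) + ((N + 1 : ℝ) : ℂ) ^ (1 - s) - 1 := by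
  induction N with
  | zero => simp
  | succ N ih => rw [Finset.sum_range_succ, ih, Finset.sum_range_succ, Et]; push_cast; ring

lemma zeta1_eq_of_one_lt {s : ℂ} (hs : 1 < s.re) : riemannZeta₁ s = 1 + ∑' n, Et n s := by
  have hs1 : s ≠ 1 := by intro h; rw [h] at hs; simp at hs
  have h1 := (Et_summ (by linarith : 1 / 2 ≤ s.re)).hasSum.tendsto_sum_nat
  have h2 : Tendsto (fun N => ∑ n ∈ Finset.range N, Et n s) atTop (nhds ((s - 1) * riemannZeta s + 0 - 1)) := by
    simp only [Et_sum]
    refine ((Tendsto.const_mul _ ?_).add ?_).sub_const 1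
    · rw [zeta_eq_tsum_one_div_nat_add_one_cpow hs]
      have hs2 : Summable (fun n : ℕ => 1 / ((n:ℂ) + 1) ^ s) := by
        have := (summable_nat_add_iff 1).2 (Complex.summable_one_div_nat_cpow.2 hs)
        simpa using this
      have := hs2.hasSum.tendsto_sum_nat
      refine this.congr fun N => Finset.sum_congr rfl fun n _ => ?_
      rw [Complex.cpow_neg]; push_cast; rw [one_div]
    · rw [tendsto_zero_iff_norm_tendsto_zero]
      have h3 : Tendsto (fun N : ℕ => ((N:ℝ) + 1) ^ (-(s.re - 1))) atTop (nhds 0) :=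
        (tendsto_rpow_neg_atTop (by linarith)).comp (tendsto_atTop_add_const_right _ _ tendsto_natCast_atTop_atTop)
      refine h3.congr fun N => ?_
      rw [Complex.norm_cpow_eq_rpow_re_of_pos (by positivity)]; simp
  have := tendsto_nhds_unique h1 h2
  rw [this, riemannZeta_eq_inv_sub_mul hs1]
  have : s - 1 ≠ 0 := sub_ne_zero.2 hs1
  field_simp; ring

lemma zeta1_eq {s : ℂ} (hs : 1 / 2 < s.re) : riemannZeta₁ s = 1 + ∑' n, Et n s := by
  set R := ‖s‖ + 3
  set U : Set ℂ := {z | 1 / 2 < z.re} ∩ Metric.ball 0 R with hU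
  have hUo : IsOpen U := (isOpen_lt continuous_const Complex.continuous_re).inter Metric.isOpen_ball
  have hUc : Convex ℝ U := (convex_halfSpace_re_gt _).inter (convex_ball _ _)
  have hd : DifferentiableOn ℂ (fun z => 1 + ∑' n, Et n z) U := by
    refine (differentiableOn_const _).add ?_
    refine Complex.differentiableOn_tsum_of_summable_norm ((summ32.mul_left R).mul_left (R + 1)) (fun n => ?_) hUo ?_
    · have h1 : ((n:ℝ) + 1 : ℝ) ≠ 0 := by positivity
      have h2 : ((n:ℝ) + 1 + 1 : ℝ) ≠ 0 := by positivity
      have h1' : (((n:ℝ) + 1 : ℝ) : ℂ) ≠ 0 := by exact_mod_cast h1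
      have h2' : (((n:ℝ) + 1 + 1 : ℝ) : ℂ) ≠ 0 := by exact_mod_cast h2
      unfold Et
      refine Differentiable.differentiableOn ?_
      refine ((differentiable_id.sub_const 1).mul (differentiable_id.neg.const_cpow (Or.inl h1'))).add ((differentiable_id.const_sub 1).const_cpow (Or.inl h2')) |>.sub ((differentiable_id.const_sub 1).const_cpow (Or.inl h1'))
    · intro n z hz
      have hz2 : ‖z‖ < R := by simpa using hz.2
      refine (Et_bd n (le_of_lt hz.1)).trans ?_
      gcongr
      refine (norm_sub_le _ _).trans ?_
      simp; linarith
  have h2U : (2:ℂ) ∈ U := ⟨by simp; norm_num, by simp [R]; linarith [norm_nonneg s]⟩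
  refine (differentiable_riemannZeta₁.differentiableOn.analyticOnNhd hUo).eqOn_of_preconnected_of_eventuallyEq
    (hd.analyticOnNhd hUo) hUc.isPreconnected h2U ?_ ⟨hs, by simp [R]⟩
  filter_upwards [(isOpen_lt continuous_const Complex.continuous_re).mem_nhds (show (1:ℝ) < (2:ℂ).re by simp)] with z hz
  exact zeta1_eq_of_one_lt hz

lemma zeta_approx {s : ℂ} (hs : 1 / 2 < s.re) (hs1 : s ≠ 1) (N : ℕ) :
    ‖riemannZeta s - ∑ n ∈ Finset.range (N + 1), ((n + 1 : ℝ) : ℂ) ^ (-s)‖ ≤ ‖((N + 1 + 1 : ℝ) : ℂ) ^ (1 - s)‖ / ‖s - 1‖ + ‖s‖ * (2 / √(N + 1 : ℝ)) := by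
  have h0 : s - 1 ≠ 0 := sub_ne_zero.2 hs1
  have h1 := zeta1_eq hs
  rw [← (Et_summ hs.le).sum_add_tsum_nat_add (N + 1), Et_sum] at h1
  have h2 : riemannZeta s - ∑ n ∈ Finset.range (N + 1), ((n + 1 : ℝ) : ℂ) ^ (-s) =
      ((N + 1 + 1 : ℝ) : ℂ) ^ (1 - s) / (s - 1) + (∑' n, Et (n + (N + 1)) s) / (s - 1) := by
    rw [riemannZeta_eq_inv_sub_mul hs1, h1]; push_cast; field_simp; ring
  rw [h2]
  refine (norm_add_le _ _).trans ?_
  rw [norm_div, norm_div]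
  gcongr
  rw [div_le_iff₀ (norm_pos_iff.2 h0)]
  refine tsum_of_norm_bounded (g := fun n => ‖s - 1‖ * (‖s‖ * (1 / √(((n + (N + 1) : ℕ) : ℝ) + 1) ^ 3))) (a := _) (Summable.hasSum ?_) (fun n => Et_bd _ hs.le) |>.trans ?_
  · exact (((summable_nat_add_iff (N + 1)).2 summ32).mul_left _).mul_left _
  · rw [tsum_mul_left, tsum_mul_left, mul_comm]
    gcongr
    exact Real.tsum_le_of_sum_range_le (fun _ => by positivity) (tail_sum N)

lemma abel_mono {a : ℕ → ℂ} {w : ℕ → ℝ} {B : ℝ} {N N' : ℕ} (hNN : N ≤ N') (hw : ∀ n, N ≤ n → w (n + 1) ≤ w n) (hw0 : ∀ n, N ≤ n → 0 ≤ w n)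
    (hB : ∀ n, N ≤ n → n ≤ N' → ‖∑ i ∈ Finset.Ioc N n, a i‖ ≤ B) :
    ‖∑ i ∈ Finset.Ioc N N', (w i : ℂ) * a i‖ ≤ B * w N := by
  have key : ∀ n, N ≤ n → n ≤ N' → ‖∑ i ∈ Finset.Ioc N n, (w i : ℂ) * a i - w n * ∑ i ∈ Finset.Ioc N n, a i‖ ≤ B * (w N - w n) := by
    intro n hn
    induction n, hn using Nat.le_induction with
    | base => simp
    | succ n hn ih =>
      intro hn2
      have h1 := ih (by omega)
      rw [Finset.sum_Ioc_succ_top hn, Finset.sum_Ioc_succ_top hn]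
      have e : ∑ i ∈ Finset.Ioc N n, (w i : ℂ) * a i + w (n + 1) * a (n + 1) - w (n + 1) * (∑ i ∈ Finset.Ioc N n, a i + a (n + 1)) =
        (∑ i ∈ Finset.Ioc N n, (w i : ℂ) * a i - w n * ∑ i ∈ Finset.Ioc N n, a i) + ((w n - w (n + 1) : ℝ) : ℂ) * ∑ i ∈ Finset.Ioc N n, a i := by
        push_cast; ring
      rw [e]
      refine (norm_add_le _ _).trans ?_
      rw [norm_mul, Complex.norm_real, Real.norm_eq_abs, abs_of_nonneg (by linarith [hw n hn])]
      have : (w n - w (n + 1)) * ‖∑ i ∈ Finset.Ioc N n, a i‖ ≤ (w n - w (n + 1)) * B := by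
        gcongr
        · linarith [hw n hn]
        · exact hB n hn (by omega)
      nlinarith
  have h1 := key N' hNN le_rfl
  have h2 : ‖(w N' : ℂ) * ∑ i ∈ Finset.Ioc N N', a i‖ ≤ w N' * B := by
    rw [norm_mul, Complex.norm_real, Real.norm_eq_abs, abs_of_nonneg (hw0 _ hNN)]
    gcongr
    · exact hw0 _ hNN
    · exact hB N' hNN le_rfl
  have := norm_add_le (∑ i ∈ Finset.Ioc N N', (w i : ℂ) * a i - w N' * ∑ i ∈ Finset.Ioc N N', a i) ((w N' : ℂ) * ∑ i ∈ Finset.Ioc N N', a i)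
  rw [sub_add_cancel] at this
  nlinarith

lemma cpow_eq_ee {n : ℕ} (hn : 1 ≤ n) (σ t : ℝ) : ((n:ℝ):ℂ) ^ (-(σ + t * Complex.I)) = (((n:ℝ) ^ (-σ) : ℝ) : ℂ) * ee t n := by
  have hn0 : (0:ℝ) < n := by exact_mod_cast hn
  have hn1 : ((n:ℝ):ℂ) ≠ 0 := by exact_mod_cast hn0.ne'
  rw [neg_add, Complex.cpow_add _ _ hn1, Complex.ofReal_cpow hn0.le, ee, Complex.cpow_def_of_ne_zero hn1 (-(t * Complex.I)), ← Complex.ofReal_log hn0.le]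
  push_cast; congr 2; ring

lemma num_bd {y : ℝ} (hy : 0 ≤ y) : y - y ^ 3 / 10 ^ 9 ≤ 40000 := by
  by_cases h : y ≤ 40000
  · have : 0 ≤ y ^ 3 / 10 ^ 9 := by positivity
    linarith
  · push Not at h
    have : 40000 * 40000 ≤ y * y := by gcongr
    have : y * (40000 * 40000) ≤ y * (y * y) := by gcongr
    have e : y ^ 3 = y * (y * y) := by ring
    rw [e]; linarith

lemma block {t σ : ℝ} {N : ℕ} (ht0 : 0 < t) (hL : 42000 ≤ log t) (hN1 : 1 ≤ N) (hNt : log N ≤ 2 * log t) (hσ0 : 1 / 2 ≤ σ)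
    (hσ : 1 - (log t) ^ (-(2 / 3) : ℝ) ≤ σ) : ‖∑ n ∈ Finset.Ioc N (2 * N), ((n:ℝ):ℂ) ^ (-(σ + t * Complex.I))‖ ≤ exp 40014 := by
  have hN0 : (0:ℝ) < N := by exact_mod_cast hN1
  have hL0 : 0 < log t := by linarith
  set L := log t
  have h1 : ∑ n ∈ Finset.Ioc N (2 * N), ((n:ℝ):ℂ) ^ (-(σ + t * Complex.I)) = ∑ n ∈ Finset.Ioc N (2 * N), (((n:ℝ) ^ (-σ) : ℝ) : ℂ) * ee t n :=
    Finset.sum_congr rfl fun n hn => cpow_eq_ee (by rw [Finset.mem_Ioc] at hn; omega) σ t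
  rw [h1]
  refine (abel_mono (w := fun n => (n:ℝ) ^ (-σ)) (B := N * exp (14 - log N ^ 3 / (10 ^ 9 * log t ^ 2))) (by omega) (fun n hn => ?_) (fun n hn => by positivity)
    (fun n hn hn2 => ES ht0 hL hN1 hn hn2 hNt)).trans ?_
  · have : (0:ℝ) < n := by exact_mod_cast (by omega : 0 < n)
    exact rpow_le_rpow_of_nonpos this (by push_cast; linarith) (by linarith)
  · have hl : 0 ≤ log N := log_nonneg (by exact_mod_cast hN1)
    set l := log N with hld
    have e1 : (N:ℝ) = exp l := (exp_log hN0).symm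
    have e2 : (N:ℝ) ^ (-σ) = exp (l * (-σ)) := by rw [rpow_def_of_pos hN0]
    simp only [e2]
    rw [e1, ← exp_add, ← exp_add]
    gcongr
    set y := l * L ^ (-(2 / 3) : ℝ) with hy
    have e3 : l ^ 3 / (10 ^ 9 * L ^ 2) = y ^ 3 / 10 ^ 9 := by
      have : (L ^ (-(2 / 3) : ℝ)) ^ 3 = 1 / L ^ 2 := by
        rw [← rpow_natCast, ← rpow_mul hL0.le, ← rpow_natCast L 2, one_div, ← rpow_neg hL0.le]; norm_num
      rw [hy, mul_pow, this]; field_simp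
    have h4 := num_bd (by positivity : 0 ≤ y)
    have : l * (1 - σ) ≤ y := by rw [hy]; gcongr; linarith
    rw [e3]; linarith

lemma zeta_bd {t σ : ℝ} (ht0 : 0 < t) (hL : 42000 ≤ log t) (hσ : 1 - (log t) ^ (-(2 / 3) : ℝ) ≤ σ) (hσ2 : σ ≤ 3) :
    ‖riemannZeta (σ + t * Complex.I)‖ ≤ exp 40020 * log t := by
  have hL0 : 0 < log t := by linarith
  have ht : 42001 ≤ t := by
    have := add_one_le_exp (log t)
    rw [exp_log ht0] at this; linarith
  have hσ0 : 3 / 4 ≤ σ := by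
    have h64 : (64:ℝ) ^ (2 / 3 : ℝ) = 16 := by
      rw [show (64:ℝ) = 4 ^ (3:ℝ) by norm_num, ← rpow_mul (by norm_num)]; norm_num
    have : (log t) ^ (-(2 / 3) : ℝ) ≤ 64 ^ (-(2 / 3) : ℝ) := rpow_le_rpow_of_nonpos (by norm_num) (by linarith) (by norm_num)
    rw [rpow_neg (by norm_num : (0:ℝ) ≤ 64), h64] at this
    linarith
  set L := log t with hLd
  set s : ℂ := σ + t * Complex.I with hs
  have hre : s.re = σ := by simp [hs]
  have him : s.im = t := by simp [hs]
  have hs1 : s ≠ 1 := by intro h; rw [h] at him; simp at him; linarith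
  set m := ⌈2 * L / log 2⌉₊ with hm
  have hlog2 : 1 / 2 < log 2 := by linarith [log_two_gt_d9]
  have hlog2' : log 2 < 1 := by linarith [log_two_lt_d9]
  have hm1 : 2 * L ≤ m * log 2 := by
    have := Nat.le_ceil (2 * L / log 2)
    rw [div_le_iff₀ (by linarith)] at this; exact this
  have hm2 : (m:ℝ) ≤ 4 * L + 1 := by
    have := (Nat.ceil_lt_add_one (by positivity : 0 ≤ 2 * L / log 2)).le
    have h2 : 2 * L / log 2 ≤ 4 * L := by rw [div_le_iff₀ (by linarith)]; nlinarith
    linarith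
  have hm3 : m * log 2 ≤ 2 * L + 1 := by
    have := (Nat.ceil_lt_add_one (by positivity : 0 ≤ 2 * L / log 2)).le
    calc m * log 2 ≤ (2 * L / log 2 + 1) * log 2 := by gcongr
      _ = 2 * L + log 2 := by field_simp
      _ ≤ _ := by linarith
  have h2m : ((2:ℝ) ^ m) = exp (m * log 2) := by rw [exp_nat_mul, exp_log (by norm_num)]
  have hlow : t ^ 2 ≤ (2:ℝ) ^ m := by
    rw [h2m]
    calc t ^ 2 = exp (2 * L) := by rw [hLd, two_mul, exp_add, exp_log ht0, sq]
      _ ≤ _ := by gcongr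
  have hup : (2:ℝ) ^ m ≤ 3 * t ^ 2 := by
    rw [h2m]
    calc exp (m * log 2) ≤ exp (2 * L + 1) := by gcongr
      _ = t ^ 2 * exp 1 := by rw [exp_add, hLd, two_mul, exp_add, exp_log ht0, sq]
      _ ≤ _ := by nlinarith [exp_one_lt_d9, sq_nonneg t]
  have hsum : ∀ j ≤ m, ‖∑ n ∈ Finset.Ioc 0 ((2:ℕ) ^ j), ((n:ℝ):ℂ) ^ (-s)‖ ≤ 1 + j * exp 40014 := by
    intro j
    induction j with
    | zero => intro _; rw [pow_zero, show Finset.Ioc 0 1 = {1} from rfl]; simp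
    | succ j ih =>
      intro hj
      have h1 := ih (by omega)
      rw [← Finset.sum_Ioc_consecutive _ (Nat.zero_le (2 ^ j)) (Nat.pow_le_pow_right (by norm_num) (by omega)), show 2 ^ (j + 1) = 2 * 2 ^ j by ring]
      have h2 : log ((2 ^ j : ℕ) : ℝ) ≤ 2 * log t := by
        have : j < 2 * L / log 2 := Nat.lt_ceil.1 (by omega)
        rw [lt_div_iff₀ (by linarith)] at this
        push_cast; rw [log_pow]; exact this.le
      have := block ht0 hL (Nat.one_le_two_pow (n := j)) h2 (by linarith) hσ
      refine (norm_add_le _ _).trans ((add_le_add h1 this).trans (le_of_eq ?_))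
      push_cast; ring
  obtain ⟨N, hN⟩ : ∃ N : ℕ, (2:ℕ) ^ m = N + 1 := ⟨_, (Nat.sub_add_cancel Nat.one_le_two_pow).symm⟩
  have hNr : (2:ℝ) ^ m = N + 1 := by exact_mod_cast hN
  have happ := zeta_approx (s := s) (by rw [hre]; linarith) hs1 N
  have e1 : ∑ n ∈ Finset.range (N + 1), ((n + 1 : ℝ) : ℂ) ^ (-s) = ∑ n ∈ Finset.Ioc 0 ((2:ℕ) ^ m), ((n:ℝ):ℂ) ^ (-s) := by
    rw [hN, Finset.range_eq_Ico, ← Finset.Ico_add_one_add_one_eq_Ioc, ← Finset.sum_Ico_add' _ 0 (N + 1) 1]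
    push_cast; rfl
  rw [e1, ← hNr] at happ
  have h4 := hsum m le_rfl
  have hst : t ≤ ‖s - 1‖ := by
    have := Complex.abs_im_le_norm (s - 1)
    rw [Complex.sub_im, him, Complex.one_im, sub_zero, abs_of_pos ht0] at this; exact this
  have hsn : ‖s‖ ≤ 2 * t := by
    refine (Complex.norm_le_abs_re_add_abs_im s).trans ?_
    rw [hre, him, abs_of_pos ht0, abs_of_pos (by linarith)]; linarith
  have h5 : ‖(((2:ℝ) ^ m + 1 : ℝ) : ℂ) ^ (1 - s)‖ / ‖s - 1‖ ≤ 1 := by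
    rw [div_le_one (by linarith)]
    refine le_trans ?_ hst
    rw [Complex.norm_cpow_eq_rpow_re_of_pos (by positivity), Complex.sub_re, hre, Complex.one_re]
    have hb : (2:ℝ) ^ m + 1 ≤ t ^ 4 := by
      have e : t ^ 4 = t ^ 2 * t ^ 2 := by ring
      have : 4 * 4 ≤ t ^ 2 := by nlinarith
      nlinarith
    calc ((2:ℝ) ^ m + 1) ^ (1 - σ) ≤ ((2:ℝ) ^ m + 1) ^ (1 / 4 : ℝ) :=
          rpow_le_rpow_of_exponent_le (by linarith [pow_pos (two_pos (α := ℝ)) m]) (by linarith)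
      _ ≤ (t ^ 4) ^ (1 / 4 : ℝ) := by gcongr
      _ = t := by rw [← rpow_natCast, ← rpow_mul ht0.le]; norm_num
  have h6 : ‖s‖ * (2 / √((2:ℝ) ^ m)) ≤ 4 := by
    have : t ≤ √((2:ℝ) ^ m) := le_sqrt_of_sq_le hlow
    calc ‖s‖ * (2 / √((2:ℝ) ^ m)) ≤ 2 * t * (2 / t) := by gcongr
      _ = 4 := by field_simp; norm_num
  have h7 := norm_add_le (riemannZeta s - ∑ n ∈ Finset.Ioc 0 ((2:ℕ) ^ m), ((n:ℝ):ℂ) ^ (-s)) (∑ n ∈ Finset.Ioc 0 ((2:ℕ) ^ m), ((n:ℝ):ℂ) ^ (-s))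
  rw [sub_add_cancel] at h7
  have h8 : exp 40020 = exp 40014 * exp 6 := by rw [← exp_add]; norm_num
  have h9 : 7 ≤ exp 6 := by linarith [add_one_le_exp (6:ℝ)]
  have h10 : 40000 ≤ exp 40014 := by linarith [add_one_le_exp (40014:ℝ)]
  rw [h8]
  have h11 : m * exp 40014 ≤ (4 * L + 1) * exp 40014 := by gcongr
  have h12 : exp 40014 * 7 * L ≤ exp 40014 * exp 6 * L := by gcongr
  nlinarith
open Metric in
lemma bc {g : ℂ → ℂ} {s0 : ℂ} {R M : ℝ} (hR : 0 < R) (hM : 0 < M) (hg : DifferentiableOn ℂ g (ball s0 R))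
    (h0 : ∀ z ∈ ball s0 R, g z ≠ 0) (hb : ∀ z ∈ ball s0 R, ‖g z‖ ≤ exp M * ‖g s0‖) :
    ∀ z ∈ ball s0 (R / 2), ‖deriv g z / g z‖ ≤ 24 * M / R := by
  have hd : DifferentiableOn ℂ (fun z => deriv g z / g z) (ball s0 R) := (hg.deriv isOpen_ball).div hg h0
  obtain ⟨h, hh⟩ := hd.isExactOn_ball
  have hs0 : s0 ∈ ball s0 R := mem_ball_self hR
  have key : ∀ z ∈ ball s0 R, g z = g s0 * Complex.exp (h z - h s0) := by
    intro z hz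
    have hc : ∀ z ∈ ball s0 R, HasDerivAt (fun z => g z * Complex.exp (-h z)) 0 z := by
      intro z hz
      have h1 := (hg.differentiableAt (isOpen_ball.mem_nhds hz)).hasDerivAt
      have h2 := ((hh z hz).neg).cexp
      refine (h1.mul h2).congr_deriv ?_
      have := h0 z hz
      show deriv g z * Complex.exp (-h z) + g z * (Complex.exp (-h z) * -(deriv g z / g z)) = 0
      field_simp
      ring
    have := (convex_ball s0 R).is_const_of_fderivWithin_eq_zero (𝕜 := ℂ) (f := fun z => g z * Complex.exp (-h z))
      (fun z hz => (hc z hz).differentiableAt.differentiableWithinAt)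
      (fun z hz => by
        rw [fderivWithin_of_isOpen isOpen_ball hz]
        have := (hc z hz).hasFDerivAt.fderiv
        rw [this]; ext; simp) hz hs0
    rw [Complex.exp_sub]
    rw [Complex.exp_neg, Complex.exp_neg] at this
    field_simp at this ⊢
    linear_combination this
  set f : ℂ → ℂ := fun z => h (s0 + z) - h s0 with hf
  have hmem : ∀ z ∈ ball (0:ℂ) R, s0 + z ∈ ball s0 R := by intro z hz; simpa using hz
  have hfd : DifferentiableOn ℂ f (ball 0 R) := by
    intro z hz
    have h1 : HasDerivAt h _ (s0 + z) := hh _ (hmem z hz)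
    exact ((h1.comp_const_add s0 z).sub_const (h s0)).differentiableAt.differentiableWithinAt
  have hmaps : Set.MapsTo f (ball 0 R) {z | z.re ≤ M} := by
    intro z hz
    have h1 := key _ (hmem z hz)
    have h2 := hb _ (hmem z hz)
    rw [h1, norm_mul, Complex.norm_exp, mul_comm] at h2
    have h3 := le_of_mul_le_mul_right h2 (norm_pos_iff.2 (h0 s0 hs0))
    simpa [f] using exp_le_exp.1 h3
  have hbc : ∀ z : ℂ, ‖z‖ ≤ 3 * R / 4 → ‖f z‖ ≤ 6 * M := by
    intro z hz
    have h1 := Complex.borelCaratheodory_zero hM hfd hmaps hR (by simp; linarith) (by simp [f])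
    refine h1.trans ?_
    rw [div_le_iff₀ (by linarith)]
    nlinarith
  intro z hz
  have hz' : ‖z - s0‖ < R / 2 := by simpa [dist_eq_norm] using hz
  have hzR : z ∈ ball s0 R := ball_subset_ball (by linarith) hz
  have h1 : HasDerivAt f (deriv g z / g z) (z - s0) := by
    have := hh z hzR
    have h2 : HasDerivAt h (deriv g z / g z) (s0 + (z - s0)) := by simpa using this
    exact (h2.comp_const_add s0 (z - s0)).sub_const (h s0)
  rw [← h1.deriv]
  have := Complex.norm_deriv_le_of_forall_mem_sphere_norm_le (c := z - s0) (R := R / 4) (C := 6 * M) (f := f) (by positivity)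
    (DifferentiableOn.diffContOnCl (hfd.mono ?_)) ?_
  · refine this.trans (le_of_eq ?_); field_simp; norm_num
  · refine (closure_ball_subset_closedBall).trans ?_
    intro w hw
    rw [mem_closedBall, dist_eq_norm] at hw
    have := norm_add_le (w - (z - s0)) (z - s0)
    rw [sub_add_cancel] at this
    rw [mem_ball_zero_iff]; linarith
  · intro w hw
    rw [mem_sphere, dist_eq_norm] at hw
    have := norm_add_le (w - (z - s0)) (z - s0)
    rw [sub_add_cancel] at this
    apply hbc; linarith

open Metric in
lemma landau_step {f : ℂ → ℂ} {s0 ρ : ℂ} {R K : ℝ} (hR : 0 < R) (hf : DifferentiableOn ℂ f (ball s0 R)) (hK : 0 ≤ K)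
    (h0 : f s0 ≠ 0) (hb : ∀ z ∈ ball s0 R, ‖f z‖ ≤ K * ‖f s0‖) (hρ : ρ ∈ closedBall s0 (R / 4)) (hz : f ρ = 0)
    (hre : ∀ z ∈ closedBall s0 (R / 4), f z = 0 → z.re < s0.re) :
    ∃ g : ℂ → ℂ, DifferentiableOn ℂ g (ball s0 R) ∧ g s0 ≠ 0 ∧ (∀ z ∈ ball s0 R, ‖g z‖ ≤ K / 2 * ‖g s0‖) ∧
      (∀ z ∈ closedBall s0 (R / 4), g z = 0 → z.re < s0.re) ∧
      deriv f s0 / f s0 = deriv g s0 / g s0 + 1 / (s0 - ρ) := by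
  have hρR : ρ ∈ ball s0 R := closedBall_subset_ball (by linarith) hρ
  have hs0 : s0 ∈ ball s0 R := mem_ball_self hR
  have hne : s0 ≠ ρ := fun h => h0 (h ▸ hz)
  have hρn : ‖s0 - ρ‖ ≤ R / 4 := by rw [← dist_eq_norm, dist_comm]; exact hρ
  have hg : DifferentiableOn ℂ (dslope f ρ) (ball s0 R) :=
    (Complex.differentiableOn_dslope (isOpen_ball.mem_nhds hρR)).2 hf
  have hfg : ∀ z, f z = (z - ρ) * dslope f ρ z := by
    intro z
    have := sub_smul_dslope f ρ z
    rw [smul_eq_mul, hz, sub_zero] at this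
    exact this.symm
  have hg0 : dslope f ρ s0 ≠ 0 := by
    intro h; apply h0; rw [hfg, h, mul_zero]
  refine ⟨dslope f ρ, hg, hg0, ?_, ?_, ?_⟩
  · intro z hz'
    rw [mem_ball] at hz'
    set r' := max (3 * R / 4) (dist z s0) with hr'
    have hr1 : r' < R := max_lt (by linarith) hz'
    have hr2 : 3 * R / 4 ≤ r' := le_max_left _ _
    have := Complex.norm_le_of_forall_mem_frontier_norm_le (f := dslope f ρ) (U := ball s0 r') (C := K / 2 * ‖dslope f ρ s0‖)
      isBounded_ball (DifferentiableOn.diffContOnCl (hg.mono (closure_ball_subset_closedBall.trans (closedBall_subset_ball hr1)))) ?_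
      (z := z) (by rw [closure_ball _ (ne_of_gt (by linarith : 0 < r')), mem_closedBall]; exact le_max_right _ _)
    · exact this
    · intro w hw
      rw [frontier_ball _ (ne_of_gt (by linarith : 0 < r'))] at hw
      rw [mem_sphere, dist_eq_norm] at hw
      have h1 := hb w (by rw [mem_ball, dist_eq_norm]; linarith)
      rw [hfg w, hfg s0, norm_mul, norm_mul] at h1
      have h2 : R / 2 ≤ ‖w - ρ‖ := by
        have := norm_sub_le (w - ρ) (s0 - ρ)
        rw [sub_sub_sub_cancel_right] at this; linarith
      have h3 : K * (‖s0 - ρ‖ * ‖dslope f ρ s0‖) ≤ K * (R / 4 * ‖dslope f ρ s0‖) := by gcongr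
      have h4 : R / 2 * ‖dslope f ρ w‖ ≤ ‖w - ρ‖ * ‖dslope f ρ w‖ := by gcongr
      have h5 : R / 2 * ‖dslope f ρ w‖ ≤ R / 2 * (K / 2 * ‖dslope f ρ s0‖) := by linarith
      exact le_of_mul_le_mul_left h5 (by linarith)
  · intro z hz1 hz2
    exact hre z hz1 (by rw [hfg, hz2, mul_zero])
  · have hgd := (hg.differentiableAt (isOpen_ball.mem_nhds hs0)).hasDerivAt
    have h1 : HasDerivAt (fun z => (z - ρ) * dslope f ρ z) (1 * dslope f ρ s0 + (s0 - ρ) * deriv (dslope f ρ) s0) s0 :=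
      ((hasDerivAt_id s0).sub_const ρ).mul hgd
    have h2 : f = fun z => (z - ρ) * dslope f ρ z := funext hfg
    have h3 : deriv f s0 = 1 * dslope f ρ s0 + (s0 - ρ) * deriv (dslope f ρ) s0 := by
      conv_lhs => rw [h2]
      exact h1.deriv
    rw [h3, hfg s0]
    have := sub_ne_zero.2 hne
    field_simp
    ring

open Metric in
lemma landau {s0 : ℂ} {R : ℝ} (hR : 0 < R) (n : ℕ) : ∀ f : ℂ → ℂ, DifferentiableOn ℂ f (ball s0 R) →
    f s0 ≠ 0 → (∀ z ∈ ball s0 R, ‖f z‖ ≤ 2 ^ n * ‖f s0‖) → (∀ z ∈ closedBall s0 (R / 4), f z = 0 → z.re < s0.re) →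
    -(deriv f s0 / f s0).re ≤ 96 * (n + 1) / R := by
  induction n with
  | zero =>
    intro f hf h0 hb hre
    by_cases hz : ∃ ρ ∈ closedBall s0 (R / 4), f ρ = 0
    · obtain ⟨ρ, hρ, hz⟩ := hz
      obtain ⟨g, _, g1, g2, _⟩ := landau_step hR hf (by positivity) h0 hb hρ hz hre
      have := g2 s0 (mem_ball_self hR)
      have := norm_pos_iff.2 g1
      rw [pow_zero] at *; linarith
    · push Not at hz
      have h4 : ball s0 (R / 4) ⊆ ball s0 R := ball_subset_ball (by linarith)
      have := bc (g := f) (s0 := s0) (R := R / 4) (M := 1) (by positivity) one_pos (hf.mono h4)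
        (fun z hz' => hz z (ball_subset_closedBall hz')) (fun z hz' => (hb z (h4 hz')).trans (by
          gcongr; simpa using add_one_le_exp (1:ℝ) |>.trans' (by norm_num))) s0 (mem_ball_self (by positivity))
      have h5 := (neg_le_abs _).trans ((Complex.abs_re_le_norm (deriv f s0 / f s0)).trans this)
      refine h5.trans (le_of_eq ?_); push_cast; field_simp; norm_num
  | succ n ih =>
    intro f hf h0 hb hre
    by_cases hz : ∃ ρ ∈ closedBall s0 (R / 4), f ρ = 0
    · obtain ⟨ρ, hρ, hz⟩ := hz
      obtain ⟨g, g0, g1, g2, g3, g4⟩ := landau_step hR hf (by positivity) h0 hb hρ hz hre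
      have := ih g g0 g1 (fun z hz => (g2 z hz).trans (le_of_eq (by rw [pow_succ]; ring))) g3
      rw [g4, Complex.add_re]
      have h6 : 0 ≤ (1 / (s0 - ρ)).re := by
        rw [one_div, Complex.inv_re]
        have := hre ρ hρ hz
        exact div_nonneg (by simp; linarith) (Complex.normSq_nonneg _)
      have h7 : 96 * ((n:ℝ) + 1) / R ≤ 96 * (((n + 1 : ℕ) : ℝ) + 1) / R := by gcongr; simp
      linarith
    · push Not at hz
      have h4 : ball s0 (R / 4) ⊆ ball s0 R := ball_subset_ball (by linarith)
      have := bc (g := f) (s0 := s0) (R := R / 4) (M := (n + 1 : ℕ) + 1) (by positivity) (by positivity) (hf.mono h4)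
        (fun z hz' => hz z (ball_subset_closedBall hz')) (fun z hz' => (hb z (h4 hz')).trans (by
          gcongr
          have e1 : (2:ℝ) ≤ exp 1 := by simpa using add_one_le_exp (1:ℝ) |>.trans' (by norm_num)
          calc (2:ℝ) ^ (n + 1) ≤ exp 1 ^ (n + 1) := by gcongr
            _ = exp ((n + 1 : ℕ) : ℝ) := by rw [← exp_nat_mul, mul_one]
            _ ≤ _ := exp_le_exp.2 (by linarith))) s0 (mem_ball_self (by positivity))
      have h5 := (neg_le_abs _).trans ((Complex.abs_re_le_norm (deriv f s0 / f s0)).trans this)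
      refine h5.trans (le_of_eq ?_); field_simp; norm_num

open Metric in
lemma landau' {s0 ρ : ℂ} {R : ℝ} (hR : 0 < R) (n : ℕ) {f : ℂ → ℂ} (hf : DifferentiableOn ℂ f (ball s0 R))
    (h0 : f s0 ≠ 0) (hb : ∀ z ∈ ball s0 R, ‖f z‖ ≤ 2 ^ n * ‖f s0‖) (hre : ∀ z ∈ closedBall s0 (R / 4), f z = 0 → z.re < s0.re)
    (hρ : ρ ∈ closedBall s0 (R / 4)) (hz : f ρ = 0) :
    -(deriv f s0 / f s0).re ≤ 96 * (n + 1) / R - (1 / (s0 - ρ)).re := by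
  obtain ⟨g, g0, g1, g2, g3, g4⟩ := landau_step hR hf (by positivity) h0 hb hρ hz hre
  have := landau hR n g g0 g1 (fun z hz => (g2 z hz).trans (by
    gcongr; have : (0:ℝ) < 2 ^ n := by positivity
    linarith)) g3
  rw [g4, Complex.add_re]; linarith
lemma norm_LSeries_le {f g : ℕ → ℂ} (hfg : ∀ n, ‖f n‖ ≤ ‖g n‖) (hg : ∀ n, g n = (‖g n‖ : ℝ)) {s : ℂ} {σ : ℝ} (hσ : σ ≤ s.re)
    (hs : LSeriesSummable g (σ : ℂ)) : ‖LSeries f s‖ ≤ ‖LSeries g (σ : ℂ)‖ := by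
  have h1 : ∀ n, ‖LSeries.term f s n‖ ≤ ‖LSeries.term g (σ:ℂ) n‖ := fun n => by
    rw [LSeries.norm_term_eq, LSeries.norm_term_eq, Complex.ofReal_re]
    split_ifs with hn
    · exact le_rfl
    · have : (1:ℝ) ≤ n := by exact_mod_cast Nat.one_le_iff_ne_zero.2 hn
      gcongr
      exact hfg n
  have h2 : ∀ n, LSeries.term g (σ:ℂ) n = (‖LSeries.term g (σ:ℂ) n‖ : ℝ) := fun n => by
    rw [LSeries.norm_term_eq, Complex.ofReal_re, LSeries.term_def]
    split_ifs
    · simp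
    · rw [hg n, Complex.ofReal_div, Complex.ofReal_cpow (by positivity)]; simp
  have h3 : LSeries g (σ : ℂ) = ((∑' n, ‖LSeries.term g (σ:ℂ) n‖ : ℝ) : ℂ) := by
    rw [LSeries, Complex.ofReal_tsum]; exact tsum_congr h2
  rw [h3, Complex.norm_real, Real.norm_of_nonneg (tsum_nonneg fun _ => norm_nonneg _)]
  exact tsum_of_norm_bounded hs.norm.hasSum h1

lemma norm_inv_zeta {s : ℂ} (hs : 1 < s.re) : ‖(riemannZeta s)⁻¹‖ ≤ ‖riemannZeta (s.re : ℂ)‖ := by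
  have h1 := LSeries_one_mul_Lseries_moebius hs
  rw [LSeries_one_eq_riemannZeta hs] at h1
  have h0 := riemannZeta_ne_zero_of_one_lt_re hs
  rw [← eq_inv_of_mul_eq_one_right h1, ← LSeries_one_eq_riemannZeta (s := (s.re : ℂ)) (by simpa using hs)]
  refine norm_LSeries_le ?_ ?_ le_rfl ?_
  · intro n
    rw [Complex.norm_intCast, Pi.one_apply, norm_one]
    exact_mod_cast ArithmeticFunction.abs_moebius_le_one
  · intro n; simp
  · exact LSeriesSummable_one_iff.2 (by simpa using hs)

lemma norm_logderiv {s : ℂ} {σ : ℝ} (hσ : 1 < σ) (hs : σ ≤ s.re) :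
    ‖deriv riemannZeta s / riemannZeta s‖ ≤ ‖deriv riemannZeta (σ:ℂ) / riemannZeta (σ : ℂ)‖ := by
  have h1 := ArithmeticFunction.LSeries_vonMangoldt_eq_deriv_riemannZeta_div (hσ.trans_le hs)
  have hs' : 1 < (σ : ℂ).re := by simpa using hσ
  have h2 := ArithmeticFunction.LSeries_vonMangoldt_eq_deriv_riemannZeta_div hs'
  rw [neg_div] at h1 h2
  rw [← norm_neg, ← h1, ← norm_neg (deriv _ _ / _), ← h2]
  refine norm_LSeries_le ?_ ?_ hs ?_
  · intro n; exact le_rfl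
  · intro n; rw [Complex.norm_real, Real.norm_of_nonneg ArithmeticFunction.vonMangoldt_nonneg]
  · exact ArithmeticFunction.LSeriesSummable_vonMangoldt hs'

lemma l341 {σ t : ℝ} (hσ : 1 < σ) :
    0 ≤ 3 * (-(deriv riemannZeta σ / riemannZeta σ).re)
      + 4 * (-(deriv riemannZeta (σ + t * Complex.I) / riemannZeta (σ + t * Complex.I)).re)
      + (-(deriv riemannZeta (σ + (2 * t : ℝ) * Complex.I) / riemannZeta (σ + (2 * t : ℝ) * Complex.I)).re) := by
  have hs : ∀ y : ℝ, 1 < ((σ : ℂ) + y * Complex.I).re := fun y => by simpa using hσ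
  have h0 : -(deriv riemannZeta σ / riemannZeta σ).re = -(deriv riemannZeta (σ + (0:ℝ) * Complex.I) / riemannZeta (σ + (0:ℝ) * Complex.I)).re := by
    rw [Complex.ofReal_zero, zero_mul, add_zero]
  obtain ⟨A, hAd⟩ : ∃ A : ℝ → ℕ → ℝ, ∀ y n, A y n = (LSeries.term (fun n => (ArithmeticFunction.vonMangoldt n : ℂ)) ((σ : ℂ) + y * Complex.I) n).re :=
    ⟨_, fun _ _ => rfl⟩
  have key : ∀ y : ℝ, -(deriv riemannZeta (σ + y * Complex.I) / riemannZeta (σ + y * Complex.I)).re = ∑' n, A y n := fun y => by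
    simp_rw [hAd]
    rw [← Complex.neg_re, ← neg_div, ← ArithmeticFunction.LSeries_vonMangoldt_eq_deriv_riemannZeta_div (hs y), LSeries]
    exact Complex.re_tsum (ArithmeticFunction.LSeriesSummable_vonMangoldt (hs y))
  have hsum : ∀ y : ℝ, Summable (A y) := fun y => by
    rw [funext (hAd y)]
    exact (Complex.hasSum_re (ArithmeticFunction.LSeriesSummable_vonMangoldt (hs y)).hasSum).summable
  rw [h0, key 0, key t, key (2 * t), ← tsum_mul_left, ← tsum_mul_left, ← Summable.tsum_add, ← Summable.tsum_add]
  rotate_left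
  · exact ((hsum 0).mul_left 3).add ((hsum t).mul_left 4)
  · exact hsum _
  · exact (hsum 0).mul_left 3
  · exact (hsum t).mul_left 4
  refine tsum_nonneg fun n => ?_
  rcases eq_or_ne n 0 with rfl | hn
  · simp [hAd]
  have hn' : (n:ℂ) ≠ 0 := by exact_mod_cast hn
  set u : ℂ := Complex.exp (-(t * log n : ℝ) * Complex.I) with hu
  have hterm : ∀ y : ℝ, LSeries.term (fun n => (ArithmeticFunction.vonMangoldt n : ℂ)) ((σ : ℂ) + y * Complex.I) n =
      ((ArithmeticFunction.vonMangoldt n / (n:ℝ) ^ σ : ℝ) : ℂ) * Complex.exp (-(y * log n : ℝ) * Complex.I) := fun y => by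
    rw [LSeries.term_of_ne_zero hn, Complex.cpow_add _ _ hn', Complex.cpow_def_of_ne_zero hn' (y * Complex.I), neg_mul, Complex.exp_neg,
      Complex.ofReal_div, Complex.ofReal_cpow (by positivity), ← Complex.natCast_log]
    push_cast
    rw [div_mul_eq_div_div, div_eq_mul_inv (_ / _)]
    congr 3; ring
  rw [hAd, hAd, hAd, hterm, hterm, hterm, Complex.re_ofReal_mul, Complex.re_ofReal_mul, Complex.re_ofReal_mul]
  have e0 : (Complex.exp (-((0:ℝ) * log n : ℝ) * Complex.I)).re = 1 := by simp
  have e1 : (Complex.exp (-(t * log n : ℝ) * Complex.I)).re = cos (t * log n) := by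
    rw [← Complex.ofReal_neg, Complex.exp_ofReal_mul_I_re, cos_neg]
  have e2 : (Complex.exp (-((2 * t) * log n : ℝ) * Complex.I)).re = 2 * cos (t * log n) ^ 2 - 1 := by
    rw [← Complex.ofReal_neg, Complex.exp_ofReal_mul_I_re, cos_neg, mul_assoc, cos_two_mul]
  rw [e0, e1, e2]
  have hA : 0 ≤ ArithmeticFunction.vonMangoldt n / (n:ℝ) ^ σ := div_nonneg ArithmeticFunction.vonMangoldt_nonneg (by positivity)
  nlinarith [mul_nonneg hA (sq_nonneg (1 + cos (t * log n)))]

lemma zeta_near : ∃ C0 δ0 : ℝ, 0 < C0 ∧ 0 < δ0 ∧ ∀ δ : ℝ, 0 < δ → δ ≤ δ0 →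
    ‖riemannZeta ((1 + δ : ℝ) : ℂ)‖ ≤ 2 / δ ∧ -(deriv riemannZeta ((1 + δ : ℝ) : ℂ) / riemannZeta ((1 + δ : ℝ) : ℂ)).re ≤ 1 / δ + C0 ∧
    ‖deriv riemannZeta ((1 + δ : ℝ) : ℂ) / riemannZeta ((1 + δ : ℝ) : ℂ)‖ ≤ 1 / δ + C0 := by
  obtain ⟨C, hC⟩ := log_deriv_riemannZeta_add_inv_sub_bounded.bound
  have h2 : ∀ᶠ s in nhds (1:ℂ), ‖riemannZeta₁ s‖ < 2 :=
    (differentiable_riemannZeta₁.continuous.norm.continuousAt (x := (1:ℂ))).eventually_lt continuousAt_const (by rw [riemannZeta₁_one]; norm_num)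
  rw [eventually_nhdsWithin_iff] at hC
  obtain ⟨r, hr, h⟩ := Metric.eventually_nhds_iff.1 (hC.and h2)
  refine ⟨|C| + 1, r / 2, by positivity, by positivity, fun δ h0 h1 => ?_⟩
  have hd : ‖((1 + δ : ℝ) : ℂ) - 1‖ = δ := by
    push_cast; rw [add_sub_cancel_left, Complex.norm_real, Real.norm_of_nonneg h0.le]
  obtain ⟨a1, a2⟩ := h (y := ((1 + δ : ℝ) : ℂ)) (by rw [dist_eq_norm, hd]; linarith)
  have hne : ((1 + δ : ℝ) : ℂ) ≠ 1 := by
    intro h; rw [h, sub_self, norm_zero] at hd; linarith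
  have a1 := a1 hne
  rw [norm_one, mul_one] at a1
  have a3 : ‖(((1 + δ : ℝ) : ℂ) - 1)⁻¹‖ = 1 / δ := by rw [norm_inv, hd, one_div]
  have a5 : ‖deriv riemannZeta ((1 + δ : ℝ) : ℂ) / riemannZeta ((1 + δ : ℝ) : ℂ)‖ ≤ 1 / δ + (|C| + 1) := by
    have := norm_sub_le (deriv riemannZeta ((1 + δ : ℝ) : ℂ) / riemannZeta ((1 + δ : ℝ) : ℂ) + (((1 + δ : ℝ) : ℂ) - 1)⁻¹) (((1 + δ : ℝ) : ℂ) - 1)⁻¹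
    rw [add_sub_cancel_right, a3] at this
    have h5 : _ ≤ C := a1
    linarith [le_abs_self C]
  refine ⟨?_, ((neg_le_abs _).trans (Complex.abs_re_le_norm _)).trans a5, a5⟩
  rw [riemannZeta_eq_inv_sub_mul hne, norm_mul]
  have : ‖(((1 + δ : ℝ) : ℂ) - 1)⁻¹‖ = 1 / δ := by rw [norm_inv, hd, one_div]
  rw [div_eq_mul_inv, mul_comm]
  first
  | (rw [this, one_div]; gcongr)
  | (rw [norm_div, hd, norm_one, one_div, mul_comm]; gcongr)
lemma zeta_bd' {s : ℂ} (hL : 42000 ≤ log |s.im|) (hσ : 1 - (log |s.im|) ^ (-(2/3) : ℝ) ≤ s.re) (hσ2 : s.re ≤ 3) :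
    ‖riemannZeta s‖ ≤ exp 40020 * log |s.im| := by
  have h0 : s.im ≠ 0 := by
    intro h; rw [h] at hL; norm_num at hL
  have := zeta_bd (abs_pos.2 h0) hL hσ hσ2
  rcases abs_cases s.im with ⟨h, _⟩ | ⟨h, _⟩
  · rw [h, Complex.re_add_im] at this; rw [h]; exact this
  · have e : ((s.re : ℂ) + ((|s.im| : ℝ) : ℂ) * Complex.I) = (starRingEnd ℂ) s := by
      apply Complex.ext <;> simp [h]
    rw [e, riemannZeta_conj, Complex.norm_conj] at this; exact this

lemma loc_bd {t : ℝ} (ht : 50000 ≤ log |t|) {z : ℂ} (h1 : |t| - 1 ≤ |z.im|) (h2 : |z.im| ≤ 2 * |t| + 1)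
    (h3 : 1 - (log |t|) ^ (-(2/3) : ℝ) / 2 ≤ z.re) (h4 : z.re ≤ 3) : ‖riemannZeta z‖ ≤ exp 40021 * log |t| := by
  have ht0 : 0 < |t| := by
    rcases (abs_nonneg t).eq_or_lt with h | h
    · rw [← h] at ht; norm_num at ht
    · exact h
  have ht2 : 2 ≤ |t| := by linarith [log_le_sub_one_of_pos ht0]
  have hz1 : log |t| - 1 ≤ log |z.im| := by
    have : log (|t| / 2) ≤ log |z.im| := log_le_log (by linarith) (by linarith)
    rw [log_div ht0.ne' two_ne_zero] at this
    linarith [log_two_lt_d9]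
  have hz2 : log |z.im| ≤ 2 * log |t| := by
    have : log |z.im| ≤ log (|t| ^ 2) := log_le_log (by linarith) (by nlinarith [log_le_sub_one_of_pos ht0])
    rwa [log_pow, Nat.cast_ofNat] at this
  have h5 : (log |t|) ^ (-(2/3) : ℝ) / 2 ≤ (log |z.im|) ^ (-(2/3) : ℝ) := by
    calc (log |t|) ^ (-(2/3) : ℝ) / 2 = 2 ^ (-1 : ℝ) * (log |t|) ^ (-(2/3) : ℝ) := by rw [rpow_neg_one]; ring
      _ ≤ 2 ^ (-(2/3) : ℝ) * (log |t|) ^ (-(2/3) : ℝ) := by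
        gcongr
        · norm_num
        · norm_num
      _ = (2 * log |t|) ^ (-(2/3) : ℝ) := by rw [mul_rpow (by norm_num) (by linarith)]
      _ ≤ _ := rpow_le_rpow_of_nonpos (by linarith) hz2 (by norm_num)
  refine (zeta_bd' (by linarith) (by linarith) h4).trans ?_
  have h6 : exp 40021 = exp 40020 * exp 1 := by rw [← exp_add]; norm_num
  have h7 : 2 ≤ exp 1 := by linarith [add_one_le_exp (1:ℝ)]
  rw [h6, mul_assoc]
  gcongr
  nlinarith

lemma zf_eventually {η C0 δ0 : ℝ} (hη : 0 < η) (hδ0 : 0 < δ0) : ∀ᶠ l : ℝ in atTop, 50000 ≤ l ∧ 16 ≤ l ^ (η / 2) ∧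
    2 * (40022 + 3 * log l) + 2 ≤ l ^ (η / 4) ∧ 3 * C0 + 960 * (l ^ (2/3 + η / 4 : ℝ)) ≤ l ^ (2/3 + η / 2 : ℝ) / 4 ∧
    l ^ (-(2/3 + η / 2) : ℝ) ≤ δ0 ∧ 8 ≤ l ^ (η / 2) := by
  have h1 : ∀ {c : ℝ}, 0 < c → Tendsto (fun l : ℝ => l ^ c) atTop atTop := fun hc => tendsto_rpow_atTop hc
  have a1 := (h1 (c := η / 2) (by positivity)).eventually_ge_atTop 16
  have a2 := (isLittleO_log_rpow_atTop (r := η / 4) (by positivity)).bound (c := 1/12) (by norm_num)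
  have a3 := (h1 (c := η / 4) (by positivity)).eventually_ge_atTop 400000
  have a4 := (h1 (c := η / 4) (by positivity)).eventually_ge_atTop (8 * 960)
  have a5 := (h1 (c := 2/3 + η / 2) (by positivity)).eventually_ge_atTop (24 * C0)
  have a6 : ∀ᶠ l : ℝ in atTop, l ^ (-(2/3 + η / 2) : ℝ) ≤ δ0 :=
    (tendsto_rpow_neg_atTop (y := 2/3 + η / 2) (by positivity)).eventually_le_const hδ0
  filter_upwards [a1, a2, a3, a4, a5, a6, eventually_ge_atTop 50000] with l b1 b2 b3 b4 b5 b6 b7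
  have hl : 0 < l := by linarith
  refine ⟨b7, b1, ?_, ?_, b6, by linarith⟩
  · rw [Real.norm_of_nonneg (log_nonneg (by linarith)), Real.norm_of_nonneg (by positivity)] at b2
    linarith
  · have : l ^ (2/3 + η / 2 : ℝ) = l ^ (2/3 + η / 4 : ℝ) * l ^ (η / 4) := by rw [← rpow_add hl]; ring_nf
    have h2 : 0 < l ^ (2/3 + η / 4 : ℝ) := by positivity
    nlinarith

lemma zero_free {η : ℝ} (hη : 0 < η) (hη1 : η ≤ 1) : ∃ L0 : ℝ, ∀ s : ℂ, L0 ≤ log |s.im| →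
    1 - (log |s.im|) ^ (-(2/3 + η) : ℝ) ≤ s.re → riemannZeta s ≠ 0 := by
  obtain ⟨C0, δ0, hC0, hδ0, hnear⟩ := zeta_near
  obtain ⟨L0, hL0⟩ := eventually_atTop.1 (zf_eventually (η := η) (C0 := C0) hη hδ0)
  refine ⟨L0, fun ρ hL hre hz => ?_⟩
  obtain ⟨b1, b2, b3, b4, b5, b6⟩ := hL0 _ hL
  have hβ : ρ.re < 1 := by
    by_contra h
    exact riemannZeta_ne_zero_of_one_le_re (not_lt.1 h) hz
  set t := ρ.im with ht
  set l := log |t| with hl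
  have hl0 : 0 < l := by linarith
  have ht0 : 0 < |t| := by
    rcases (abs_nonneg t).eq_or_lt with h | h
    · rw [hl, ← h] at b1; norm_num at b1
    · exact h
  have ht2 : 10 ≤ |t| := by linarith [log_le_sub_one_of_pos ht0]
  obtain ⟨δ, hδ⟩ : ∃ δ, δ = l ^ (-(2/3 + η / 2) : ℝ) := ⟨_, rfl⟩
  obtain ⟨R, hR⟩ : ∃ R, R = l ^ (-(2/3) : ℝ) / 2 := ⟨_, rfl⟩
  have hδp : 0 < δ := by rw [hδ]; positivity
  have hRp : 0 < R := by rw [hR]; positivity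
  have hRδ : δ * l ^ (η / 2) = 2 * R := by
    rw [hδ, hR, ← rpow_add hl0]; ring_nf
  have hδR : 8 * δ ≤ R := by nlinarith
  have hR1 : R ≤ 1 / 2 := by
    rw [hR]; have := rpow_le_one_of_one_le_of_nonpos (x := l) (z := -(2/3)) (by linarith) (by norm_num)
    linarith
  have hsmall : l ^ (-(2/3 + η) : ℝ) * 8 ≤ δ := by
    have : δ = l ^ (-(2/3 + η) : ℝ) * l ^ (η / 2) := by rw [hδ, ← rpow_add hl0]; ring_nf
    rw [this]; gcongr
  have hinv : 1 / δ = l ^ (2/3 + η / 2 : ℝ) := by rw [hδ, rpow_neg hl0.le, one_div, inv_inv]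
  obtain ⟨n1, n2, n3⟩ := hnear δ hδp (hδ ▸ b5)
  -- the integer n
  obtain ⟨n, hn⟩ : ∃ n : ℕ, n = ⌈2 * (40022 + 3 * l.log)⌉₊ := ⟨_, rfl⟩
  have hll : 0 ≤ l.log := log_nonneg (by linarith)
  have hn1 : (n:ℝ) + 1 ≤ l ^ (η / 4) := by
    have := Nat.ceil_lt_add_one (a := 2 * (40022 + 3 * l.log)) (by positivity)
    rw [hn]; linarith
  have hn2 : exp 40022 * l ^ 3 ≤ (2:ℝ) ^ n := by
    have h1 : 2 * (40022 + 3 * l.log) ≤ n := by rw [hn]; exact Nat.le_ceil _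
    calc exp 40022 * l ^ 3 = exp (40022 + 3 * l.log) := by
          rw [exp_add, mul_comm 3, exp_mul, exp_log hl0]; norm_cast
      _ ≤ exp (log 2 * n) := exp_le_exp.2 (by nlinarith [log_two_gt_d9])
      _ = 2 ^ n := by rw [exp_mul, exp_log two_pos, rpow_natCast]
  have hδl : 1 / δ ≤ l ^ 2 := by
    rw [hinv, ← rpow_natCast]
    exact rpow_le_rpow_of_exponent_le (by linarith) (by push_cast; linarith)
  -- common facts at s0 = 1+δ+iy
  have common : ∀ y : ℝ, |t| ≤ |y| → |y| ≤ 2 * |t| → ∀ s0 : ℂ, s0 = ((1 + δ : ℝ) : ℂ) + y * Complex.I →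
      DifferentiableOn ℂ riemannZeta (Metric.ball s0 R) ∧ riemannZeta s0 ≠ 0 ∧
      (∀ z ∈ Metric.ball s0 R, ‖riemannZeta z‖ ≤ 2 ^ n * ‖riemannZeta s0‖) ∧
      (∀ z ∈ Metric.closedBall s0 (R / 4), riemannZeta z = 0 → z.re < s0.re) := by
    intro y hy1 hy2 s0 hs0
    have hs0re : s0.re = 1 + δ := by rw [hs0]; simp
    have hs0im : s0.im = y := by rw [hs0]; simp
    have hne0 := riemannZeta_ne_zero_of_one_le_re (s := s0) (by rw [hs0re]; linarith)
    have hbox : ∀ z ∈ Metric.ball s0 R, |t| - 1 ≤ |z.im| ∧ |z.im| ≤ 2 * |t| + 1 ∧ 1 - R ≤ z.re ∧ z.re ≤ 3 := by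
      intro z hz
      rw [Metric.mem_ball, dist_eq_norm] at hz
      have h1 := (Complex.abs_im_le_norm (z - s0)).trans hz.le
      have h2 := (Complex.abs_re_le_norm (z - s0)).trans hz.le
      rw [Complex.sub_im, hs0im] at h1
      rw [Complex.sub_re, hs0re] at h2
      have h3 := abs_sub_abs_le_abs_sub z.im y
      have h4 := abs_sub_abs_le_abs_sub y z.im
      rw [abs_sub_comm] at h4
      rw [abs_le] at h2
      refine ⟨by linarith, by linarith, by linarith, by linarith⟩
    refine ⟨fun z hz => ?_, hne0, fun z hz => ?_, fun z hz hz0 => ?_⟩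
    · refine (differentiableAt_riemannZeta ?_).differentiableWithinAt
      rintro rfl
      have := (hbox 1 hz).1
      simp at this; linarith
    · obtain ⟨c1, c2, c3, c4⟩ := hbox z hz
      have h1 := loc_bd (t := t) b1 c1 c2 (by rw [← hl, ← hR]; exact c3) c4
      have h2 := norm_inv_zeta (s := s0) (by rw [hs0re]; linarith)
      rw [hs0re, norm_inv] at h2
      have h3 := h2.trans n1
      have h4 : 1 ≤ ‖riemannZeta s0‖ * (2 * l ^ 2) := by
        have h5 := norm_pos_iff.2 hne0
        rw [inv_le_iff_one_le_mul₀ h5] at h3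
        refine h3.trans ?_
        rw [mul_comm]; gcongr
        calc 2 / δ = 2 * (1 / δ) := by ring
          _ ≤ _ := by gcongr
      calc ‖riemannZeta z‖ ≤ exp 40021 * l * 1 := by rw [mul_one]; exact h1
        _ ≤ exp 40021 * l * (‖riemannZeta s0‖ * (2 * l ^ 2)) := by gcongr
        _ = (exp 40021 * 2 * l ^ 3) * ‖riemannZeta s0‖ := by ring
        _ ≤ (exp 40022 * l ^ 3) * ‖riemannZeta s0‖ := by
          gcongr
          rw [show (40022:ℝ) = 40021 + 1 by norm_num, exp_add]
          gcongr
          linarith [add_one_le_exp (1:ℝ)]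
        _ ≤ _ := by gcongr
    · by_contra h
      exact riemannZeta_ne_zero_of_one_le_re (s := z) (by rw [hs0re] at h; linarith) hz0
  obtain ⟨p1, p2, p3, p4⟩ := common t le_rfl (by linarith) _ rfl
  obtain ⟨q1, q2, q3, q4⟩ := common (2 * t) (by rw [abs_mul, abs_two]; linarith) (by rw [abs_mul, abs_two]) _ rfl
  have hdiff : ((1 + δ : ℝ) : ℂ) + t * Complex.I - ρ = ((1 + δ - ρ.re : ℝ) : ℂ) := by
    apply Complex.ext <;> simp [ht]
  have hρ : ρ ∈ Metric.closedBall (((1 + δ : ℝ) : ℂ) + t * Complex.I) (R / 4) := by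
    rw [Metric.mem_closedBall, dist_comm, dist_eq_norm, hdiff, Complex.norm_real, Real.norm_of_nonneg (by linarith)]
    linarith
  have A := landau' hRp n p1 p2 p3 p4 hρ hz
  have B := landau hRp n _ q1 q2 q3 q4
  have D := l341 (σ := 1 + δ) (t := t) (by linarith)
  have hE : (1 / (((1 + δ : ℝ) : ℂ) + t * Complex.I - ρ)).re = 1 / (1 + δ - ρ.re) := by
    rw [hdiff, ← Complex.ofReal_one, ← Complex.ofReal_div, Complex.ofReal_re]
  rw [hE] at A
  have hN : 96 * ((n:ℝ) + 1) / R ≤ 192 * l ^ (2/3 + η / 4 : ℝ) := by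
    have : 1 / R = 2 * l ^ (2/3 : ℝ) := by
      rw [hR, rpow_neg hl0.le, one_div, inv_div, div_eq_mul_inv, inv_inv]
    calc 96 * ((n:ℝ) + 1) / R = 96 * ((n:ℝ) + 1) * (1 / R) := by ring
      _ ≤ 96 * l ^ (η / 4) * (2 * l ^ (2/3 : ℝ)) := by rw [this]; gcongr
      _ = 192 * (l ^ (2/3:ℝ) * l ^ (η / 4)) := by ring
      _ = _ := by rw [← rpow_add hl0]
  have hfin : 4 * (1 / (1 + δ - ρ.re)) ≤ 3 * (1 / δ) + (1 / δ) / 4 := by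
    rw [← hinv] at b4
    linarith
  have hx : 1 + δ - ρ.re ≤ 9 / 8 * δ := by linarith
  have hx0 : 0 < 1 + δ - ρ.re := by linarith
  have : 1 / (9 / 8 * δ) ≤ 1 / (1 + δ - ρ.re) := one_div_le_one_div_of_le hx0 hx
  have e : 1 / (9 / 8 * δ) = 8 / 9 * (1 / δ) := by field_simp
  have : 0 < 1 / δ := by positivity
  linarith
noncomputable def FF (s : ℂ) : ℂ := -(deriv riemannZeta₁ s / riemannZeta₁ s) - riemannZeta₀ s
noncomputable def cL (n : ℕ) : ℂ := (ArithmeticFunction.vonMangoldt n : ℂ) - 1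

lemma FF_diff {s : ℂ} (hs : riemannZeta₁ s ≠ 0) : DifferentiableAt ℂ FF s := by
  have h1 : DifferentiableAt ℂ (deriv riemannZeta₁) s :=
    (differentiable_riemannZeta₁.analyticAt s).deriv.differentiableAt
  exact ((h1.div differentiable_riemannZeta₁.differentiableAt hs).neg).sub differentiable_riemannZeta₀.differentiableAt

lemma zeta1_ne {s : ℂ} (h1 : s ≠ 1) (h : riemannZeta s ≠ 0) : riemannZeta₁ s ≠ 0 := by
  intro h0; rw [riemannZeta_eq_inv_sub_mul h1, h0, mul_zero] at h; exact h rfl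

lemma zeta1_ne' {s : ℂ} (h : 1 ≤ s.re) : riemannZeta₁ s ≠ 0 := by
  rcases eq_or_ne s 1 with rfl | h1
  · simp
  · exact zeta1_ne h1 (riemannZeta_ne_zero_of_one_le_re h)

lemma FF_eq {s : ℂ} (h1 : s ≠ 1) (h : riemannZeta s ≠ 0) : FF s = -(deriv riemannZeta s / riemannZeta s) - riemannZeta s := by
  have h2 := zeta1_ne h1 h
  have h3 := sub_ne_zero.2 h1
  rw [FF, deriv_riemannZeta_eq_neg_inv_sub_sq_mul_add h1]
  have e0 : riemannZeta₀ s = riemannZeta s - (s - 1)⁻¹ := by rw [riemannZeta_eq_inv_sub_add h1]; ring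
  rw [e0, riemannZeta_eq_inv_sub_mul h1]
  field_simp
  ring

lemma LS_eq {s : ℂ} (hs : 1 < s.re) : LSeries cL s = FF s := by
  have h1 : s ≠ 1 := by rintro rfl; simp at hs
  have e : cL = (fun n => (ArithmeticFunction.vonMangoldt n : ℂ)) - 1 := by funext n; simp [cL]
  rw [FF_eq h1 (riemannZeta_ne_zero_of_one_lt_re hs), e,
    LSeries_sub (ArithmeticFunction.LSeriesSummable_vonMangoldt hs) (LSeriesSummable_one_iff.2 hs),
    ArithmeticFunction.LSeries_vonMangoldt_eq_deriv_riemannZeta_div hs, LSeries_one_eq_riemannZeta hs, neg_div]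

lemma LS_iter {s : ℂ} (hs : 1 < s.re) {r B : ℝ} (hr : 0 < r) (m : ℕ)
    (h : ∀ z ∈ Metric.closedBall s r, riemannZeta₁ z ≠ 0 ∧ ‖FF z‖ ≤ B) :
    ‖iteratedDeriv m (LSeries cL) s‖ ≤ m.factorial * B / r ^ m := by
  have e : LSeries cL =ᶠ[nhds s] FF := by
    filter_upwards [(isOpen_lt continuous_const Complex.continuous_re).mem_nhds hs] with z hz using LS_eq hz
  rw [e.iteratedDeriv_eq m]
  refine Complex.norm_iteratedDeriv_le_of_forall_mem_sphere_norm_le m hr ?_ fun z hz => (h z (Metric.sphere_subset_closedBall hz)).2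
  refine DifferentiableOn.diffContOnCl fun z hz => (FF_diff (h z ?_).1).differentiableWithinAt
  exact Metric.closure_ball_subset_closedBall hz

lemma FF_compact (T : ℝ) : ∃ A : ℝ, 1 ≤ A ∧ ∀ s : ℂ, 1 < s.re → s.re ≤ 2 → |s.im| ≤ T → ∀ m : ℕ,
    ‖iteratedDeriv m (LSeries cL) s‖ ≤ m.factorial * A ^ (m + 1) := by
  have hK : IsCompact (Set.Icc (1:ℝ) 2 ×ℂ Set.Icc (-T) T) := isCompact_Icc.reProdIm isCompact_Icc
  have hU : IsOpen {s : ℂ | riemannZeta₁ s ≠ 0} := isOpen_ne_fun differentiable_riemannZeta₁.continuous continuous_const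
  obtain ⟨r, hr, hrU⟩ := hK.exists_cthickening_subset_open hU (fun s hs => zeta1_ne' hs.1.1)
  obtain ⟨B, hB⟩ := (hK.cthickening (r := r)).exists_bound_of_continuousOn (f := FF)
    (fun z hz => (FF_diff (hrU hz)).continuousAt.continuousWithinAt)
  refine ⟨max 1 (max B (1 / r)), le_max_left _ _, fun s h1 h2 h3 m => ?_⟩
  obtain ⟨A, hA⟩ : ∃ A, A = max 1 (max B (1 / r)) := ⟨_, rfl⟩
  rw [← hA]
  have a1 : B ≤ A := hA ▸ (le_max_left _ _).trans (le_max_right _ _)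
  have a2 : 1 / r ≤ A := hA ▸ (le_max_right _ _).trans (le_max_right _ _)
  have a3 : 1 ≤ A := hA ▸ le_max_left _ _
  have hs : s ∈ Set.Icc (1:ℝ) 2 ×ℂ Set.Icc (-T) T := ⟨⟨h1.le, h2⟩, abs_le.1 h3⟩
  have hsub := Metric.closedBall_subset_cthickening hs r
  refine (LS_iter h1 hr m fun z hz => ⟨hrU (hsub hz), hB z (hsub hz)⟩).trans ?_
  rw [mul_div_assoc, div_eq_mul_one_div, ← one_div_pow, pow_succ']
  gcongr

lemma FF_ev {η δ0 C0 : ℝ} (hη : 0 < η) (hδ0 : 0 < δ0) : ∀ᶠ l : ℝ in atTop, 50001 ≤ l ∧ 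
    l ^ (-(2/3 + η / 2) : ℝ) ≤ δ0 ∧ 1000 * (40030 + 3 * log l) + 8 + C0 + exp 40021 ≤ l ^ (η / 2) ∧ 0 ≤ log l := by
  have a1 := (tendsto_rpow_atTop (y := η / 2) (by positivity)).eventually_ge_atTop (2 * (1000 * 40030 + 8 + C0 + exp 40021))
  have a2 := (isLittleO_log_rpow_atTop (r := η / 2) (by positivity)).bound (c := 1/6000) (by norm_num)
  have a6 : ∀ᶠ l : ℝ in atTop, l ^ (-(2/3 + η / 2) : ℝ) ≤ δ0 :=
    (tendsto_rpow_neg_atTop (y := 2/3 + η / 2) (by positivity)).eventually_le_const hδ0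
  filter_upwards [a1, a2, a6, eventually_ge_atTop 50001] with l b1 b2 b3 b4
  have hl : 0 < l := by linarith
  rw [Real.norm_of_nonneg (log_nonneg (by linarith)), Real.norm_of_nonneg (by positivity)] at b2
  exact ⟨b4, b3, by linarith, log_nonneg (by linarith)⟩

lemma FF_large {η : ℝ} (hη : 0 < η) (hη1 : η ≤ 1) : ∃ L0 : ℝ, ∀ s : ℂ, 1 < s.re → s.re ≤ 2 → L0 ≤ log |s.im| → ∀ m : ℕ,
    ‖iteratedDeriv m (LSeries cL) s‖ ≤ m.factorial * (2 * log |s.im| ^ 2) * (32 * log |s.im| ^ (2/3 + η : ℝ)) ^ m := by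
  obtain ⟨C0, δ0, hC0, hδ0, hnear⟩ := zeta_near
  obtain ⟨L1, hL1⟩ := zero_free (η := η / 2) (by positivity) (by linarith)
  obtain ⟨L2, hL2⟩ := eventually_atTop.1 (FF_ev (η := η) (C0 := C0) hη hδ0)
  refine ⟨max (L1 + 1) L2, fun s hs1 hs2 hL m => ?_⟩
  obtain ⟨b1, b2, b3, b4⟩ := hL2 _ ((le_max_right _ _).trans hL)
  have hLL1 := (le_max_left _ _).trans hL
  set y := s.im with hy
  set l := log |y| with hl
  have hl0 : 0 < l := by linarith
  have ht0 : 0 < |y| := by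
    rcases (abs_nonneg y).eq_or_lt with h | h
    · rw [hl, ← h] at b1; norm_num at b1
    · exact h
  have ht2 : 10 ≤ |y| := by linarith [log_le_sub_one_of_pos ht0]
  obtain ⟨w, hw⟩ : ∃ w, w = l ^ (-(2/3 + η / 2) : ℝ) / 4 := ⟨_, rfl⟩
  have hwp : 0 < w := by rw [hw]; positivity
  have hw1 : w ≤ 1 / 4 := by
    rw [hw]; have := rpow_le_one_of_one_le_of_nonpos (x := l) (z := -(2/3 + η / 2)) (by linarith) (by linarith)
    linarith
  have hw2 : w ≤ l ^ (-(2/3) : ℝ) / 2 := by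
    rw [hw]; have := rpow_le_rpow_of_exponent_le (x := l) (y := -(2/3 + η / 2)) (z := -(2/3)) (by linarith) (by linarith)
    have h0 : 0 < l ^ (-(2/3) : ℝ) := by positivity
    linarith
  have hinv : 1 / w = 4 * l ^ (2/3 + η / 2 : ℝ) := by rw [hw, rpow_neg hl0.le, one_div, inv_div, div_eq_mul_inv, inv_inv]
  have hwl : 1 / w ≤ 4 * l ^ 2 := by
    rw [hinv, ← rpow_natCast]
    gcongr
    · linarith
    · push_cast; linarith
  -- box facts
  have box : ∀ z : ℂ, |z.im - y| ≤ 1 → 1 - w ≤ z.re → z.re ≤ 3 → z ≠ 1 ∧ riemannZeta z ≠ 0 ∧ ‖riemannZeta z‖ ≤ exp 40021 * l := by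
    intro z h1 h2 h3
    have h4 := abs_sub_abs_le_abs_sub z.im y
    have h5 := abs_sub_abs_le_abs_sub y z.im
    rw [abs_sub_comm] at h5
    have hz1 : l - 1 ≤ log |z.im| := by
      have : log (|y| / 2) ≤ log |z.im| := log_le_log (by linarith) (by linarith)
      rw [log_div ht0.ne' two_ne_zero] at this
      linarith [log_two_lt_d9]
    have hz2 : log |z.im| ≤ 2 * l := by
      have : log |z.im| ≤ log (|y| ^ 2) := log_le_log (by linarith) (by nlinarith)
      rwa [log_pow, Nat.cast_ofNat] at this
    refine ⟨?_, hL1 z (by linarith) ?_, loc_bd (t := y) (by linarith) (by linarith) (by linarith) (by linarith) h3⟩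
    · rintro rfl; simp at h1; linarith
    · have : w ≤ log |z.im| ^ (-(2/3 + η / 2) : ℝ) := by
        calc w = 2 ^ (-2:ℝ) * l ^ (-(2/3 + η / 2) : ℝ) := by rw [hw, rpow_neg two_pos.le]; norm_num; ring
          _ ≤ 2 ^ (-(2/3 + η / 2) : ℝ) * l ^ (-(2/3 + η / 2) : ℝ) := by
            gcongr
            · norm_num
            · linarith
          _ = (2 * l) ^ (-(2/3 + η / 2) : ℝ) := by rw [mul_rpow two_pos.le hl0.le]
          _ ≤ _ := rpow_le_rpow_of_nonpos (by linarith) hz2 (by linarith)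
      linarith
  obtain ⟨n1, -, n3⟩ := hnear (w / 2) (by positivity) (by
    have : 0 < l ^ (-(2/3 + η / 2) : ℝ) := by positivity
    rw [hw]; linarith)
  obtain ⟨M, hM⟩ : ∃ M, M = 40030 + 3 * log l := ⟨_, rfl⟩
  rw [← hM] at b3
  have hM1 : 40030 ≤ M := by linarith
  have hll : l ≤ exp M / exp 40026 / l ^ 2 := by
    rw [hM, exp_add, mul_comm 3, exp_mul, exp_log hl0, le_div_iff₀ (by positivity), le_div_iff₀ (by positivity)]
    have : exp (40026:ℝ) ≤ exp 40030 := exp_le_exp.2 (by norm_num)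
    have e : l ^ (3:ℝ) = l * l ^ 2 := by norm_cast; ring
    rw [e, mul_comm]; gcongr
  -- logderiv bound
  have hld : ∀ z ∈ Metric.closedBall s (w / 8), ‖deriv riemannZeta z / riemannZeta z‖ ≤ 4 / w + C0 + 16 * M / w := by
    intro z hz
    rw [Metric.mem_closedBall, dist_eq_norm] at hz
    have g1 := (Complex.abs_im_le_norm (z - s)).trans hz
    have g2 := (Complex.abs_re_le_norm (z - s)).trans hz
    rw [Complex.sub_re, abs_le] at g2
    by_cases hσ : s.re ≤ 1 + w
    · obtain ⟨s2, hs2⟩ : ∃ s2 : ℂ, s2 = ((1 + w / 2 : ℝ) : ℂ) + y * Complex.I := ⟨_, rfl⟩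
      have e1 : s2.re = 1 + w / 2 := by rw [hs2]; simp
      have e2 : s2.im = y := by rw [hs2]; simp
      have hbox2 : ∀ z ∈ Metric.ball s2 (3 * w / 2), |z.im - y| ≤ 1 ∧ 1 - w ≤ z.re ∧ z.re ≤ 3 := by
        intro z hz
        rw [Metric.mem_ball, dist_eq_norm] at hz
        have h1 := (Complex.abs_im_le_norm (z - s2)).trans hz.le
        have h2 := (Complex.abs_re_le_norm (z - s2)).trans hz.le
        rw [Complex.sub_im, e2] at h1
        rw [Complex.sub_re, e1, abs_le] at h2
        exact ⟨by linarith, by linarith, by linarith⟩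
      have hne0 := riemannZeta_ne_zero_of_one_le_re (s := s2) (by rw [e1]; linarith)
      have := bc (g := riemannZeta) (s0 := s2) (R := 3 * w / 2) (M := M) (by positivity) (by linarith)
        (fun z hz => (differentiableAt_riemannZeta (by
          obtain ⟨c1, c2, c3⟩ := hbox2 z hz
          exact (box z c1 c2 c3).1)).differentiableWithinAt)
        (fun z hz => by obtain ⟨c1, c2, c3⟩ := hbox2 z hz; exact (box z c1 c2 c3).2.1)
        (fun z hz => by
          obtain ⟨c1, c2, c3⟩ := hbox2 z hz
          refine (box z c1 c2 c3).2.2.trans ?_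
          have h2 := norm_inv_zeta (s := s2) (by rw [e1]; linarith)
          rw [e1, norm_inv] at h2
          have h3 := h2.trans n1
          have h5 := norm_pos_iff.2 hne0
          rw [inv_le_iff_one_le_mul₀ h5] at h3
          have h6 : 2 / (w / 2) = 4 * (1 / w) := by field_simp; norm_num
          rw [h6] at h3
          have h7 : 1 ≤ 16 * l ^ 2 * ‖riemannZeta s2‖ := by
            exact h3.trans (mul_le_mul_of_nonneg_right (by linarith) (norm_nonneg _))
          have h8 : exp 40026 = exp 40021 * exp 5 := by rw [← exp_add]; norm_num
          have h9 : 16 ≤ exp 5 := by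
            have : exp 5 = exp 1 ^ 5 := by rw [← exp_nat_mul]; norm_num
            rw [this]
            calc (16:ℝ) ≤ 2 ^ 5 := by norm_num
              _ ≤ _ := by gcongr; linarith [add_one_le_exp (1:ℝ)]
          calc exp 40021 * l ≤ exp 40021 * (exp M / exp 40026 / l ^ 2) * 1 := by rw [mul_one]; gcongr
            _ ≤ exp 40021 * (exp M / exp 40026 / l ^ 2) * (exp 5 * l ^ 2 * ‖riemannZeta s2‖) := by
              gcongr; refine h7.trans ?_; gcongr
            _ = _ := by rw [h8]; field_simp) z (by
          rw [Metric.mem_ball, dist_eq_norm]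
          have : s - s2 = ((s.re - (1 + w / 2) : ℝ) : ℂ) := by apply Complex.ext <;> simp [e1, e2, hy]
          have h3 := norm_add_le (z - s) (s - s2)
          rw [sub_add_sub_cancel, this, Complex.norm_real, Real.norm_eq_abs] at h3
          have h4 : |s.re - (1 + w / 2)| ≤ w / 2 := abs_le.2 ⟨by linarith, by linarith⟩
          linarith)
      refine this.trans ?_
      have e : 24 * M / (3 * w / 2) = 16 * M / w := by field_simp; norm_num
      rw [e]
      have : 0 < 4 / w := by positivity
      linarith
    · push Not at hσ
      have := norm_logderiv (s := z) (σ := 1 + w / 2) (by linarith) (by linarith)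
      refine this.trans (n3.trans ?_)
      have h0 : 0 ≤ 16 * M / w := by positivity
      have : 1 / (w / 2) = 2 / w := by field_simp
      have h1 : 2 / w ≤ 4 / w := by gcongr; norm_num
      linarith
  have hFF := LS_iter (s := s) hs1 (r := w / 8) (B := 2 * l ^ 2) (by positivity) m (fun z hz => by
    have hldz := hld z hz
    rw [Metric.mem_closedBall, dist_eq_norm] at hz
    have g1 := (Complex.abs_im_le_norm (z - s)).trans hz
    have g2 := (Complex.abs_re_le_norm (z - s)).trans hz
    rw [Complex.sub_re, abs_le] at g2
    rw [Complex.sub_im] at g1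
    obtain ⟨d1, d2, d3⟩ := box z (by linarith) (by linarith) (by linarith)
    refine ⟨zeta1_ne d1 d2, ?_⟩
    rw [FF_eq d1 d2]
    refine (norm_sub_le _ _).trans ?_
    rw [norm_neg]
    have q1 : 4 / w + C0 + 16 * M / w = (1 / w) * (4 + 16 * M) + C0 := by ring
    have q2 : (1 / w) * (4 + 16 * M) ≤ l ^ (2 : ℕ) := by
      have q3 : 16 + 64 * M ≤ l ^ (η / 2) := by linarith [exp_pos 40021]
      calc (1 / w) * (4 + 16 * M) = l ^ (2/3 + η / 2 : ℝ) * (16 + 64 * M) := by rw [hinv]; ring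
        _ ≤ l ^ (2/3 + η / 2 : ℝ) * l ^ (η / 2) := by gcongr
        _ = l ^ (2/3 + η) := by rw [← rpow_add hl0]; ring_nf
        _ ≤ l ^ (2:ℝ) := rpow_le_rpow_of_exponent_le (by linarith) (by linarith)
        _ = _ := by norm_cast
    have q4 : C0 + exp 40021 ≤ l := by
      have : l ^ (η / 2) ≤ l ^ (1:ℝ) := rpow_le_rpow_of_exponent_le (by linarith) (by linarith)
      rw [rpow_one] at this; linarith
    have q5 : C0 * 1 ≤ C0 * l := by gcongr; linarith
    have q6 : (C0 + exp 40021) * l ≤ l * l := by gcongr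
    rw [q1] at hldz
    linarith)
  refine hFF.trans ?_
  rw [div_eq_mul_one_div, ← one_div_pow]
  gcongr
  have e : 1 / (w / 8) = 8 * (1 / w) := by field_simp
  rw [e, hinv]
  have : l ^ (2/3 + η / 2 : ℝ) ≤ l ^ (2/3 + η : ℝ) := rpow_le_rpow_of_exponent_le (by linarith) (by linarith)
  linarith

lemma LS_bd {η : ℝ} (hη : 0 < η) (hη1 : η ≤ 1) : ∃ A : ℝ, 1 ≤ A ∧ ∀ s : ℂ, 1 < s.re → s.re ≤ 2 → ∀ m : ℕ,
    ‖iteratedDeriv m (LSeries cL) s‖ ≤ m.factorial * (A * log (|s.im| + 3) ^ 2) * (A * log (|s.im| + 3) ^ (2/3 + η : ℝ)) ^ m := by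
  obtain ⟨L0, hL0⟩ := FF_large hη hη1
  obtain ⟨A, hA1, hA⟩ := FF_compact (exp (max L0 1))
  refine ⟨A + 32, by linarith, fun s h1 h2 m => ?_⟩
  have hl1 : 1 ≤ log (|s.im| + 3) := by
    rw [le_log_iff_exp_le (by positivity)]; linarith [exp_one_lt_d9, abs_nonneg s.im]
  by_cases h : |s.im| ≤ exp (max L0 1)
  · refine (hA s h1 h2 h m).trans ?_
    have : 1 ≤ log (|s.im| + 3) ^ (2/3 + η : ℝ) := one_le_rpow hl1 (by linarith)
    rw [pow_succ', ← mul_assoc]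
    have h6 : 1 ≤ log (|s.im| + 3) ^ 2 := one_le_pow₀ hl1
    gcongr
    · nlinarith
    · nlinarith
  · push Not at h
    have hp : 0 < |s.im| := (exp_pos _).trans h
    have h3 : max L0 1 ≤ log |s.im| := ((lt_log_iff_exp_lt hp).2 h).le
    have h4 : log |s.im| ≤ log (|s.im| + 3) := log_le_log hp (by linarith)
    have h5 : 1 ≤ log |s.im| := (le_max_right _ _).trans h3
    refine (hL0 s h1 h2 ((le_max_left _ _).trans h3) m).trans ?_
    gcongr <;> linarith
noncomputable def hat (u : ℝ) : ℂ := (Set.Ioc (0:ℝ) 1).indicator (fun _ => (1:ℂ)) u - (Set.Ioc (0:ℝ) 1).indicator (fun t : ℝ => (t:ℂ) ^ (1:ℂ)) u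

lemma hat_eq {u : ℝ} (hu : 0 < u) : hat u = ((max (1 - u) 0 : ℝ) : ℂ) := by
  unfold hat
  by_cases h : u ≤ 1
  · rw [Set.indicator_of_mem (Set.mem_Ioc.2 ⟨hu, h⟩), Set.indicator_of_mem (Set.mem_Ioc.2 ⟨hu, h⟩), max_eq_left (by linarith)]
    simp
  · rw [Set.indicator_of_notMem (fun h' => h h'.2), Set.indicator_of_notMem (fun h' => h h'.2), max_eq_right (by linarith)]
    simp

noncomputable def KK (s : ℂ) : ℂ := 1 / s - 1 / (s + 1)

lemma hat_mellin {s : ℂ} (hs : 0 < s.re) : HasMellin hat s (KK s) :=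
  hasMellin_sub (hasMellin_one_Ioc hs).1 (hasMellin_cpow_Ioc 1 (by simp; linarith)).1 |> fun h => by
    rw [(hasMellin_one_Ioc hs).2, (hasMellin_cpow_Ioc 1 (by simp; linarith)).2] at h
    exact h

lemma KK_norm {c : ℝ} (hc : 1 ≤ c) (t : ℝ) : ‖KK (c + t * Complex.I)‖ ≤ (1 + t ^ 2)⁻¹ := by
  have hb : ∀ b : ℝ, 1 ≤ b → √(1 + t ^ 2) ≤ ‖(b : ℂ) + t * Complex.I‖ := fun b hb => by
    rw [Complex.norm_add_mul_I]
    exact Real.sqrt_le_sqrt (by nlinarith)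
  have h1 := hb c hc
  have h2 := hb (c + 1) (by linarith)
  have h0 : 0 < √(1 + t ^ 2) := by positivity
  have e : KK (c + t * Complex.I) = 1 / (((c : ℂ) + t * Complex.I) * (((c + 1 : ℝ) : ℂ) + t * Complex.I)) := by
    have n1 : (c : ℂ) + t * Complex.I ≠ 0 := norm_pos_iff.1 (h0.trans_le h1)
    have n2 : ((c + 1 : ℝ) : ℂ) + t * Complex.I ≠ 0 := norm_pos_iff.1 (h0.trans_le h2)
    have n3 : (c : ℂ) + t * Complex.I + 1 = ((c + 1 : ℝ) : ℂ) + t * Complex.I := by push_cast; ring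
    rw [KK, n3]
    field_simp
    push_cast; ring
  rw [e, norm_div, norm_one, norm_mul, one_div]
  refine inv_anti₀ (by positivity) ?_
  calc 1 + t ^ 2 = √(1 + t ^ 2) * √(1 + t ^ 2) := (Real.mul_self_sqrt (by positivity)).symm
    _ ≤ _ := by gcongr

lemma KK_cont {c : ℝ} (hc : 1 ≤ c) : Continuous fun t : ℝ => KK (c + t * Complex.I) := by
  unfold KK
  refine (continuous_const.div (by fun_prop) fun t h => ?_).sub (continuous_const.div (by fun_prop) fun t h => ?_)
  · have := congrArg Complex.re h; simp at this; linarith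
  · have := congrArg Complex.re h; simp at this; linarith

lemma KK_int {c : ℝ} (hc : 1 ≤ c) : Integrable fun t : ℝ => KK (c + t * Complex.I) :=
  integrable_inv_one_add_sq.mono' (KK_cont hc).aestronglyMeasurable (ae_of_all _ (KK_norm hc))

lemma hat_inv {c u : ℝ} (hc : 1 ≤ c) (hu : 0 < u) :
    ∫ t : ℝ, (u : ℂ) ^ (-((c:ℂ) + t * Complex.I)) * KK (c + t * Complex.I) = 2 * π * hat u := by
  have hm : ∀ t : ℝ, mellin hat (c + t * Complex.I) = KK (c + t * Complex.I) := fun t => (hat_mellin (by simp; linarith)).2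
  have := mellinInv_mellin_eq c hat hu (hat_mellin (s := c) (by simp; linarith)).1 (by
    unfold Complex.VerticalIntegrable
    simp_rw [hm]; exact KK_int hc) (by
    have h1 : hat =ᶠ[nhds u] fun u => ((max (1 - u) 0 : ℝ) : ℂ) := by
      filter_upwards [isOpen_Ioi.mem_nhds hu] with v hv using hat_eq hv
    refine ContinuousAt.congr ?_ h1.symm
    fun_prop)
  rw [← this, mellinInv]
  simp_rw [hm, smul_eq_mul]
  rw [Complex.real_smul]
  push_cast
  have : (π:ℂ) ≠ 0 := by exact_mod_cast pi_ne_zero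
  generalize (∫ t : ℝ, (u : ℂ) ^ (-((c:ℂ) + t * Complex.I)) * KK (c + t * Complex.I)) = J
  field_simp

lemma perron_bd {a : ℕ → ℂ} {x c : ℝ} (hx : 0 < x) (hc : 1 ≤ c) (hs : LSeriesSummable a (c:ℂ)) {B : ℝ → ℝ}
    (hB : Integrable fun t => B t * (1 + t ^ 2)⁻¹) (hb : ∀ t : ℝ, ‖LSeries a (c + t * Complex.I)‖ ≤ B t) :
    ‖∑' n : ℕ, if n = 0 then 0 else a n * hat (n / x)‖ ≤ x ^ c * ∫ t, B t * (1 + t ^ 2)⁻¹ := by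
  set F : ℕ → ℝ → ℂ := fun n t => LSeries.term a (c + t * Complex.I) n * ((x:ℂ) ^ ((c:ℂ) + t * Complex.I) * KK (c + t * Complex.I)) with hF
  have hxc : ∀ t : ℝ, ‖(x:ℂ) ^ ((c:ℂ) + t * Complex.I)‖ = x ^ c := fun t => by
    rw [Complex.norm_cpow_eq_rpow_re_of_pos hx]; simp
  have htn : ∀ n (t : ℝ), ‖LSeries.term a (c + t * Complex.I) n‖ = ‖LSeries.term a c n‖ := fun n t => by
    rw [LSeries.norm_term_eq, LSeries.norm_term_eq]; simp
  have hnorm : ∀ n t, ‖F n t‖ = ‖LSeries.term a c n‖ * x ^ c * ‖KK (c + t * Complex.I)‖ := fun n t => by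
    rw [hF]; simp only [norm_mul]; rw [htn, hxc, mul_assoc]
  have hxne : (x:ℂ) ≠ 0 := by exact_mod_cast hx.ne'
  have hcont : ∀ n, Continuous (F n) := fun n => by
    rcases eq_or_ne n 0 with rfl | hn
    · simp [hF]; exact continuous_const
    · have hn' : (n:ℂ) ≠ 0 := by exact_mod_cast hn
      simp only [hF, LSeries.term_of_ne_zero hn]
      refine (continuous_const.div ?_ ?_).mul (Continuous.mul ?_ (KK_cont hc))
      · exact Continuous.const_cpow (by fun_prop) (Or.inl hn')
      · intro t; exact (Complex.cpow_ne_zero_iff_of_exponent_ne_zero (by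
          intro h; have := congrArg Complex.re h; simp at this; linarith)).2 hn'
      · exact Continuous.const_cpow (by fun_prop) (Or.inl hxne)
  have hint : ∀ n, Integrable (F n) := fun n => by
    refine ((KK_int hc).norm.const_mul (‖LSeries.term a c n‖ * x ^ c)).mono' (hcont n).aestronglyMeasurable (ae_of_all _ fun t => (hnorm n t).le)
  have hsum := hasSum_integral_of_summable_integral_norm hint (by
    simp_rw [hnorm, integral_const_mul]
    exact (hs.norm.mul_right _).mul_right _)
  have hval : ∀ n, ∫ t, F n t = 2 * π * (if n = 0 then 0 else a n * hat (n / x)) := fun n => by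
    rcases eq_or_ne n 0 with rfl | hn
    · simp [hF]
    · have hn' : (n:ℂ) ≠ 0 := by exact_mod_cast hn
      have hnp : (0:ℝ) < n := by positivity
      rw [if_neg hn]
      have : ∀ t : ℝ, F n t = a n * (((n / x : ℝ) : ℂ) ^ (-((c:ℂ) + t * Complex.I)) * KK (c + t * Complex.I)) := fun t => by
        simp only [hF, LSeries.term_of_ne_zero hn]
        rw [Complex.ofReal_div, Complex.cpow_neg, Complex.div_cpow_ofReal_nonneg hnp.le hx.le]
        push_cast
        rw [inv_div]; ring
      simp_rw [this]
      rw [integral_const_mul, hat_inv hc (by positivity)]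
      push_cast; ring
  have h1 : ∫ t, ∑' n, F n t = 2 * π * ∑' n : ℕ, if n = 0 then 0 else a n * hat (n / x) := by
    rw [← hsum.tsum_eq, ← tsum_mul_left]; exact tsum_congr hval
  have h2 : ∀ t, ∑' n, F n t = LSeries a (c + t * Complex.I) * ((x:ℂ) ^ ((c:ℂ) + t * Complex.I) * KK (c + t * Complex.I)) := fun t => by
    rw [LSeries, ← tsum_mul_right]
  have h3 : ‖∫ t, ∑' n, F n t‖ ≤ ∫ t, x ^ c * (B t * (1 + t ^ 2)⁻¹) := by
    refine norm_integral_le_of_norm_le (hB.const_mul _) (ae_of_all _ fun t => ?_)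
    rw [h2, norm_mul, norm_mul, hxc]
    have := hb t
    have h0 : 0 ≤ B t := (norm_nonneg _).trans this
    calc _ ≤ B t * (x ^ c * (1 + t ^ 2)⁻¹) := by gcongr; exact KK_norm hc t
      _ = _ := by ring
  rw [h1, norm_mul, integral_const_mul] at h3
  refine le_trans ?_ h3
  have : 1 ≤ ‖(2 * π : ℂ)‖ := by
    rw [norm_mul, Complex.norm_real, Real.norm_of_nonneg pi_pos.le, Complex.norm_ofNat]; linarith [pi_gt_three]
  exact le_mul_of_one_le_left (norm_nonneg _) this
noncomputable def cr (n : ℕ) : ℝ := ArithmeticFunction.vonMangoldt n - 1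

lemma log_pow_bd {a : ℝ} (ha : 0 < a) (ha1 : a ≤ 1) {m : ℕ} (hm : 1 ≤ m) (t : ℝ) :
    log (|t| + 3) ^ 2 * (log (|t| + 3) ^ a) ^ m ≤ (6 * m : ℝ) ^ (a * m + 2) * (2 * (1 + t ^ 2) ^ (1/4 : ℝ)) := by
  have hm' : (1:ℝ) ≤ m := by exact_mod_cast hm
  have h0 := abs_nonneg t
  have hl : 0 < log (|t| + 3) := log_pos (by linarith)
  have hq : 0 < a * m + 2 := by positivity
  have hq1 : a * m ≤ 1 * m := by gcongr
  have h1 : log (|t| + 3) ≤ (6 * m) * (|t| + 3) ^ (1 / (2 * (a * m + 2))) := by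
    have := log_le_rpow_div (x := |t| + 3) (ε := 1 / (2 * (a * m + 2))) (by linarith) (by positivity)
    rw [div_div_eq_mul_div, div_one, mul_comm] at this
    exact this.trans (mul_le_mul_of_nonneg_right (by linarith) (by positivity))
  have h2 : (|t| + 3) ^ (1/2 : ℝ) ≤ 2 * (1 + t ^ 2) ^ (1/4 : ℝ) := by
    have e : (|t| + 3) ≤ (16 * (1 + t ^ 2)) ^ (1/2:ℝ) := by
      rw [← sqrt_eq_rpow]; refine le_sqrt_of_sq_le ?_
      nlinarith [sq_abs t, sq_nonneg (|t| - 1)]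
    calc (|t| + 3) ^ (1/2 : ℝ) ≤ ((16 * (1 + t ^ 2)) ^ (1/2:ℝ)) ^ (1/2 : ℝ) := by gcongr
      _ = (16 * (1 + t ^ 2)) ^ (1/4:ℝ) := by rw [← rpow_mul (by positivity)]; norm_num
      _ = 16 ^ (1/4:ℝ) * (1 + t ^ 2) ^ (1/4:ℝ) := mul_rpow (by norm_num) (by positivity)
      _ = _ := by
        congr 1
        rw [show (16:ℝ) = 2 ^ (4:ℝ) by norm_num, ← rpow_mul (by norm_num)]; norm_num
  calc log (|t| + 3) ^ 2 * (log (|t| + 3) ^ a) ^ m = log (|t| + 3) ^ (a * m + 2) := by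
        rw [rpow_add hl, ← rpow_mul_natCast hl.le, mul_comm]; norm_cast
    _ ≤ ((6 * m) * (|t| + 3) ^ (1 / (2 * (a * m + 2)))) ^ (a * m + 2) := by gcongr
    _ = (6 * m : ℝ) ^ (a * m + 2) * (|t| + 3) ^ (1/2 : ℝ) := by
        rw [mul_rpow (by positivity) (by positivity), ← rpow_mul (by positivity)]
        congr 2; field_simp
    _ ≤ _ := by gcongr

lemma iter_logMul (f : ℕ → ℂ) (m n : ℕ) : (LSeries.logMul^[m] f) n = Complex.log n ^ m * f n := by
  induction m generalizing f with
  | zero => simp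
  | succ m ih => rw [Function.iterate_succ_apply, ih, LSeries.logMul]; ring

lemma V_bd {η : ℝ} (hη : 0 < η) (hη1 : η ≤ 1/3) : ∃ D : ℝ, 1 ≤ D ∧ ∀ m : ℕ, 1 ≤ m → ∀ N : ℕ, 3 ≤ N →
    |∑ n ∈ Finset.range N, cr n * log n ^ m * (N - n)| ≤ (N:ℝ) ^ 2 * (D * (m:ℝ) ^ (5/3 + η : ℝ)) ^ m := by
  obtain ⟨A, hA, hLS⟩ := LS_bd hη (by linarith)
  have hKi : Integrable fun t : ℝ => (1 + t ^ 2) ^ (-(3/4) : ℝ) := by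
    have := integrable_rpow_neg_one_add_norm_sq (E := ℝ) (μ := volume) (r := 3/2) (by simp; norm_num)
    refine this.congr (ae_of_all _ fun t => ?_)
    simp only [norm_eq_abs, sq_abs]; norm_num
  obtain ⟨K, hK⟩ : ∃ K, K = ∫ t : ℝ, (1 + t ^ 2) ^ (-(3/4) : ℝ) := ⟨_, rfl⟩
  have hK0 : 0 ≤ K := hK ▸ integral_nonneg fun t => by positivity
  have key : ∀ m : ℕ, 1 ≤ m → ∀ N : ℕ, 3 ≤ N → |∑ n ∈ Finset.range N, cr n * log n ^ m * (N - n)| ≤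
      N ^ 2 * (exp 1 * (m.factorial * A ^ (m + 1) * (6 * m : ℝ) ^ ((2/3 + η) * m + 2) * 2 * K)) := by
    intro m hm N hN
    have hN0 : (3:ℝ) ≤ N := by exact_mod_cast hN
    have hlN : 1 < log N := by
      rw [lt_log_iff_exp_lt (by linarith)]; linarith [exp_one_lt_d9]
    have hc : 1 < 1 + 1 / log N := by have : 0 < 1 / log N := by positivity
                                      linarith
    have hc2 : 1 + 1 / log N ≤ 2 := by
      have : 1 / log N ≤ 1 := by rw [div_le_one (by linarith)]; linarith
      linarith
    obtain ⟨c, hcc⟩ : ∃ c, c = 1 + 1 / log N := ⟨_, rfl⟩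
    rw [← hcc] at hc hc2
    have hab : ∀ s : ℂ, 1 < s.re → LSeries.abscissaOfAbsConv cL < s.re := by
      intro s hs
      refine lt_of_le_of_lt (LSeries.abscissaOfAbsConv_le_of_forall_lt_LSeriesSummable (x := 1) fun y hy => ?_) (by exact_mod_cast hs)
      have hy' : 1 < ((y:ℂ)).re := by simpa using hy
      exact (ArithmeticFunction.LSeriesSummable_vonMangoldt hy').sub (LSeriesSummable_one_iff.2 hy')
    have hb : ∀ t : ℝ, ‖LSeries (LSeries.logMul^[m] cL) (c + t * Complex.I)‖ ≤
        (m.factorial * A ^ (m + 1) * (6 * m : ℝ) ^ ((2/3 + η) * m + 2) * 2) * (1 + t ^ 2) ^ (1/4 : ℝ) := fun t => by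
      have h1 := hLS (c + t * Complex.I) (by simpa using hc) (by simpa using hc2) m
      rw [LSeries_iteratedDeriv m (hab _ (by simpa using hc)), norm_mul, norm_pow, norm_neg, norm_one, one_pow, one_mul] at h1
      simp only [Complex.add_im, Complex.ofReal_im, Complex.mul_im, Complex.ofReal_re, Complex.I_im, Complex.I_re, mul_one, mul_zero, zero_add, add_zero] at h1
      have h2 := log_pow_bd (a := 2/3 + η) (by positivity) (by linarith) hm t
      calc _ ≤ _ := h1
        _ = m.factorial * A ^ (m + 1) * (log (|t| + 3) ^ 2 * (log (|t| + 3) ^ (2/3+η)) ^ m) := by rw [mul_pow]; ring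
        _ ≤ _ := mul_le_mul_of_nonneg_left h2 (by positivity)
        _ = _ := by ring
    have e1 : ∀ (G t : ℝ), G * (1 + t ^ 2) ^ (1/4 : ℝ) * (1 + t ^ 2)⁻¹ = G * (1 + t ^ 2) ^ (-(3/4) : ℝ) := fun G t => by
      rw [mul_assoc, ← rpow_neg_one (1 + t ^ 2), ← rpow_add (by positivity)]; norm_num
    have h3 := perron_bd (x := N) (c := c) (by linarith) hc.le
      (LSeriesSummable_of_abscissaOfAbsConv_lt_re (LSeries.absicssaOfAbsConv_logPowMul.symm ▸ hab _ (by simpa using hc))) (by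
        simp_rw [e1]; exact hKi.const_mul _) hb
    simp_rw [e1] at h3
    rw [integral_const_mul, ← hK, tsum_eq_sum (s := Finset.range N) (fun n hn => by
      rw [Finset.mem_range, not_lt] at hn
      have hn' : (N:ℝ) ≤ n := by exact_mod_cast hn
      rw [hat_eq (by have : (0:ℝ) < n := by linarith
                     positivity), max_eq_right (by rw [sub_nonpos, one_le_div (by linarith)]; exact hn')]
      simp)] at h3
    have hNc : (N:ℝ) ^ c = exp 1 * N := by
      rw [hcc, rpow_add (by linarith), rpow_one, rpow_def_of_pos (by linarith), mul_one_div_cancel (by linarith)]; ring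
    have e2 : ∑ n ∈ Finset.range N, cr n * log n ^ m * (N - n) = N * ∑ n ∈ Finset.range N, cr n * log n ^ m * (1 - n / N) := by
      rw [Finset.mul_sum]; refine Finset.sum_congr rfl fun n _ => ?_
      field_simp
    have e3 : (∑ n ∈ Finset.range N, if n = 0 then 0 else (LSeries.logMul^[m] cL) n * hat (n / N)) =
        ((∑ n ∈ Finset.range N, cr n * log n ^ m * (1 - n / N) : ℝ) : ℂ) := by
      push_cast
      refine Finset.sum_congr rfl fun n hn => ?_
      rw [Finset.mem_range] at hn
      rcases eq_or_ne n 0 with rfl | h0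
      · simp; right; omega
      · have hn' : (n:ℝ) < N := by exact_mod_cast hn
        have h0' : (0:ℝ) < n := by positivity
        rw [if_neg h0, hat_eq (by positivity), max_eq_left (by rw [sub_nonneg, div_le_one (by linarith)]; exact hn'.le), iter_logMul, cL, cr]
        push_cast
        ring
    rw [e3, Complex.norm_real, norm_eq_abs, hNc] at h3
    rw [e2, abs_mul, Nat.abs_cast]
    calc _ ≤ _ := mul_le_mul_of_nonneg_left h3 (by positivity)
      _ = _ := by ring
  obtain ⟨W, hW⟩ : ∃ W, W = exp 1 * A * 72 * K + 1 := ⟨_, rfl⟩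
  have hW1 : 1 ≤ W := by rw [hW]; have : 0 ≤ exp 1 * A * 72 * K := by positivity
                         linarith
  refine ⟨W * 4 * A * 6, by nlinarith [mul_nonneg (sub_nonneg.2 hW1) (sub_nonneg.2 hA)], fun m hm N hN => (key m hm N hN).trans ?_⟩
  have hm' : (1:ℝ) ≤ m := by exact_mod_cast hm
  gcongr
  have f1 : (m.factorial : ℝ) ≤ (m:ℝ) ^ m := by exact_mod_cast Nat.factorial_le_pow m
  have f2 : (6 * m : ℝ) ^ ((2/3 + η) * m + 2) ≤ (6 * (m:ℝ) ^ (2/3 + η)) ^ m * (36 * 4 ^ m) := by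
    rw [rpow_add (by positivity), rpow_mul_natCast (by positivity)]
    gcongr
    · rw [mul_rpow (by norm_num) (by positivity)]; gcongr
      calc (6:ℝ) ^ (2/3 + η) ≤ 6 ^ (1:ℝ) := rpow_le_rpow_of_exponent_le (by norm_num) (by linarith)
        _ = 6 := rpow_one _
    · have : (m:ℝ) ≤ 2 ^ m := by exact_mod_cast Nat.lt_two_pow_self.le
      calc (6 * m:ℝ) ^ (2:ℝ) = 36 * m ^ 2 := by norm_cast; ring
        _ ≤ 36 * (2 ^ m) ^ 2 := by gcongr
        _ = _ := by rw [← pow_mul, mul_comm m 2, pow_mul]; norm_num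
  calc exp 1 * (m.factorial * A ^ (m + 1) * (6 * m : ℝ) ^ ((2/3 + η) * m + 2) * 2 * K)
      ≤ exp 1 * ((m:ℝ) ^ m * A ^ (m + 1) * ((6 * (m:ℝ) ^ (2/3 + η)) ^ m * (36 * 4 ^ m)) * 2 * K) := by gcongr
    _ = (exp 1 * A * 72 * K) * (4 * A * 6 * (m * (m:ℝ) ^ (2/3+η))) ^ m := by rw [pow_succ]; simp only [mul_pow]; ring
    _ ≤ W ^ m * (4 * A * 6 * (m * (m:ℝ) ^ (2/3+η))) ^ m := by
        gcongr
        exact le_trans (by linarith) (le_self_pow₀ hW1 (by omega))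
    _ = _ := by
        rw [← mul_pow, show (5/3 + η : ℝ) = 1 + (2/3+η) by ring, rpow_add (by linarith) 1, rpow_one]; ring
lemma unsmooth {f : ℕ → ℝ} {w Q : ℝ} {X H N : ℕ} (hw : 0 ≤ w) (hf : ∀ n, n ≤ 2 * X → -w ≤ f n)
    (hQ : ∀ N, N ≤ 2 * X → |∑ n ∈ Finset.range N, f n * (N - n)| ≤ Q) (hH : 1 ≤ H) (hHX : H ≤ X) (hN : N ≤ X) :
    |∑ n ∈ Finset.range (N + 1), f n| ≤ 2 * Q / H + H * w := by
  set T : ℕ → ℝ := fun k => ∑ n ∈ Finset.range (k + 1), f n with hT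
  have hV : ∀ N : ℕ, ∑ n ∈ Finset.range N, f n * (N - n) = ∑ k ∈ Finset.range N, T k := fun N => by
    induction N with
    | zero => simp
    | succ N ih =>
      rw [Finset.sum_range_succ T N, ← ih, hT]
      simp only
      rw [Finset.sum_range_succ, Finset.sum_range_succ, ← add_assoc, ← Finset.sum_add_distrib]
      push_cast
      congr 1
      · exact Finset.sum_congr rfl fun n _ => by ring
      · ring
  have hmono : ∀ j k : ℕ, k + j ≤ 2 * X → T k - j * w ≤ T (k + j) := fun j k h => by
    induction j with
    | zero => simp
    | succ j ih =>
      have h1 := ih (by omega)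
      have h2 : T (k + (j + 1)) = T (k + j) + f (k + j + 1) := by simp only [hT]; rw [← add_assoc, Finset.sum_range_succ]
      have h3 := hf (k + j + 1) (by omega)
      push_cast; linarith
  have hH0 : (0:ℝ) < H := by exact_mod_cast hH
  have hwin : ∀ M : ℕ, M + H ≤ 2 * X → |∑ j ∈ Finset.range H, T (M + j)| ≤ 2 * Q := fun M hM => by
    have h1 := hQ (M + H) hM
    have h2 := hQ M (by omega)
    rw [hV] at h1 h2
    rw [Finset.sum_range_add] at h1
    rw [abs_le] at *
    constructor <;> linarith
  change |T N| ≤ _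
  have hjw : ∀ j ∈ Finset.range H, (j:ℝ) * w ≤ H * w := fun j hj => by
    have : (j:ℝ) ≤ H := by exact_mod_cast (Finset.mem_range.1 hj).le
    gcongr
  have hQ0 : 0 ≤ 2 * Q / H := by have := (abs_nonneg _).trans (hQ 0 (by omega)); positivity
  rw [abs_le]
  constructor
  · rcases Nat.lt_or_ge N H with h | h
    · have h1 : ∑ n ∈ Finset.range (N + 1), -w ≤ T N := Finset.sum_le_sum fun n hn => hf n (by rw [Finset.mem_range] at hn; omega)
      rw [Finset.sum_const, Finset.card_range, nsmul_eq_mul] at h1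
      have : ((N + 1 : ℕ):ℝ) ≤ H := by exact_mod_cast h
      have h2 : ((N + 1 : ℕ):ℝ) * w ≤ H * w := by gcongr
      linarith
    · have h1 := (abs_le.1 (hwin (N - H) (by omega))).1
      have h2 : ∑ j ∈ Finset.range H, T (N - H + j) ≤ ∑ j ∈ Finset.range H, (T N + H * w) := Finset.sum_le_sum fun j hj => by
        rw [Finset.mem_range] at hj
        have h3 := hmono (H - j) (N - H + j) (by omega)
        rw [show N - H + j + (H - j) = N by omega] at h3
        have : ((H - j : ℕ):ℝ) ≤ H := by exact_mod_cast Nat.sub_le _ _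
        have h4 : ((H - j : ℕ):ℝ) * w ≤ H * w := by gcongr
        linarith
      rw [Finset.sum_const, Finset.card_range, nsmul_eq_mul] at h2
      have : -(2 * Q / H) ≤ T N + H * w := by
        rw [← neg_div, div_le_iff₀ hH0]; linarith
      linarith
  · have h1 := (abs_le.1 (hwin N (by omega))).2
    have h2 : ∑ j ∈ Finset.range H, (T N - H * w) ≤ ∑ j ∈ Finset.range H, T (N + j) := Finset.sum_le_sum fun j hj => by
      have h3 := hmono j N (by rw [Finset.mem_range] at hj; omega)
      linarith [hjw j hj]
    rw [Finset.sum_const, Finset.card_range, nsmul_eq_mul] at h2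
    have : T N - H * w ≤ 2 * Q / H := by
      rw [le_div_iff₀ hH0]; linarith
    linarith

lemma cr_low (n : ℕ) : -1 ≤ cr n := by
  have := ArithmeticFunction.vonMangoldt_nonneg (n := n); rw [cr]; linarith

lemma cr_abs (n : ℕ) : |cr n| ≤ log n + 1 := by
  have h1 := ArithmeticFunction.vonMangoldt_nonneg (n := n)
  have h2 := ArithmeticFunction.vonMangoldt_le_log (n := n)
  rw [cr, abs_le]; constructor <;> linarith

lemma psi_aux {m X : ℕ} {G : ℝ} (hm : 1 ≤ m) (hX : 16 ≤ X) (hXm : (16:ℝ) ^ m ≤ X) (hG : 0 ≤ G)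
    (hV : ∀ N : ℕ, 3 ≤ N → |∑ n ∈ Finset.range N, cr n * log n ^ m * (N - n)| ≤ (N:ℝ) ^ 2 * G ^ m) (hGX : 96 * G ≤ log X) :
    |∑ n ∈ Finset.Ioc 0 X, cr n| ≤ 20 * X * (1/2) ^ m + √X * (log X + 1) := by
  have hXr : (16:ℝ) ≤ X := by exact_mod_cast hX
  have hlX : 1 < log X := by rw [lt_log_iff_exp_lt (by linarith)]; linarith [exp_one_lt_d9]
  have hl2 : log ((2 * X : ℕ) : ℝ) ≤ 2 * log X := by
    push_cast
    rw [log_mul (by norm_num) (by linarith)]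
    have := log_le_log (by norm_num) (show (2:ℝ) ≤ X by linarith)
    linarith
  set R := Nat.sqrt X with hR
  have hR3 : 4 ≤ R := by rw [hR, Nat.le_sqrt]; omega
  have hRX : R ≤ X := Nat.sqrt_le_self X
  have hR3r : (4:ℝ) ≤ R := by exact_mod_cast hR3
  have hlR : log X / 3 ≤ log R := by
    have : (X:ℝ) ≤ R ^ 3 := by
      have h1 : (X:ℝ) ≤ (R + 1) * (R + 1) := by exact_mod_cast (Nat.lt_succ_sqrt X).le
      nlinarith [mul_nonneg (sub_nonneg.2 hR3r) (sub_nonneg.2 hR3r), pow_pos (show (0:ℝ) < R by linarith) 2]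
    have h2 := log_le_log (by linarith) this
    rw [log_pow] at h2; push_cast at h2; linarith
  set H := ⌈(X:ℝ) / 16 ^ m⌉₊ with hH
  have hH1 : 1 ≤ (X:ℝ) / 16 ^ m := by rwa [one_le_div (by positivity)]
  have hHge : (X:ℝ) / 16 ^ m ≤ H := Nat.le_ceil _
  have hHlt : (H:ℝ) ≤ 2 * (X / 16 ^ m) := by have := Nat.ceil_lt_add_one (a := (X:ℝ) / 16 ^ m) (by positivity); linarith
  have hHX : H ≤ X := Nat.ceil_le.2 (div_le_self (by positivity) (one_le_pow₀ (by norm_num)))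
  have hH0 : 1 ≤ H := Nat.one_le_ceil_iff.2 (by linarith)
  set Q : ℝ := 4 * X ^ 2 * G ^ m with hQ
  have hT : ∀ N ≤ X, |∑ n ∈ Finset.range (N + 1), cr n * log n ^ m| ≤ 2 * Q / H + H * (2 * log X) ^ m := fun N hN => by
    refine unsmooth (by positivity) (fun n hn => ?_) (fun M hM => ?_) hH0 hHX hN
    · rcases Nat.eq_zero_or_pos n with rfl | h
      · simp [show m ≠ 0 by omega]; positivity
      · have h0 : 0 ≤ log (n:ℝ) := log_natCast_nonneg n
        have h1 : log (n:ℝ) ≤ 2 * log X := (log_le_log (by exact_mod_cast h) (by exact_mod_cast hn)).trans hl2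
        have h2 : log (n:ℝ) ^ m ≤ (2 * log X) ^ m := by gcongr
        have h3 : -1 * log (n:ℝ) ^ m ≤ cr n * log (n:ℝ) ^ m := mul_le_mul_of_nonneg_right (cr_low n) (by positivity)
        linarith
    · rcases Nat.lt_or_ge M 3 with h | h
      · have : ∑ n ∈ Finset.range M, cr n * log n ^ m * (M - n) = 0 := Finset.sum_eq_zero fun n hn => by
          rw [Finset.mem_range] at hn
          have : n = 0 ∨ n = 1 := by omega
          rcases this with rfl | rfl <;> simp [show m ≠ 0 by omega]
        rw [this, abs_zero]; positivity
      · refine (hV M h).trans ?_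
        have : (M:ℝ) ≤ 2 * X := by exact_mod_cast hM
        calc (M:ℝ) ^ 2 * G ^ m ≤ (2 * X) ^ 2 * G ^ m := by gcongr
          _ = Q := by rw [hQ]; ring
  have hB : 2 * Q / H + H * (2 * log X) ^ m ≤ X * (log X / 3) ^ m * (10 * (1/2) ^ m) := by
    have h1 : 2 * Q / H ≤ 2 * Q / ((X:ℝ) / 16 ^ m) := by gcongr
    have h2 : 2 * Q / ((X:ℝ) / 16 ^ m) = 8 * X * (16 * G) ^ m := by rw [hQ, mul_pow]; field_simp; ring
    have h3 : (16 * G) ^ m ≤ (log X / 3) ^ m * (1/2) ^ m := by rw [← mul_pow]; exact pow_le_pow_left₀ (by positivity) (by linarith) m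
    have h4 : H * (2 * log X) ^ m ≤ 2 * (X / 16 ^ m) * (2 * log X) ^ m := by gcongr
    have h5 : 2 * (X / 16 ^ m) * (2 * log X) ^ m = 2 * X * (log X / 8) ^ m := by
      rw [show log X / 8 = (2 * log X) / 16 by ring, div_pow]; ring
    have h6 : (log X / 8) ^ m ≤ (log X / 3 * (1/2)) ^ m := by gcongr; linarith
    rw [mul_pow] at h6
    have h7 : 8 * X * (16 * G) ^ m ≤ 8 * X * ((log X / 3) ^ m * (1/2) ^ m) := by gcongr
    have h8 : 2 * X * (log X / 8) ^ m ≤ 2 * X * ((log X / 3) ^ m * (1/2) ^ m) := by gcongr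
    linarith
  have hT' : ∀ N ≤ X, |∑ n ∈ Finset.range (N + 1), cr n * log n ^ m| ≤ X * (log X / 3) ^ m * (10 * (1/2) ^ m) := fun N hN => (hT N hN).trans hB
  have hIoc : ∀ (g : ℕ → ℝ) (n : ℕ), R ≤ n → ∑ i ∈ Finset.Ioc R n, g i = ∑ i ∈ Finset.range (n + 1), g i - ∑ i ∈ Finset.range (R + 1), g i := fun g n h => by
    rw [eq_sub_iff_add_eq, add_comm, ← Finset.sum_range_add_sum_Ico g (show R + 1 ≤ n + 1 by omega)]
    congr 2; ext i; simp
  have hab := abel_mono (a := fun n => ((cr n * log n ^ m : ℝ) : ℂ)) (w := fun n => (log n ^ m)⁻¹) (B := 2 * (X * (log X / 3) ^ m * (10 * (1/2) ^ m))) hRX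
    (fun n hn => by
      have : (1:ℝ) < n := by exact_mod_cast (show 1 < n by omega)
      have h0 : 0 < log (n:ℝ) := log_pos this
      have : log (n:ℝ) ≤ log ((n + 1 : ℕ):ℝ) := log_le_log (by linarith) (by push_cast; linarith)
      gcongr)
    (fun n hn => by have := log_natCast_nonneg n; positivity)
    (fun n hn hn' => by
      rw [← Complex.ofReal_sum, Complex.norm_real, norm_eq_abs, hIoc _ n hn]
      refine (abs_sub _ _).trans ?_
      linarith [hT' n hn', hT' R hRX])
  have e1 : ∑ i ∈ Finset.Ioc R X, (((log (i:ℝ) ^ m)⁻¹ : ℝ) : ℂ) * ((cr i * log i ^ m : ℝ) : ℂ) = ((∑ i ∈ Finset.Ioc R X, cr i : ℝ) : ℂ) := by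
    rw [Complex.ofReal_sum]
    refine Finset.sum_congr rfl fun i hi => ?_
    rw [← Complex.ofReal_mul]; congr 1
    have : (1:ℝ) < i := by exact_mod_cast (show 1 < i by rw [Finset.mem_Ioc] at hi; omega)
    have h0 : 0 < log (i:ℝ) := log_pos this
    field_simp
  rw [e1, Complex.norm_real, norm_eq_abs] at hab
  have h0 : 0 < log (R:ℝ) := by linarith
  have hb2 : 2 * (X * (log X / 3) ^ m * (10 * (1/2) ^ m)) * (log (R:ℝ) ^ m)⁻¹ ≤ 20 * X * (1/2) ^ m := by
    rw [← div_eq_mul_inv, div_le_iff₀ (by positivity)]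
    have : (log X / 3) ^ m ≤ log R ^ m := by gcongr
    calc _ = 20 * X * (1/2) ^ m * (log X / 3) ^ m := by ring
      _ ≤ _ := by gcongr
  have hs : |∑ n ∈ Finset.Ioc 0 R, cr n| ≤ √X * (log X + 1) := by
    refine (Finset.abs_sum_le_sum_abs _ _).trans ?_
    have h1 : ∑ n ∈ Finset.Ioc 0 R, |cr n| ≤ ∑ n ∈ Finset.Ioc 0 R, (log X + 1) := Finset.sum_le_sum fun n hn => by
      rw [Finset.mem_Ioc] at hn
      have := log_le_log (x := (n:ℝ)) (y := X) (by exact_mod_cast hn.1) (by exact_mod_cast hn.2.trans hRX)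
      linarith [cr_abs n]
    rw [Finset.sum_const, Nat.card_Ioc, Nat.sub_zero, nsmul_eq_mul] at h1
    refine h1.trans ?_
    gcongr
    exact le_sqrt_of_sq_le (by rw [sq]; exact_mod_cast Nat.sqrt_le X)
  have e2 : ∑ n ∈ Finset.Ioc 0 X, cr n = ∑ n ∈ Finset.Ioc 0 R, cr n + ∑ n ∈ Finset.Ioc R X, cr n :=
    (Finset.sum_Ioc_consecutive cr (Nat.zero_le R) hRX).symm
  rw [e2]
  refine (abs_add_le _ _).trans ?_
  linarith

lemma psi_bd {b : ℝ} (hb : 0 < b) (hb1 : b < 3/5) :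
    ∀ᶠ X : ℕ in atTop, |∑ n ∈ Finset.Ioc 0 X, cr n| ≤ 50 * X * exp (-((log X) ^ b / 2)) := by
  obtain ⟨η, hη, hη1, hηb⟩ : ∃ η : ℝ, 0 < η ∧ η ≤ 1/3 ∧ b * (5/3 + η) < 1 := by
    refine ⟨min (1/3) (3/5 - b), lt_min (by norm_num) (by linarith), min_le_left _ _, ?_⟩
    have : min (1/3) (3/5 - b) ≤ 3/5 - b := min_le_right _ _
    nlinarith
  obtain ⟨D, hD, hV⟩ := V_bd hη hη1
  have hlog : Tendsto (fun X : ℕ => log (X:ℝ)) atTop atTop := tendsto_log_atTop.comp tendsto_natCast_atTop_atTop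
  have hc1 : ∀ᶠ y : ℝ in atTop, 96 * D ≤ y ^ (1 - b * (5/3 + η)) := (tendsto_rpow_atTop (by linarith)).eventually_ge_atTop _
  filter_upwards [hlog.eventually hc1, hlog.eventually_ge_atTop 1, eventually_ge_atTop 16] with X h1 h2 h3
  obtain ⟨y, hy⟩ : ∃ y, y = log (X:ℝ) := ⟨_, rfl⟩
  have hX0 : (0:ℝ) < X := by exact_mod_cast (show 0 < X by omega)
  have hXe : (X:ℝ) = exp y := by rw [hy, exp_log hX0]
  rw [← hy] at h1 h2
  rw [← hy]
  obtain ⟨m, hm⟩ : ∃ m, m = ⌊y ^ b⌋₊ := ⟨_, rfl⟩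
  have hyb : 1 ≤ y ^ b := one_le_rpow h2 hb.le
  have hm1 : 1 ≤ m := by rw [hm, Nat.one_le_floor_iff]; exact hyb
  have hmy : (m:ℝ) ≤ y ^ b := hm ▸ Nat.floor_le (by positivity)
  have hmy2 : y ^ b - 1 ≤ m := by rw [hm]; exact (Nat.sub_one_lt_floor _).le
  have hm1r : (1:ℝ) ≤ m := by exact_mod_cast hm1
  have hG : 96 * (D * (m:ℝ) ^ (5/3 + η)) ≤ y := by
    calc 96 * (D * (m:ℝ) ^ (5/3 + η)) ≤ 96 * (D * (y ^ b) ^ (5/3 + η)) := by gcongr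
      _ = 96 * D * y ^ (b * (5/3 + η)) := by rw [← rpow_mul (by linarith)]; ring
      _ ≤ y ^ (1 - b * (5/3 + η)) * y ^ (b * (5/3 + η)) := by gcongr
      _ = y := by rw [← rpow_add (by linarith)]; simp
  have hm96 : 96 * (m:ℝ) ≤ y := by
    refine le_trans ?_ hG
    have : (m:ℝ) ^ (1:ℝ) ≤ (m:ℝ) ^ (5/3 + η) := rpow_le_rpow_of_exponent_le hm1r (by linarith)
    rw [rpow_one] at this
    have h5 : 1 * (m:ℝ) ≤ D * (m:ℝ) ^ (5/3 + η) := by gcongr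
    linarith
  have h2e : ∀ (k : ℕ) , (1/2:ℝ) ^ k = exp (-(k * log 2)) := fun k => by
    rw [exp_neg, mul_comm, ← rpow_def_of_pos (by norm_num), rpow_natCast]; simp
  have h16 : (16:ℝ) ^ m ≤ X := by
    rw [hXe]
    calc (16:ℝ) ^ m ≤ (exp 1 ^ 4) ^ m := by
          gcongr
          calc (16:ℝ) = 2 ^ 4 := by norm_num
            _ ≤ _ := by gcongr; linarith [exp_one_gt_d9]
      _ = exp (4 * m) := by rw [← exp_nat_mul, ← exp_nat_mul]; norm_num; ring
      _ ≤ _ := exp_le_exp.2 (by linarith)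
  have hmain := psi_aux hm1 h3 h16 (G := D * (m:ℝ) ^ (5/3 + η)) (by positivity) (hV m hm1) (by rw [← hy]; exact hG)
  rw [← hy] at hmain
  have hl1 := log_two_gt_d9
  have hl2 := log_two_lt_d9
  have hs : √(X:ℝ) * (y + 1) ≤ 5 * X * (1/2) ^ m := by
    have e1 : √(X:ℝ) = exp (y / 2) := by rw [hXe, exp_half]
    have e2 : y / 4 + 1 ≤ exp (y / 4) := add_one_le_exp _
    have e3 : exp (y / 2) * exp (y / 4) ≤ exp y * exp (-(m * log 2)) := by
      rw [← exp_add, ← exp_add]; refine exp_le_exp.2 ?_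
      nlinarith
    rw [e1, h2e, hXe]
    calc exp (y / 2) * (y + 1) ≤ exp (y / 2) * (5 * exp (y / 4)) := by gcongr; linarith
      _ = 5 * (exp (y / 2) * exp (y / 4)) := by ring
      _ ≤ 5 * (exp y * exp (-(m * log 2))) := by gcongr
      _ = _ := by ring
  have hf : (1/2:ℝ) ^ m ≤ 2 * exp (-(y ^ b / 2)) := by
    have : exp (-((m:ℝ) * log 2)) ≤ exp (log 2) * exp (-(y ^ b / 2)) := by
      rw [← exp_add]; refine exp_le_exp.2 ?_
      nlinarith
    rwa [← h2e, exp_log (by norm_num)] at this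
  calc _ ≤ 25 * X * (1/2:ℝ) ^ m := by linarith
    _ ≤ 25 * X * (2 * exp (-(y ^ b / 2))) := by gcongr
    _ = _ := by ring
noncomputable def lam (n : ℕ) : ℝ := ArithmeticFunction.vonMangoldt n / log n
noncomputable def AA (N : ℕ) : ℝ := ∑ n ∈ Finset.Ioc 0 N, lam n / n

lemma lam_nonneg (n : ℕ) : 0 ≤ lam n := div_nonneg ArithmeticFunction.vonMangoldt_nonneg (log_natCast_nonneg n)
lemma lam_le (n : ℕ) : lam n ≤ 1 := div_le_one_of_le₀ ArithmeticFunction.vonMangoldt_le_log (log_natCast_nonneg n)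

lemma abel_real {a : ℕ → ℝ} {w : ℕ → ℝ} {B : ℝ} {N N' : ℕ} (hNN : N ≤ N') (hw : ∀ n, N ≤ n → w (n+1) ≤ w n)
    (hw0 : ∀ n, N ≤ n → 0 ≤ w n) (hB : ∀ n, N ≤ n → n ≤ N' → |∑ i ∈ Finset.Ioc 0 n, a i| ≤ B) :
    |∑ i ∈ Finset.Ioc N N', w i * a i| ≤ 2 * B * w N := by
  have := abel_mono (a := fun n => (a n : ℂ)) (B := 2 * B) hNN hw hw0 fun n h1 h2 => by
    rw [← Complex.ofReal_sum, Complex.norm_real, norm_eq_abs]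
    have e := Finset.sum_Ioc_consecutive a (Nat.zero_le N) h1
    rw [show ∑ i ∈ Finset.Ioc N n, a i = ∑ i ∈ Finset.Ioc 0 n, a i - ∑ i ∈ Finset.Ioc 0 N, a i by linarith]
    refine (abs_sub _ _).trans ?_
    linarith [hB n h1 h2, hB N le_rfl hNN]
  simp_rw [← Complex.ofReal_mul] at this
  rwa [← Complex.ofReal_sum, Complex.norm_real, norm_eq_abs] at this

lemma llog_step {n : ℕ} (hn : 2 ≤ n) : 1 / (((n + 1 : ℕ):ℝ) * log ((n + 1 : ℕ):ℝ)) ≤ log (log ((n + 1 : ℕ):ℝ)) - log (log n) ∧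
    log (log ((n + 1 : ℕ):ℝ)) - log (log n) ≤ 1 / (n * log n) := by
  have hn' : (2:ℝ) ≤ n := by exact_mod_cast hn
  have h0 : 0 < log (n:ℝ) := log_pos (by linarith)
  have h1 : 0 < log ((n:ℝ) + 1) := log_pos (by linarith)
  push_cast
  have u1 : log ((n:ℝ) + 1) - log n ≤ 1 / n := by
    rw [← log_div (by linarith) (by linarith)]
    refine (log_le_sub_one_of_pos (by positivity)).trans (le_of_eq ?_); field_simp; ring
  have u2 : 1 / ((n:ℝ) + 1) ≤ log ((n:ℝ) + 1) - log n := by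
    have : log (n / ((n:ℝ) + 1)) ≤ n / ((n:ℝ) + 1) - 1 := log_le_sub_one_of_pos (by positivity)
    rw [log_div (by linarith) (by linarith)] at this
    have e : (n:ℝ) / (n + 1) - 1 = - (1 / ((n:ℝ) + 1)) := by field_simp; ring
    linarith
  constructor
  · have : log (log n / log ((n:ℝ) + 1)) ≤ log n / log ((n:ℝ) + 1) - 1 := log_le_sub_one_of_pos (by positivity)
    rw [log_div h0.ne' h1.ne'] at this
    have e : 1 / (((n:ℝ) + 1) * log ((n:ℝ) + 1)) ≤ 1 - log n / log ((n:ℝ) + 1) := by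
      rw [one_sub_div h1.ne', ← div_div]; gcongr
    linarith
  · have : log (log ((n:ℝ) + 1) / log n) ≤ log ((n:ℝ) + 1) / log n - 1 := log_le_sub_one_of_pos (by positivity)
    rw [log_div h1.ne' h0.ne'] at this
    have e : log ((n:ℝ) + 1) / log n - 1 ≤ 1 / (n * log n) := by
      rw [div_sub_one h0.ne', ← div_div]; gcongr
    linarith

lemma llog_sum {N N' : ℕ} (hN : 2 ≤ N) (h : N ≤ N') :
    |∑ n ∈ Finset.Ioc N N', 1 / ((n:ℝ) * log n) - (log (log N') - log (log N))| ≤ 1 / (N * log N) := by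
  have key : -(1 / ((N:ℝ) * log N)) + 1 / (N' * log N') ≤ ∑ n ∈ Finset.Ioc N N', 1 / ((n:ℝ) * log n) - (log (log N') - log (log N)) ∧
    ∑ n ∈ Finset.Ioc N N', 1 / ((n:ℝ) * log n) - (log (log N') - log (log N)) ≤ 0 := by
    induction N', h using Nat.le_induction with
    | base => simp
    | succ M hM ih =>
      have := llog_step (hN.trans hM)
      rw [Finset.sum_Ioc_succ_top (by omega)]
      constructor <;> linarith [ih.1, ih.2]
  have h0 : 0 ≤ 1 / ((N':ℝ) * log N') := by have := log_natCast_nonneg N'; positivity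
  have h1 : 0 ≤ 1 / ((N:ℝ) * log N) := by have := log_natCast_nonneg N; positivity
  rw [abs_le]; constructor <;> linarith [key.1, key.2]

noncomputable def DD (b l : ℝ) : ℝ := exp (-(l ^ b / 4)) / l

lemma mert_block {b : ℝ} (hb : 0 < b) (hb1 : b < 3/5) : ∀ᶠ N : ℕ in atTop, ∀ N' : ℕ, N ≤ N' →
    |∑ n ∈ Finset.Ioc N N', cr n / (n * log n)| ≤ DD b (log N) := by
  have hlog : Tendsto (fun X : ℕ => log (X:ℝ)) atTop atTop := tendsto_log_atTop.comp tendsto_natCast_atTop_atTop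
  have hdec : ∀ᶠ l : ℝ in atTop, l ^ 2 * exp (-(l ^ b / 4)) ≤ 1 / 800 := by
    have h1 := tendsto_rpow_mul_exp_neg_mul_atTop_nhds_zero (2 / b) (1/4) (by norm_num)
    have h2 := h1.comp (tendsto_rpow_atTop hb)
    filter_upwards [h2.eventually_le_const (show (0:ℝ) < 1 / 800 by norm_num), eventually_ge_atTop 0] with l hl hl0
    simp only [Function.comp] at hl
    rw [← rpow_mul hl0, mul_div_cancel₀ _ hb.ne', rpow_two] at hl
    rwa [show -(l ^ b / 4) = -(1/4) * l ^ b by ring]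
  obtain ⟨N0, hN0⟩ := eventually_atTop.1 ((psi_bd hb hb1).and ((hlog.eventually hdec).and ((hlog.eventually_ge_atTop 1).and (eventually_ge_atTop 2))))
  have hblock : ∀ N, N0 ≤ N → ∀ N', N ≤ N' → N' ≤ 2 * N → |∑ n ∈ Finset.Ioc N N', cr n / (n * log n)| ≤ 200 * exp (-((log N) ^ b / 2)) := by
    intro N hN N' h1 h2
    obtain ⟨-, -, c3, c4⟩ := hN0 N hN
    have hNr : (2:ℝ) ≤ N := by exact_mod_cast c4
    have := abel_real (a := cr) (w := fun n => 1 / ((n:ℝ) * log n)) (B := 50 * (2 * N) * exp (-((log N) ^ b / 2))) h1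
      (fun n hn => by
        have h0 : (0:ℝ) < log n := log_pos (by exact_mod_cast (show 1 < n by omega))
        have h0' : (0:ℝ) < n := by exact_mod_cast (show 0 < n by omega)
        have : log (n:ℝ) ≤ log ((n + 1 : ℕ):ℝ) := log_le_log h0' (by push_cast; linarith)
        gcongr; omega)
      (fun n hn => by have := log_natCast_nonneg n; positivity)
      (fun n hn hn' => by
        refine (hN0 n (by omega)).1.trans ?_
        have e1 : (n:ℝ) ≤ 2 * N := by exact_mod_cast hn'.trans h2
        have e2 : log (N:ℝ) ≤ log n := log_le_log (by linarith) (by exact_mod_cast hn)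
        gcongr)
    simp_rw [one_div_mul_eq_div] at this
    refine this.trans ?_
    have e : (N:ℝ) * 1 ≤ N * log N := by gcongr
    calc 2 * (50 * (2 * N) * exp (-((log N) ^ b / 2))) * (1 / ((N:ℝ) * log N)) = 200 * exp (-((log N) ^ b / 2)) * (N / (N * log N)) := by ring
      _ ≤ 200 * exp (-((log N) ^ b / 2)) * 1 := by gcongr; rw [div_le_one (by positivity)]; linarith
      _ = _ := mul_one _
  have hD : ∀ N, N0 ≤ N → 200 * exp (-((log N) ^ b / 2)) + DD b (log ((2 * N : ℕ):ℝ)) ≤ DD b (log N) := by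
    intro N hN
    obtain ⟨-, c2, c3, c4⟩ := hN0 N hN
    have hNr : (2:ℝ) ≤ N := by exact_mod_cast c4
    have e1 : log ((2 * N : ℕ):ℝ) = log N + log 2 := by push_cast; rw [log_mul (by norm_num) (by linarith), add_comm]
    obtain ⟨l, hl⟩ : ∃ l, l = log (N:ℝ) := ⟨_, rfl⟩
    rw [e1]
    rw [← hl] at c2 c3 ⊢
    have g1 := log_two_gt_d9
    have g2 := log_two_lt_d9
    have e2 : DD b (l + log 2) ≤ exp (-(l ^ b / 4)) / (l + log 2) := by
      unfold DD
      have : l ^ b ≤ (l + log 2) ^ b := by gcongr; linarith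
      gcongr
    have e3 : exp (-(l ^ b / 2)) = exp (-(l ^ b / 4)) * exp (-(l ^ b / 4)) := by rw [← exp_add]; ring_nf
    have e4 : 1 / (4 * l ^ 2) ≤ 1 / l - 1 / (l + log 2) := by
      rw [div_sub_div _ _ (by linarith) (by linarith), div_le_div_iff₀ (by positivity) (by positivity)]
      nlinarith
    have e5 : 200 * exp (-(l ^ b / 4)) ≤ 1 / (4 * l ^ 2) := by
      rw [le_div_iff₀ (by positivity)]; linarith
    have e6 := mul_le_mul_of_nonneg_left (e5.trans e4) (exp_pos (-(l ^ b / 4))).le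
    have e7 : DD b l = exp (-(l ^ b / 4)) * (1 / l) := by unfold DD; ring
    have e8 : exp (-(l ^ b / 4)) / (l + log 2) = exp (-(l ^ b / 4)) * (1 / (l + log 2)) := by ring
    rw [e3, e7]
    linarith
  filter_upwards [eventually_ge_atTop N0] with N hN N'
  obtain ⟨d, hd⟩ : ∃ d, d = N' - N := ⟨_, rfl⟩
  induction d using Nat.strong_induction_on generalizing N with
  | _ d ih =>
    intro h
    have h2 := hD N hN
    have c4 := (hN0 N hN).2.2.2
    have hDD : 0 ≤ DD b (log ((2 * N : ℕ):ℝ)) := div_nonneg (exp_pos _).le (log_natCast_nonneg _)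
    rcases le_total N' (2 * N) with h3 | h3
    · linarith [hblock N hN N' h h3]
    · have h4 := ih (N' - 2 * N) (by omega) (2 * N) (by omega) rfl h3
      have h5 := hblock N hN (2 * N) (by omega) le_rfl
      rw [← Finset.sum_Ioc_consecutive _ (show N ≤ 2 * N by omega) h3]
      refine (abs_add_le _ _).trans ?_
      linarith

lemma AA_cauchy {b : ℝ} (hb : 0 < b) (hb1 : b < 3/5) : ∀ᶠ N : ℕ in atTop, ∀ N' : ℕ, N ≤ N' →
    |(AA N' - log (log N')) - (AA N - log (log N))| ≤ DD b (log N) + 1 / (N * log N) := by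
  filter_upwards [mert_block hb hb1, eventually_ge_atTop 2] with N h1 h2 N' h
  have h3 := h1 N' h
  have h4 := llog_sum h2 h
  have e : AA N' - AA N = ∑ n ∈ Finset.Ioc N N', cr n / (n * log n) + ∑ n ∈ Finset.Ioc N N', 1 / ((n:ℝ) * log n) := by
    rw [AA, AA, ← Finset.sum_Ioc_consecutive _ (Nat.zero_le N) h, add_sub_cancel_left, ← Finset.sum_add_distrib]
    refine Finset.sum_congr rfl fun n hn => ?_
    rw [← add_div, cr, lam, sub_add_cancel, div_div, mul_comm (log (n:ℝ))]
  rw [show (AA N' - log (log N')) - (AA N - log (log N)) = ∑ n ∈ Finset.Ioc N N', cr n / (n * log n) + (∑ n ∈ Finset.Ioc N N', 1 / ((n:ℝ) * log n) - (log (log N') - log (log N))) by linarith]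
  exact (abs_add_le _ _).trans (add_le_add h3 h4)

lemma DD_tendsto {b : ℝ} : Tendsto (fun N : ℕ => DD b (log N) + 1 / (N * log N)) atTop (nhds 0) := by
  have hlog : Tendsto (fun X : ℕ => log (X:ℝ)) atTop atTop := tendsto_log_atTop.comp tendsto_natCast_atTop_atTop
  have h1 : Tendsto (fun N : ℕ => 2 / log (N:ℝ)) atTop (nhds 0) := tendsto_const_nhds.div_atTop hlog
  refine squeeze_zero' ?_ ?_ h1
  · filter_upwards [] with N
    have := log_natCast_nonneg N
    unfold DD; positivity
  · filter_upwards [eventually_ge_atTop 2] with N hN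
    have h0 : (0:ℝ) < log N := log_pos (by exact_mod_cast (show 1 < N by omega))
    have e1 : DD b (log N) ≤ 1 / log N := by
      unfold DD; gcongr; rw [exp_le_one_iff]; have : 0 ≤ (log (N:ℝ)) ^ b := by positivity
      linarith
    have e2 : 1 / ((N:ℝ) * log N) ≤ 1 / (1 * log N) := by
      gcongr; exact_mod_cast (show 1 ≤ N by omega)
    rw [one_mul] at e2
    calc _ ≤ 1 / log (N:ℝ) + 1 / log N := add_le_add e1 e2
      _ = _ := by ring

lemma AA_lim : ∃ L : ℝ, Tendsto (fun N : ℕ => AA N - log (log N)) atTop (nhds L) ∧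
    ∀ b : ℝ, 0 < b → b < 3/5 → ∀ᶠ N : ℕ in atTop, |(AA N - log (log N)) - L| ≤ DD b (log N) + 1 / (N * log N) := by
  have hc : CauchySeq fun N : ℕ => AA N - log (log N) := by
    rw [Metric.cauchySeq_iff']
    intro ε hε
    obtain ⟨N, h1, h2⟩ := ((AA_cauchy (b := 1/2) (by norm_num) (by norm_num)).and ((DD_tendsto (b := 1/2)).eventually_lt_const hε)).exists
    exact ⟨N, fun n hn => (h1 n hn).trans_lt h2⟩
  obtain ⟨L, hL⟩ := cauchySeq_tendsto_of_complete hc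
  refine ⟨L, hL, fun b hb hb1 => ?_⟩
  filter_upwards [AA_cauchy hb hb1] with N hN
  rw [abs_sub_comm]
  exact le_of_tendsto ((hL.sub_const _).abs) (by filter_upwards [eventually_ge_atTop N] with n hn using hN n hn)
noncomputable def GG {ι : Type} (c τ : ι → ℝ) (v : ℝ) : ℝ := ∑' i, if τ i ≤ v then c i else 0

lemma lapI {ι : Type} [Countable ι] {c τ : ι → ℝ} (hc : ∀ i, 0 ≤ c i) {δ : ℝ} (hδ : 0 < δ)
    (hs : Summable fun i => c i * exp (-δ * τ i)) {i₀ : ι} (h0 : 0 < c i₀) :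
    Integrable (fun v => δ * exp (-δ * v) * GG c τ v) ∧
    ∫ v, δ * exp (-δ * v) * GG c τ v = ∑' i, c i * exp (-δ * τ i) := by
  set F : ι → ℝ → ℝ := fun i => (Set.Ici (τ i)).indicator fun v => c i * δ * exp (-δ * v) with hF
  have hI : ∀ i, Integrable (F i) := fun i =>
    (integrable_indicator_iff measurableSet_Ici).2
      (((integrableOn_Ici_iff_integrableOn_Ioi (by finiteness)).2 (integrableOn_exp_mul_Ioi (by linarith) _)).const_mul _)
  have hv : ∀ i, ∫ v, F i v = c i * exp (-δ * τ i) := fun i => by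
    rw [hF, integral_indicator measurableSet_Ici, integral_Ici_eq_integral_Ioi, integral_const_mul,
      integral_exp_mul_Ioi (by linarith)]
    field_simp
  have hn : ∀ i v, 0 ≤ F i v := fun i v => Set.indicator_nonneg (fun v _ => by have := hc i; positivity) v
  have H := hasSum_integral_of_summable_integral_norm hI (by
    simp_rw [norm_of_nonneg (hn _ _), hv]; exact hs)
  simp_rw [hv] at H
  have e : (fun v => ∑' i, F i v) = fun v => δ * exp (-δ * v) * GG c τ v := by
    funext v
    rw [GG, ← tsum_mul_left]
    refine tsum_congr fun i => ?_
    simp only [hF, Set.indicator_apply, Set.mem_Ici]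
    split_ifs <;> ring
  rw [e] at H
  refine ⟨not_imp_comm.1 integral_undef ?_, H.tsum_eq.symm⟩
  rw [← H.tsum_eq]
  exact (hs.tsum_pos (fun i => mul_nonneg (hc i) (exp_pos _).le) i₀ (by positivity)).ne'

lemma lap_lim {g h : ℝ → ℝ} (hg0 : ∀ v < 0, g v = 0) (hh : ∀ v, 0 ≤ v → h v = 1) (hh0 : ∀ v, 0 ≤ h v)
    (hgi : ∀ δ > 0, Integrable (fun v => δ * exp (-δ * v) * g v))
    (hhi : ∀ δ > 0, Integrable (fun v => δ * exp (-δ * v) * h v) ∧ ∫ v, δ * exp (-δ * v) * h v = 1)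
    (hg : Tendsto g atTop (nhds 0)) :
    Tendsto (fun δ : ℝ => ∫ v, δ * exp (-δ * v) * g v) (nhdsWithin 0 (Set.Ioi 0)) (nhds 0) := by
  rw [Metric.tendsto_nhds]
  intro ε hε
  obtain ⟨V, hV⟩ := eventually_atTop.1 ((Metric.tendsto_nhds.1 hg) (ε / 2) (by positivity))
  set M := ∫ v, ‖1 * exp (-1 * v) * g v‖ with hM
  have hM0 : 0 ≤ M := integral_nonneg fun _ => norm_nonneg _
  have hlim : ∀ᶠ δ : ℝ in nhdsWithin 0 (Set.Ioi 0), δ * (exp V * M) < ε / 2 := by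
    have : Tendsto (fun δ : ℝ => δ * (exp V * M)) (nhdsWithin 0 (Set.Ioi 0)) (nhds (0 * (exp V * M))) :=
      (tendsto_nhdsWithin_of_tendsto_nhds tendsto_id).mul_const _
    rw [zero_mul] at this
    exact this.eventually (gt_mem_nhds (by positivity))
  filter_upwards [hlim, self_mem_nhdsWithin] with δ h1 hδ
  have hδ : 0 < δ := hδ
  rw [dist_zero_right]
  have i1 := (hhi δ hδ).1.const_mul (ε / 2)
  have i2 := ((hgi 1 one_pos).norm).const_mul (δ * exp V)
  refine (norm_integral_le_of_norm_le (i1.add i2) (ae_of_all _ fun v => ?_)).trans_lt ?_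
  · rcases lt_or_ge v 0 with hv | hv
    · rw [hg0 v hv]; have := hh0 v; simp; positivity
    simp only [Pi.add_apply, norm_mul, norm_eq_abs, abs_exp, hh v hv, abs_of_pos hδ, abs_one]
    rcases le_or_gt V v with h2 | h2
    · have := hV v h2
      rw [dist_zero_right, norm_eq_abs] at this
      have : δ * exp (-δ * v) * |g v| ≤ δ * exp (-δ * v) * (ε / 2) := mul_le_mul_of_nonneg_left this.le (by positivity)
      have : 0 ≤ δ * exp V * (1 * exp (-1 * v) * |g v|) := by positivity
      linarith
    · have e1 : exp (-δ * v) ≤ exp V * exp (-1 * v) := by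
        rw [← exp_add]; exact exp_le_exp.2 (by nlinarith)
      have : δ * exp (-δ * v) * |g v| ≤ δ * (exp V * exp (-1 * v)) * |g v| := by gcongr
      have : 0 ≤ ε / 2 * (δ * exp (-δ * v) * 1) := by positivity
      linarith
  · rw [integral_add' i1 i2, integral_const_mul, integral_const_mul, (hhi δ hδ).2]
    linarith

lemma GG_eq {c τ : ℕ → ℝ} {N : ℕ} {v : ℝ} (h0 : c 0 = 0) (h : ∀ n, n ≠ 0 → (τ n ≤ v ↔ n ≤ N)) :
    GG c τ v = ∑ n ∈ Finset.Ioc 0 N, c n := by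
  rw [GG, tsum_eq_sum (s := Finset.Ioc 0 N)]
  · refine Finset.sum_congr rfl fun n hn => if_pos ?_
    rw [Finset.mem_Ioc] at hn
    exact (h n (by omega)).2 hn.2
  · intro n hn
    rw [Finset.mem_Ioc] at hn
    rcases eq_or_ne n 0 with rfl | h1
    · simp [h0]
    · exact if_neg fun h2 => hn ⟨by omega, (h n h1).1 h2⟩

lemma log_floor_lim : Tendsto (fun v : ℝ => log (⌊v⌋₊ : ℝ) - log v) atTop (nhds 0) := by
  have := (tendsto_nat_floor_div_atTop (R := ℝ)).log one_ne_zero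
  rw [log_one] at this
  refine this.congr' ?_
  filter_upwards [eventually_ge_atTop 1] with v hv
  rw [log_div _ (by linarith)]
  exact_mod_cast (Nat.floor_pos.2 hv).ne'

lemma llog_floor_lim : Tendsto (fun v : ℝ => log (log (⌊v⌋₊ : ℝ)) - log (log v)) atTop (nhds 0) := by
  have h1 : Tendsto (fun v : ℝ => (log (⌊v⌋₊ : ℝ) - log v) / log v + 1) atTop (nhds (0 + 1)) :=
    (log_floor_lim.div_atTop tendsto_log_atTop).add_const 1
  have := h1.log (by norm_num)
  rw [zero_add, log_one] at this
  refine this.congr' ?_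
  filter_upwards [eventually_ge_atTop 2] with v hv
  have : 0 < log v := log_pos (by linarith)
  have h2 : 0 < log (⌊v⌋₊ : ℝ) := log_pos (by
    have : 2 ≤ ⌊v⌋₊ := Nat.le_floor (by exact_mod_cast hv)
    exact_mod_cast this)
  rw [← log_div h2.ne' this.ne']
  congr 1; field_simp; ring

lemma sum1 {δ : ℝ} (hδ : 0 < δ) : Summable (fun n : ℕ => lam n / n * exp (-δ * log n)) ∧
    ∑' n : ℕ, lam n / n * exp (-δ * log n) = log (riemannZeta ((1 + δ : ℝ) : ℂ)).re := by
  have e : ∀ n : ℕ, lam n / n * exp (-δ * log n) = ArithmeticFunction.vonMangoldt n / ((n:ℝ) ^ (1 + δ) * log n) := fun n => by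
    rcases eq_or_ne n 0 with rfl | hn
    · simp
    have : (0:ℝ) < n := by positivity
    rw [lam, rpow_add this, rpow_one, rpow_def_of_pos this, show -δ * log n = -(log n * δ) by ring, exp_neg]
    field_simp
  refine ⟨Summable.of_nonneg_of_le (fun n => mul_nonneg (div_nonneg (lam_nonneg n) n.cast_nonneg) (exp_pos _).le) (fun n => ?_)
    (Real.summable_one_div_nat_rpow.2 (show 1 < 1 + δ by linarith)), ?_⟩
  · rcases eq_or_ne n 0 with rfl | hn
    · simp; positivity
    have : (0:ℝ) < n := by positivity
    rw [rpow_add this, rpow_one, rpow_def_of_pos this, show -δ * log n = -(log n * δ) by ring, exp_neg,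
      one_div, mul_inv, div_eq_mul_inv]
    have := lam_le n
    gcongr
    exact mul_le_of_le_one_left (by positivity) this
  · simp_rw [e]
    exact (log_riemannZeta_eq (by linarith)).symm

lemma sum2 {δ : ℝ} (hδ : 0 < δ) : HasSum (fun n : ℕ => 1 / (n:ℝ) * exp (-δ * n)) (-log (1 - exp (-δ))) := by
  have h := Real.hasSum_pow_div_log_of_abs_lt_one (x := exp (-δ)) (by rw [abs_exp]; exact exp_lt_one_iff.2 (by linarith))
  rw [← hasSum_nat_add_iff' 1]
  simp only [Finset.range_one, Finset.sum_singleton, Nat.cast_zero, div_zero, zero_mul, sub_zero]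
  refine h.congr_fun fun n => ?_
  rw [← exp_nat_mul]
  push_cast
  rw [mul_comm _ (-δ)]; ring

lemma exp_lim : Tendsto (fun δ : ℝ => log (1 - exp (-δ)) - log δ) (nhdsWithin 0 (Set.Ioi 0)) (nhds 0) := by
  have h : HasDerivAt (fun δ : ℝ => 1 - exp (-δ)) 1 0 := by
    have := ((hasDerivAt_neg (0:ℝ)).exp).const_sub 1
    simpa using this
  have h1 := (h.tendsto_slope.mono_left (nhdsWithin_mono 0 (s := Set.Ioi 0) fun x hx => (ne_of_gt hx : x ≠ 0))).log one_ne_zero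
  rw [log_one] at h1
  refine h1.congr' ?_
  filter_upwards [self_mem_nhdsWithin] with δ hδ
  have hδ : 0 < δ := hδ
  have : exp (-δ) < 1 := exp_lt_one_iff.2 (by linarith)
  simp only [slope_def_field, neg_zero, exp_zero, sub_self, sub_zero]
  rw [log_div (by linarith) hδ.ne']

lemma AA_gamma : ∀ b, 0 < b → b < 3/5 → ∀ᶠ N : ℕ in atTop,
    |(AA N - log (log N)) - eulerMascheroniConstant| ≤ DD b (log N) + 1 / (N * log N) := by
  obtain ⟨L, hL, hb⟩ := AA_lim
  suffices h : L - eulerMascheroniConstant = 0 by rwa [show eulerMascheroniConstant = L by linarith]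
  set ℓ := L - eulerMascheroniConstant with hℓ
  set G1 := GG (fun n : ℕ => lam n / n) (fun n => log n) with hG1
  set G2 := GG (fun n : ℕ => 1 / (n:ℝ)) (fun n => n) with hG2
  set G0 := GG (fun _ : Unit => (1:ℝ)) (fun _ => 0) with hG0
  have e1 : ∀ v, G1 v = AA ⌊exp v⌋₊ := fun v => GG_eq (by simp) fun n hn => by
    rw [Nat.le_floor_iff (exp_pos v).le, log_le_iff_le_exp (by positivity)]
  have e2 : ∀ v, G2 v = harmonic ⌊v⌋₊ := fun v => by
    rw [hG2, GG_eq (N := ⌊v⌋₊) (by simp) fun n hn => (Nat.le_floor_iff' hn).symm, harmonic_eq_sum_Icc]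
    push_cast
    refine Finset.sum_congr (by ext; simp; omega) fun n _ => by simp
  have e0 : ∀ v, G0 v = if 0 ≤ v then 1 else 0 := fun v => by simp [hG0, GG]
  have I1 := fun (δ : ℝ) (hδ : δ > 0) => lapI (c := fun n : ℕ => lam n / n) (τ := fun n : ℕ => log n)
    (fun n => div_nonneg (lam_nonneg n) n.cast_nonneg) hδ (sum1 hδ).1 (i₀ := 2) (by
      have : lam 2 = 1 := by
        rw [lam, ArithmeticFunction.vonMangoldt_apply_prime Nat.prime_two]; exact div_self (log_pos (by norm_num)).ne'
      rw [this]; norm_num)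
  have I2 := fun (δ : ℝ) (hδ : δ > 0) => lapI (c := fun n : ℕ => 1 / (n:ℝ)) (τ := fun n : ℕ => (n:ℝ))
    (fun n => by positivity) hδ (sum2 hδ).summable (i₀ := 1) (by norm_num)
  have I0 := fun (δ : ℝ) (hδ : δ > 0) => lapI (c := fun _ : Unit => (1:ℝ)) (τ := fun _ => (0:ℝ))
    (fun n => by positivity) hδ (Summable.of_finite) (i₀ := ()) (by norm_num)
  simp only [← hG1, ← hG2, ← hG0] at I1 I2 I0
  have split : ∀ δ v : ℝ, δ * exp (-δ * v) * (G1 v - G2 v - ℓ * G0 v) =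
    δ * exp (-δ * v) * G1 v - δ * exp (-δ * v) * G2 v - ℓ * (δ * exp (-δ * v) * G0 v) := fun δ v => by ring
  have hl := lap_lim (g := fun v => G1 v - G2 v - ℓ * G0 v) (h := G0)
    (fun v hv => by
      simp only [e1, e2, e0, if_neg hv.not_ge, Nat.floor_of_nonpos hv.le, Nat.floor_eq_zero.2 (exp_lt_one_iff.2 hv)]
      simp [AA])
    (fun v hv => by rw [e0, if_pos hv]) (fun v => by rw [e0]; split_ifs <;> norm_num)
    (fun δ hδ => by
      simp_rw [split]
      exact ((I1 δ hδ).1.sub (I2 δ hδ).1).sub ((I0 δ hδ).1.const_mul ℓ))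
    (fun δ hδ => ⟨(I0 δ hδ).1, by rw [(I0 δ hδ).2]; simp⟩)
    (by
      have a1 := (hL.comp (tendsto_nat_floor_atTop (α := ℝ))).comp tendsto_exp_atTop
      have a2 := llog_floor_lim.comp tendsto_exp_atTop
      have a3 := tendsto_harmonic_sub_log.comp (tendsto_nat_floor_atTop (α := ℝ))
      have := ((a1.add a2).sub (a3.add log_floor_lim)).sub_const ℓ
      rw [show L + 0 - (eulerMascheroniConstant + 0) - ℓ = 0 by rw [hℓ]; ring] at this
      refine this.congr' ?_
      filter_upwards [eventually_ge_atTop 0] with v hv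
      simp only [Function.comp, e1, e2, e0, if_pos hv, log_exp]
      ring)
  have hl2 : Tendsto (fun δ : ℝ => log (riemannZeta ((1 + δ : ℝ) : ℂ)).re + log (1 - exp (-δ)) - ℓ)
      (nhdsWithin 0 (Set.Ioi 0)) (nhds 0) := by
    refine hl.congr' ?_
    filter_upwards [self_mem_nhdsWithin] with δ hδ
    have hδ : 0 < δ := hδ
    simp_rw [split]
    rw [integral_sub (f := fun v => δ * exp (-δ * v) * G1 v - δ * exp (-δ * v) * G2 v) ((I1 δ hδ).1.sub (I2 δ hδ).1) ((I0 δ hδ).1.const_mul ℓ), integral_sub (I1 δ hδ).1 (I2 δ hδ).1,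
      integral_const_mul, (I1 δ hδ).2, (I2 δ hδ).2, (I0 δ hδ).2, (sum1 hδ).2, (sum2 hδ).tsum_eq]
    simp
  have hz := log_riemannZeta_add_log_sub_isLittleO_ofReal.tendsto_div_nhds_zero
  have hs : Tendsto (fun δ : ℝ => 1 + δ) (nhdsWithin 0 (Set.Ioi 0)) (nhdsWithin 1 (Set.Ioi 1)) := by
    refine tendsto_nhdsWithin_iff.2 ⟨?_, ?_⟩
    · have : Tendsto (fun δ : ℝ => 1 + δ) (nhds 0) (nhds (1 + 0)) := (continuous_const.add continuous_id).tendsto 0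
      rw [add_zero] at this
      exact this.mono_left nhdsWithin_le_nhds
    · filter_upwards [self_mem_nhdsWithin] with δ hδ
      have hδ : 0 < δ := hδ
      exact (by linarith : 1 < 1 + δ)
  have hfin := ((hz.comp hs).add exp_lim).sub hl2
  have : Tendsto (fun _ : ℝ => ℓ) (nhdsWithin 0 (Set.Ioi 0)) (nhds (0 + 0 - 0)) := by
    refine hfin.congr fun δ => ?_
    simp only [Function.comp, add_sub_cancel_left, div_one]
    ring
  simpa using tendsto_nhds_unique tendsto_const_nhds this

noncomputable def ww (x t : ℝ) : ℝ := (⌊x / t⌋₊ : ℝ) / log t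
noncomputable def FS (x : ℝ) : ℝ := ∑ n ∈ Finset.Ioc 0 ⌊x⌋₊, lam n * ⌊x / n⌋₊

lemma ww_anti {x : ℝ} (hx : 0 ≤ x) : AntitoneOn (ww x) (Set.Ici 2) := by
  intro s hs t ht hst
  have hs : (2:ℝ) ≤ s := hs
  have : 0 < log s := log_pos (by linarith)
  refine div_le_div₀ (Nat.cast_nonneg _) (Nat.cast_le.2 (Nat.floor_le_floor ?_)) this (log_le_log (by linarith) hst)
  exact div_le_div_of_nonneg_left hx (by linarith) hst

lemma ww_nonneg {x t : ℝ} (ht : 2 ≤ t) : 0 ≤ ww x t := div_nonneg (Nat.cast_nonneg _) (log_pos (by linarith)).le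

lemma ww_int {x a b : ℝ} (hx : 0 ≤ x) (ha : 2 ≤ a) (hb : 2 ≤ b) : IntervalIntegrable (ww x) volume a b :=
  ((ww_anti hx).mono fun t ht => by
    rw [Set.mem_uIcc] at ht; show (2:ℝ) ≤ t; rcases ht with h | h <;> linarith).intervalIntegrable

lemma llog_cont {a b : ℝ} (ha : 2 ≤ a) (hb : 2 ≤ b) : (∀ t ∈ Set.uIcc a b, HasDerivAt (fun t => log (log t)) (t⁻¹ / log t) t) ∧
    IntervalIntegrable (fun t => t⁻¹ / log t) volume a b := by
  have h : ∀ t ∈ Set.uIcc a b, 2 ≤ t := fun t ht => by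
    rw [Set.mem_uIcc] at ht; rcases ht with h | h <;> linarith
  refine ⟨fun t ht => ((hasDerivAt_log (by linarith [h t ht])).log (log_pos (by linarith [h t ht])).ne'), 
    ContinuousOn.intervalIntegrable fun t ht => ?_⟩
  have := h t ht
  exact ((continuousAt_inv₀ (by linarith)).div (continuousAt_log (by linarith)) (log_pos (by linarith)).ne').continuousWithinAt

lemma fract_eq {x t : ℝ} (hx : 0 ≤ x) (ht : 0 ≤ t) : Int.fract (x / t) / log t = x * (t⁻¹ / log t) - ww x t := by
  rw [ww, natCast_floor_eq_intCast_floor (div_nonneg hx ht), Int.fract]; ring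

lemma fract_int {x a b : ℝ} (hx : 0 ≤ x) (ha : 2 ≤ a) (hb : 2 ≤ b) :
    IntervalIntegrable (fun t => Int.fract (x / t) / log t) volume a b ∧
    ∫ t in a..b, Int.fract (x / t) / log t = x * (log (log b) - log (log a)) - ∫ t in a..b, ww x t := by
  have e : Set.EqOn (fun t => x * (t⁻¹ / log t) - ww x t) (fun t => Int.fract (x / t) / log t) (Set.uIcc a b) := fun t ht => by
    refine (fract_eq hx ?_).symm
    rw [Set.mem_uIcc] at ht; rcases ht with h | h <;> linarith
  obtain ⟨h1, h2⟩ := llog_cont ha hb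
  refine ⟨((h2.const_mul x).sub (ww_int hx ha hb)).congr (e.mono Set.uIoc_subset_uIcc), ?_⟩
  rw [← intervalIntegral.integral_congr e, intervalIntegral.integral_sub (h2.const_mul x) (ww_int hx ha hb),
    intervalIntegral.integral_const_mul, intervalIntegral.integral_eq_sub_of_hasDerivAt h1 h2]

lemma F_core {x : ℝ} {N : ℕ} {a B : ℝ} (hN : 3 ≤ N) (hNx : N ≤ ⌊x⌋₊)
    (ha : |(AA N - log (log N)) - eulerMascheroniConstant| ≤ a)
    (hB : ∀ n, N ≤ n → n ≤ ⌊x⌋₊ → |∑ i ∈ Finset.Ioc 0 n, cr i| ≤ B) :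
    |FS x - (x * log (log x) + eulerMascheroniConstant * x - lif x)| ≤ x * a + 3 * N + 2 * B * (x / N) + x / N + 2 := by
  set X := ⌊x⌋₊ with hX
  have hN' : (3:ℝ) ≤ N := by exact_mod_cast hN
  have hNX : (N:ℝ) ≤ X := by exact_mod_cast hNx
  have hx0 : 0 ≤ x := by
    by_contra h
    rw [hX, Nat.floor_of_nonpos (by linarith)] at hNx; omega
  have hXx : (X:ℝ) ≤ x := Nat.floor_le hx0
  have hxX : x < X + 1 := Nat.lt_floor_add_one x
  have hlN : 1 ≤ log N := by
    rw [le_log_iff_exp_le (by linarith)]; linarith [exp_one_lt_d9]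
  have hwN : ww x N ≤ x / N := (div_le_self (Nat.cast_nonneg _) hlN).trans (Nat.floor_le (by positivity))
  have hwN0 : 0 ≤ ww x N := ww_nonneg (by linarith)
  have hwa : ∀ n : ℕ, N ≤ n → ww x (n+1:ℕ) ≤ ww x n := fun n hn => by
    have : (N:ℝ) ≤ n := by exact_mod_cast hn
    refine ww_anti hx0 (Set.mem_Ici.2 (by linarith)) (Set.mem_Ici.2 (by push_cast; linarith)) (by push_cast; linarith)
  have hw0 : ∀ n : ℕ, N ≤ n → 0 ≤ ww x n := fun n hn => by
    have : (N:ℝ) ≤ n := by exact_mod_cast hn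
    exact ww_nonneg (by linarith)
  have hB0 : 0 ≤ B := (abs_nonneg _).trans (hB N le_rfl hNx)
  have E2 := abel_real (w := fun n => ww x n) hNx hwa hw0 hB
  have E2' : 2 * B * ww x N ≤ 2 * B * (x / N) := by gcongr
  have hR1 : ∃ R : ℝ, 0 ≤ R ∧ R ≤ N ∧ ∑ n ∈ Finset.Ioc 0 N, lam n * ⌊x / n⌋₊ = x * AA N - R := by
    refine ⟨∑ n ∈ Finset.Ioc 0 N, lam n * (x / n - ⌊x / n⌋₊), Finset.sum_nonneg fun n _ => mul_nonneg (lam_nonneg n) ?_, ?_, ?_⟩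
    · linarith [Nat.floor_le (show 0 ≤ x / n by positivity)]
    · refine (Finset.sum_le_card_nsmul _ _ 1 fun n _ => ?_).trans (by simp)
      have : x / n - ⌊x / n⌋₊ ≤ 1 := by linarith [Nat.lt_floor_add_one (x / n)]
      exact (mul_le_of_le_one_right (lam_nonneg n) this).trans (lam_le n)
    · rw [AA, Finset.mul_sum, ← Finset.sum_sub_distrib]
      exact Finset.sum_congr rfl fun n _ => by ring
  obtain ⟨R1, r1, r2, r3⟩ := hR1
  have hsplit : FS x = ∑ n ∈ Finset.Ioc 0 N, lam n * ⌊x / n⌋₊ + (∑ i ∈ Finset.Ioc N X, ww x i * cr i + ∑ i ∈ Finset.Ioc N X, ww x i) := by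
    rw [FS, ← Finset.sum_Ioc_consecutive _ (Nat.zero_le N) hNx, ← Finset.sum_add_distrib]
    congr 1
    exact Finset.sum_congr rfl fun n _ => by rw [lam, ww, cr]; ring
  obtain ⟨i1, -⟩ := fract_int hx0 le_rfl (show (2:ℝ) ≤ N by linarith)
  obtain ⟨i2, i3⟩ := fract_int hx0 (show (2:ℝ) ≤ N by linarith) (show (2:ℝ) ≤ x by linarith)
  have hl : lif x = (∫ t in (2:ℝ)..N, Int.fract (x / t) / log t) + ∫ t in (N:ℝ)..x, Int.fract (x / t) / log t :=
    (intervalIntegral.integral_add_adjacent_intervals i1 i2).symm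
  have R2a : 0 ≤ ∫ t in (2:ℝ)..N, Int.fract (x / t) / log t :=
    intervalIntegral.integral_nonneg (by linarith) fun t ht => div_nonneg (Int.fract_nonneg _) (log_nonneg (by linarith [ht.1]))
  have R2b : ∫ t in (2:ℝ)..N, Int.fract (x / t) / log t ≤ 2 * N := by
    have := intervalIntegral.integral_mono_on (g := fun _ => (2:ℝ)) (show (2:ℝ) ≤ N by linarith) i1 intervalIntegrable_const fun t ht => by
      have h1 : log 2 ≤ log t := log_le_log (by norm_num) ht.1
      have h2 : 0 < log t := by linarith [log_two_gt_d9]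
      rw [div_le_iff₀ h2]
      linarith [log_two_gt_d9, Int.fract_lt_one (x / t)]
    rw [intervalIntegral.integral_const, smul_eq_mul] at this
    linarith
  have hadj := intervalIntegral.integral_add_adjacent_intervals (ww_int hx0 (show (2:ℝ) ≤ N by linarith) (show (2:ℝ) ≤ X by linarith))
    (ww_int hx0 (show (2:ℝ) ≤ X by linarith) (show (2:ℝ) ≤ x by linarith))
  have E4a : 0 ≤ ∫ t in (X:ℝ)..x, ww x t := intervalIntegral.integral_nonneg hXx fun t ht => ww_nonneg (by linarith [ht.1])
  have E4b : ∫ t in (X:ℝ)..x, ww x t ≤ 2 := by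
    have := intervalIntegral.integral_mono_on (g := fun _ => (2:ℝ)) hXx (ww_int hx0 (show (2:ℝ) ≤ X by linarith) (show (2:ℝ) ≤ x by linarith)) intervalIntegrable_const fun t ht => by
      have hl1 : log N ≤ log t := log_le_log (by linarith) (by linarith [ht.1])
      refine (div_le_self (Nat.cast_nonneg _) (by linarith)).trans ((Nat.floor_le (div_nonneg hx0 (by linarith [ht.1]))).trans ?_)
      rw [div_le_iff₀ (by linarith [ht.1])]
      linarith [ht.1]
    rw [intervalIntegral.integral_const, smul_eq_mul] at this
    linarith
  have hanti : AntitoneOn (ww x) (Set.Icc (N:ℝ) X) := (ww_anti hx0).mono fun t ht => by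
    show (2:ℝ) ≤ t; linarith [ht.1]
  have s1 := AntitoneOn.sum_le_integral_Ico hNx hanti
  have s2 := AntitoneOn.integral_le_sum_Ico hNx hanti
  rw [Finset.sum_Ico_add' (fun i : ℕ => ww x i) N X 1, show Finset.Ico (N+1) (X+1) = Finset.Ioc N X by ext; simp] at s1
  have s3 : ∑ i ∈ Finset.Ico N X, ww x i ≤ ∑ i ∈ Finset.Icc N X, ww x i :=
    Finset.sum_le_sum_of_subset_of_nonneg Finset.Ico_subset_Icc_self fun i hi _ => hw0 i (Finset.mem_Icc.1 hi).1
  rw [← Finset.add_sum_Ioc_eq_sum_Icc hNx] at s3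
  have E1 : |x * ((AA N - log (log N)) - eulerMascheroniConstant)| ≤ x * a := by
    rw [abs_mul, abs_of_nonneg hx0]; gcongr
  rw [abs_le] at E1 E2 ⊢
  rw [hsplit, r3, hl, i3]
  constructor <;> linarith

theorem F_asym {b : ℝ} (hb : 0 < b) (hb1 : b < 3/5) : ∀ᶠ x : ℝ in atTop,
    |FS x - (x * log (log x) + eulerMascheroniConstant * x - lif x)| ≤ 300 * x * exp (-((log x) ^ b / 16)) := by
  obtain ⟨N1, h1⟩ := eventually_atTop.1 (AA_gamma b hb hb1)
  obtain ⟨N2, h2⟩ := eventually_atTop.1 (psi_bd hb hb1)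
  filter_upwards [tendsto_log_atTop.eventually_ge_atTop (2 * (N1 + N2 + 3)), eventually_gt_atTop 0] with x hy hx
  set y := log x with hyd
  have hc1 : (0:ℝ) ≤ N1 := Nat.cast_nonneg _
  have hc2 : (0:ℝ) ≤ N2 := Nat.cast_nonneg _
  have hy4 : 6 ≤ y := by linarith
  have hxy : x = exp y := (exp_log hx).symm
  have hq0 : 0 < y ^ b := by positivity
  have hqy : y ^ b ≤ y := by
    conv_rhs => rw [← rpow_one y]
    exact rpow_le_rpow_of_exponent_le (by linarith) (by linarith)
  set q := y ^ b with hq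
  set K := exp (q / 16) with hK
  have hK0 : 0 < K := exp_pos _
  have hK1 : 1 ≤ K := one_le_exp (by positivity)
  have hinv : exp (-(q / 16)) = 1 / K := by rw [exp_neg, one_div]
  have hxK : x / K = exp (y - q / 16) := by rw [hxy, hK, exp_sub]
  have hbig : 2 * exp (y / 2) ≤ x / K := by
    have e1 : exp (y / 2 + 1) ≤ exp (y - q / 16) := exp_le_exp.2 (by linarith)
    rw [exp_add] at e1
    have : (2:ℝ) ≤ exp 1 := by linarith [exp_one_gt_d9]
    rw [hxK]
    nlinarith [exp_pos (y / 2)]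
  have hone : y / 2 + 1 ≤ exp (y / 2) := add_one_le_exp _
  set N := ⌊x / K⌋₊ with hN
  have hNle : (N:ℝ) ≤ x / K := Nat.floor_le (by positivity)
  have hNgt : x / K < N + 1 := Nat.lt_floor_add_one _
  have hNe : exp (y / 2) ≤ N := by linarith
  have hN3 : 3 ≤ N := by
    have : (3:ℝ) ≤ N := by linarith
    exact_mod_cast this
  have hN1 : N1 ≤ N := by
    have : (N1:ℝ) ≤ N := by linarith
    exact_mod_cast this
  have hN2 : N2 ≤ N := by
    have : (N2:ℝ) ≤ N := by linarith
    exact_mod_cast this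
  have hN0 : (0:ℝ) < N := by linarith [exp_pos (y / 2)]
  have hNx : N ≤ ⌊x⌋₊ := Nat.floor_le_floor (div_le_self hx.le hK1)
  have hxN : x / N ≤ 2 * K := by
    rw [div_le_iff₀ hN0]
    have : x / K ≤ 2 * N := by linarith
    rw [div_le_iff₀ hK0] at this
    linarith
  have hlog : ∀ n : ℕ, N ≤ n → q / 2 ≤ (log n) ^ b := fun n hn => by
    have : (N:ℝ) ≤ n := by exact_mod_cast hn
    have : y / 2 ≤ log n := by rw [le_log_iff_exp_le (by linarith)]; linarith
    have e1 : (y / 2) ^ b ≤ (log n) ^ b := rpow_le_rpow (by linarith) this hb.le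
    have e2 : (2:ℝ) ^ b ≤ 2 := by
      conv_rhs => rw [← rpow_one 2]
      exact rpow_le_rpow_of_exponent_le (by norm_num) (by linarith)
    rw [div_rpow (by linarith) (by norm_num)] at e1
    have : q / 2 ≤ y ^ b / 2 ^ b := by rw [← hq]; gcongr
    linarith
  have hlN : 1 ≤ log N := by
    rw [le_log_iff_exp_le hN0]
    have : (3:ℝ) ≤ N := by exact_mod_cast hN3
    linarith [exp_one_lt_d9]
  have hD : DD b (log N) ≤ 1 / K := by
    rw [DD]
    refine (div_le_self (exp_pos _).le hlN).trans ?_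
    rw [← hinv]
    exact exp_le_exp.2 (by linarith [hlog N le_rfl])
  have hB : ∀ n, N ≤ n → n ≤ ⌊x⌋₊ → |∑ i ∈ Finset.Ioc 0 n, cr i| ≤ 50 * x * exp (-(q / 4)) := fun n a1 a2 => by
    refine (h2 n (hN2.trans a1)).trans ?_
    have : (n:ℝ) ≤ x := (Nat.cast_le.2 a2).trans (Nat.floor_le hx.le)
    have : exp (-((log n) ^ b / 2)) ≤ exp (-(q / 4)) := exp_le_exp.2 (by linarith [hlog n a1])
    gcongr
  have hmain := F_core hN3 hNx (h1 N hN1) hB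
  refine hmain.trans ?_
  have hKx : K ≤ x / K := by rw [hxK]; exact exp_le_exp.2 (by linarith)
  have t1 : x * DD b (log N) ≤ x / K := by
    rw [div_eq_mul_one_div x K]; gcongr
  have t2 : x * (1 / (N * log N)) ≤ 2 * K := by
    refine le_trans ?_ hxN
    rw [div_eq_mul_one_div x]
    gcongr
    exact le_mul_of_one_le_right hN0.le hlN
  have t3 : 2 * (50 * x * exp (-(q / 4))) * (x / N) ≤ 200 * (x / K) := by
    have e1 : exp (-(q / 4)) * K ≤ 1 / K := by
      rw [← hinv, hK, ← exp_add]; exact exp_le_exp.2 (by linarith)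
    calc 2 * (50 * x * exp (-(q / 4))) * (x / N) ≤ 2 * (50 * x * exp (-(q / 4))) * (2 * K) := by gcongr
      _ = 200 * x * (exp (-(q / 4)) * K) := by ring
      _ ≤ 200 * x * (1 / K) := by gcongr
      _ = _ := by ring
  have : 300 * x * exp (-(q / 16)) = 300 * (x / K) := by rw [hinv]; ring
  rw [this, mul_add]
  linarith

lemma omega_sum (x : ℝ) : ∑ n ∈ Finset.Icc 1 ⌊x⌋₊, (n.primeFactors.card : ℝ) = ∑' p : Nat.Primes, (⌊x / (p:ℕ)⌋₊ : ℝ) := by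
  have h : ∑' p : Nat.Primes, (⌊x / (p:ℕ)⌋₊ : ℝ) = ∑ p ∈ (Finset.Ioc 0 ⌊x⌋₊).filter Nat.Prime, (⌊x / (p:ℕ)⌋₊ : ℝ) := by
    rw [show (∑' p : Nat.Primes, (⌊x / (p:ℕ)⌋₊ : ℝ)) = ∑' p : ℕ, Set.indicator {p | Nat.Prime p} (fun p : ℕ => (⌊x / p⌋₊ : ℝ)) p from
      tsum_subtype {p | Nat.Prime p} (fun p : ℕ => (⌊x / p⌋₊ : ℝ)), tsum_eq_sum (s := Finset.Ioc 0 ⌊x⌋₊), Finset.sum_filter]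
    · exact Finset.sum_congr rfl fun p _ => by simp [Set.indicator_apply]
    · intro p hp
      rw [Finset.mem_Ioc] at hp
      by_cases h : Nat.Prime p
      · rw [Set.indicator_of_mem (show p ∈ {p | Nat.Prime p} from h), Nat.floor_div_natCast, Nat.div_eq_of_lt, Nat.cast_zero]
        have := h.pos; omega
      · exact Set.indicator_of_notMem h _
  rw [h]
  have e : ∀ n ∈ Finset.Icc 1 ⌊x⌋₊, (n.primeFactors.card : ℝ) = ∑ p ∈ (Finset.Ioc 0 ⌊x⌋₊).filter Nat.Prime, if p ∣ n then (1:ℝ) else 0 := fun n hn => by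
    rw [Finset.mem_Icc] at hn
    rw [Finset.sum_boole, Finset.filter_filter]
    congr 2
    ext p
    simp only [Nat.mem_primeFactors, Finset.mem_filter, Finset.mem_Ioc]
    constructor
    · rintro ⟨a, b, c⟩; exact ⟨⟨a.pos, (Nat.le_of_dvd (by omega) b).trans hn.2⟩, a, b⟩
    · rintro ⟨-, a, b⟩; exact ⟨a, b, by omega⟩
  rw [Finset.sum_congr rfl e, Finset.sum_comm]
  refine Finset.sum_congr rfl fun p _ => ?_
  rw [Finset.sum_boole, Nat.floor_div_natCast, ← Nat.Ioc_filter_dvd_card_eq_div]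
  rfl

lemma lam_pp (p : Nat.Primes) (k : ℕ) : lam ((p:ℕ) ^ (k + 1)) = 1 / (k + 1) := by
  have : log (p:ℕ) ≠ 0 := (log_pos (by exact_mod_cast p.2.one_lt)).ne'
  rw [lam, ArithmeticFunction.vonMangoldt_apply_pow (by omega), ArithmeticFunction.vonMangoldt_apply_prime p.2]
  push_cast
  rw [log_pow]
  push_cast
  field_simp

noncomputable def gg (x : ℝ) (q : Nat.Primes × ℕ) : ℝ := 1 / (q.2 + 2) * ⌊x / ((q.1:ℕ):ℝ) ^ (q.2 + 2)⌋₊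
noncomputable def hh (q : Nat.Primes × ℕ) : ℝ := 1 / ((q.2 + 2) * ((q.1:ℕ):ℝ) ^ (q.2 + 2))
noncomputable def HH (q : Nat.Primes × ℕ) : ℝ := (((q.1:ℕ):ℝ) ^ (q.2 + 2)) ^ (-(3/4) : ℝ)

lemma FS_split (x : ℝ) : FS x = ∑ n ∈ Finset.Icc 1 ⌊x⌋₊, (n.primeFactors.card : ℝ) + ∑' p : Nat.Primes, ∑' k : ℕ, gg x (p, k) := by
  have hz : ∀ m ∉ Finset.Ioc 0 ⌊x⌋₊, lam m * ⌊x / m⌋₊ = 0 := fun m hm => by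
    rw [Finset.mem_Ioc] at hm
    rcases eq_or_ne m 0 with rfl | h
    · simp
    · rw [Nat.floor_div_natCast, Nat.div_eq_of_lt (by omega)]; simp
  have H : HasSum (fun m : ℕ => lam m * ⌊x / m⌋₊) _ := hasSum_sum_of_ne_finset_zero hz
  rw [FS, ← H.tsum_eq, tsum_eq_tsum_primes_add_tsum_primes_of_support_subset_prime_powers H.summable, omega_sum]
  · congr 1
    · refine tsum_congr fun p => ?_
      have := lam_pp p 0
      rw [zero_add, pow_one] at this
      rw [this]; simp
    · refine tsum_congr fun p => tsum_congr fun k => ?_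
      rw [gg, lam_pp p (k + 1)]
      push_cast
      ring_nf
  · intro m hm
    by_contra h
    refine hm ?_
    show lam m * _ = 0
    rw [lam, ArithmeticFunction.vonMangoldt_eq_zero_iff.2 h]; simp

lemma HH_sum : Summable HH := by
  have h2 : (2:ℝ) ^ (-(3/4) : ℝ) < 1 := rpow_lt_one_of_one_lt_of_neg (by norm_num) (by norm_num)
  refine Summable.of_nonneg_of_le (fun q => by rw [HH]; positivity) (fun q => ?_)
    (Summable.mul_of_nonneg (Nat.Primes.summable_rpow.2 (show (-(3/2) : ℝ) < -1 by norm_num))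
    (summable_geometric_of_lt_one (by positivity) h2) (fun p => by positivity) (fun k => by positivity))
  have hp : (2:ℝ) ≤ (q.1:ℕ) := by exact_mod_cast q.1.2.two_le
  rw [HH, ← rpow_natCast, ← rpow_mul (by linarith), mul_comm, rpow_mul (by linarith), rpow_natCast, pow_add, mul_comm]
  refine mul_le_mul (le_of_eq ?_) (pow_le_pow_left₀ (by positivity) ?_ _) (by positivity) (by positivity)
  · rw [← rpow_natCast, ← rpow_mul (by linarith)]; norm_num
  · exact rpow_le_rpow_of_nonpos (by norm_num) hp (by norm_num)

lemma gh_bd {x : ℝ} (hx : 0 < x) (q : Nat.Primes × ℕ) : 0 ≤ x * hh q - gg x q ∧ x * hh q - gg x q ≤ x ^ (3/4 : ℝ) * HH q := by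
  have hp : (0:ℝ) < (q.1:ℕ) := by exact_mod_cast q.1.2.pos
  rw [hh, gg, HH]
  obtain ⟨P, hP⟩ : ∃ P, P = ((q.1:ℕ):ℝ) ^ (q.2 + 2) := ⟨_, rfl⟩
  rw [← hP]
  have hP0 : 0 < P := by rw [hP]; positivity
  have e : x * (1 / ((q.2 + 2) * P)) - 1 / (q.2 + 2) * ⌊x / P⌋₊ = 1 / (q.2 + 2) * (x / P - ⌊x / P⌋₊) := by
    field_simp
  rw [e, rpow_neg hP0.le, ← div_eq_mul_inv, ← div_rpow hx.le hP0.le]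
  have hu : 0 < x / P := by positivity
  have f1 := Nat.floor_le hu.le
  have f2 := Nat.lt_floor_add_one (x / P)
  refine ⟨mul_nonneg (by positivity) (by linarith), (mul_le_of_le_one_left (by linarith) ?_).trans ?_⟩
  · rw [div_le_one (by positivity)]; linarith [(Nat.cast_nonneg q.2 : (0:ℝ) ≤ q.2)]
  · rcases le_or_gt 1 (x / P) with h | h
    · linarith [one_le_rpow h (show (0:ℝ) ≤ 3/4 by norm_num)]
    · have := rpow_le_rpow_of_exponent_ge hu h.le (show (3/4:ℝ) ≤ 1 by norm_num)
      rw [rpow_one] at this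
      linarith [(Nat.cast_nonneg ⌊x / P⌋₊ : (0:ℝ) ≤ _)]

lemma hh_sum : Summable hh := by
  refine Summable.of_nonneg_of_le (fun q => by rw [hh]; positivity) (fun q => ?_) HH_sum
  have := (gh_bd (x := 1) (by norm_num) q).2
  have g1 : gg 1 q = 0 := by
    have hp : (1:ℝ) < (q.1:ℕ) := by exact_mod_cast q.1.2.one_lt
    rw [gg, Nat.floor_eq_zero.2]
    · simp
    · rw [div_lt_one (by positivity)]
      exact one_lt_pow₀ hp (by omega)
  rw [g1, one_rpow] at this
  linarith

lemma pp_bd {x : ℝ} (hx : 0 < x) : |x * (∑' p : Nat.Primes, ∑' k : ℕ, hh (p, k)) - ∑' p : Nat.Primes, ∑' k : ℕ, gg x (p, k)|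
    ≤ x ^ (3/4 : ℝ) * ∑' q, HH q := by
  have hd : Summable fun q => x * hh q - gg x q :=
    Summable.of_nonneg_of_le (fun q => (gh_bd hx q).1) (fun q => (gh_bd hx q).2) (HH_sum.mul_left _)
  have hg : Summable (gg x) := ((hh_sum.mul_left x).sub hd).congr fun q => by ring
  rw [← hh_sum.tsum_prod, ← hg.tsum_prod, ← tsum_mul_left, ← tsum_mul_left, ← (hh_sum.mul_left x).tsum_sub hg,
    abs_of_nonneg (tsum_nonneg fun q => (gh_bd hx q).1)]
  exact hd.tsum_le_tsum (fun q => (gh_bd hx q).2) (HH_sum.mul_left _)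

theorem omega_asym {b : ℝ} (hb : 0 < b) (hb1 : b < 3/5) : ∃ C > 0, ∀ᶠ x : ℝ in atTop,
    |(∑ n ∈ Finset.Icc 1 ⌊x⌋₊, (n.primeFactors.card : ℝ)) - (x * log (log x) + mertensB1 * x - lif x)|
      ≤ C * x * exp (-((log x) ^ b / 16)) := by
  have hS0 : 0 ≤ ∑' q, HH q := tsum_nonneg fun q => by rw [HH]; positivity
  refine ⟨300 + ∑' q, HH q, by linarith, ?_⟩
  filter_upwards [F_asym hb hb1, eventually_ge_atTop (exp 1)] with x h1 hx
  have hx0 : 0 < x := (exp_pos 1).trans_le hx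
  have hy : 1 ≤ log x := by rwa [le_log_iff_exp_le hx0]
  have h2 := pp_bd hx0
  have hm : mertensB1 = eulerMascheroniConstant - ∑' p : Nat.Primes, ∑' k : ℕ, hh (p, k) := rfl
  have h3 : x ^ (3/4 : ℝ) ≤ x * exp (-((log x) ^ b / 16)) := by
    have : (log x) ^ b ≤ log x := by
      conv_rhs => rw [← rpow_one (log x)]
      exact rpow_le_rpow_of_exponent_le hy (by linarith)
    calc x ^ (3/4 : ℝ) = exp (log x * (3/4)) := rpow_def_of_pos hx0 _
      _ ≤ exp (log x + -((log x) ^ b / 16)) := exp_le_exp.2 (by linarith)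
      _ = _ := by rw [exp_add, exp_log hx0]
  have h4 : x ^ (3/4 : ℝ) * ∑' q, HH q ≤ x * exp (-((log x) ^ b / 16)) * ∑' q, HH q := mul_le_mul_of_nonneg_right h3 hS0
  rw [FS_split] at h1
  rw [hm]
  rw [abs_le] at h1 h2 ⊢
  constructor <;> linarith

end VK

theorem sum_omega_asymptotic :
    ∀ ε > (0:ℝ), ∃ c > (0:ℝ), ∃ C > (0:ℝ), ∀ᶠ x : ℝ in atTop,
      |(∑ n ∈ Finset.Icc 1 ⌊x⌋₊, (n.primeFactors.card : ℝ)) -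
          (x * Real.log (Real.log x) + mertensB1 * x - lif x)| ≤
        C * x * Real.exp (-c * (Real.log x) ^ ((3:ℝ)/5 - ε)) := by
  intro ε hε
  obtain ⟨b, hb, hb1, hbe⟩ : ∃ b : ℝ, 0 < b ∧ b < 3/5 ∧ 3/5 - ε ≤ b :=
    ⟨max (1/2) (3/5 - ε), by positivity, max_lt (by norm_num) (by linarith), le_max_right _ _⟩
  obtain ⟨C, hC, h⟩ := VK.omega_asym hb hb1
  refine ⟨1/16, by norm_num, C, hC, ?_⟩
  filter_upwards [h, eventually_ge_atTop (exp 1)] with x h1 hx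
  have hx0 : 0 < x := (exp_pos 1).trans_le hx
  have hy : 1 ≤ log x := by rwa [le_log_iff_exp_le hx0]
  refine h1.trans (mul_le_mul_of_nonneg_left (exp_le_exp.2 ?_) (by positivity))
  linarith [rpow_le_rpow_of_exponent_le hy hbe]
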